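/- arXiv:2110.01862 — 2 statements merged into one kernel-verified Lean document; each statement's English description precedes it below -/
import Mathlib

section
/- If G is a 4-critical graph on n vertices, then G has at least (5n − 2)/3 edges. -/
open SimpleGraph

noncomputable section

/-- The setoid on darts whose classes are the cycles (orbits) of the face permutation `φ`. -/
def faceSetoid {V : Type} (G : SimpleGraph V) (φ : Equiv.Perm G.Dart) : Setoid G.Dart :=
  ⟨φ.SameCycle, ⟨fun _ => Equiv.Perm.SameCycle.refl φ _, fun h => h.symm, fun h₁ h₂ => h₁.trans h₂⟩⟩

/-- A combinatorial plane embedding of a finite simple graph `G`: a face-successor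
permutation of the darts (equivalently, a rotation system) satisfying Euler's formula,
which forces genus zero. Faces are the orbits of `φ`. -/
structure PlaneEmbedding {V : Type} [Fintype V] (G : SimpleGraph V) where
  φ : Equiv.Perm G.Dart
  succ_tail : ∀ d : G.Dart, (φ d).toProd.1 = d.toProd.2
  euler : Fintype.card V + Nat.card (Quotient (faceSetoid G φ))
      + Nat.card {v : V // G.neighborSet v = ∅}
      = Nat.card G.edgeSet + 2 * Nat.card G.ConnectedComponent

/-- A finite simple graph is planar if it admits a plane embedding. -/
def IsPlanar {V : Type} [Fintype V] (G : SimpleGraph V) : Prop :=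
  Nonempty (PlaneEmbedding G)

/-- The length of the face of the dart `d`: the number of darts on its boundary walk. -/
def faceLength {V : Type} [Fintype V] {G : SimpleGraph V} (emb : PlaneEmbedding G)
    (d : G.Dart) : ℕ :=
  Nat.card {d' : G.Dart | emb.φ.SameCycle d d'}

/-- The vertices on the boundary of the face of the dart `d`. -/
def faceVerts {V : Type} [Fintype V] {G : SimpleGraph V} (emb : PlaneEmbedding G)
    (d : G.Dart) : Set V :=
  {v : V | ∃ d' : G.Dart, emb.φ.SameCycle d d' ∧ d'.toProd.1 = v}

/-- A graph is `4`-critical if its chromatic number equals `4` and deleting any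
vertex or any edge yields a graph of chromatic number less than `4`. -/
def IsFourCritical {V : Type} [Fintype V] (G : SimpleGraph V) : Prop :=
  G.chromaticNumber = 4 ∧
  (∀ v : V, (G.induce {u : V | u ≠ v}).chromaticNumber < 4) ∧
  (∀ e ∈ G.edgeSet, (G.deleteEdges {e}).chromaticNumber < 4)

namespace KostochkaYancey

open scoped Classical

variable {V : Type}

/-- The number of ordered pairs in `A × B` that are adjacent in `G`. -/
def adjPairs (G : SimpleGraph V) (A B : Finset V) : ℕ :=
  ∑ a ∈ A, ∑ b ∈ B, if G.Adj a b then 1 else 0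

/-- `G` restricted to the vertex set `W` is properly 3-colorable. -/
def ThreeColorableOn (G : SimpleGraph V) (W : Finset V) : Prop :=
  ∃ c : V → Fin 3, ∀ a ∈ W, ∀ b ∈ W, G.Adj a b → c a ≠ c b

lemma adjPairs_comm (G : SimpleGraph V) (A B : Finset V) :
    adjPairs G A B = adjPairs G B A := by
  unfold adjPairs
  rw [Finset.sum_comm]
  simp [G.adj_comm]

lemma adjPairs_union_left (G : SimpleGraph V) {A B : Finset V} (C : Finset V)
    (h : Disjoint A B) : adjPairs G (A ∪ B) C = adjPairs G A C + adjPairs G B C :=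
  Finset.sum_union h

lemma adjPairs_union_right (G : SimpleGraph V) {A B : Finset V} (C : Finset V)
    (h : Disjoint A B) : adjPairs G C (A ∪ B) = adjPairs G C A + adjPairs G C B := by
  rw [adjPairs_comm, adjPairs_union_left G C h, adjPairs_comm G A, adjPairs_comm G B]

lemma adjPairs_union_self (G : SimpleGraph V) {A B : Finset V} (h : Disjoint A B) :
    adjPairs G (A ∪ B) (A ∪ B) =
      adjPairs G A A + adjPairs G B B + 2 * adjPairs G A B := by
  rw [adjPairs_union_left G _ h, adjPairs_union_right G _ h, adjPairs_union_right G _ h,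
    adjPairs_comm G B A]
  ring

lemma adjPairs_singleton (G : SimpleGraph V) (a : V) (B : Finset V) :
    adjPairs G {a} B = (B.filter (G.Adj a)).card := by
  simp [adjPairs]

lemma adjPairs_insert_self (G : SimpleGraph V) {a : V} {A : Finset V} (h : a ∉ A) :
    adjPairs G (insert a A) (insert a A) =
      adjPairs G A A + 2 * (A.filter (G.Adj a)).card := by
  rw [Finset.insert_eq, adjPairs_union_self G (by simpa using h), adjPairs_singleton,
    adjPairs_singleton]
  simp [Finset.filter_singleton]

lemma even_adjPairs_self (G : SimpleGraph V) (A : Finset V) : Even (adjPairs G A A) := by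
  induction A using Finset.induction_on with
  | empty => simp [adjPairs]
  | insert a A h ih =>
    rw [adjPairs_insert_self G h]
    exact ih.add (even_two_mul _)

lemma adjPairs_eq_sum_card (G : SimpleGraph V) (A B : Finset V) :
    adjPairs G A B = ∑ a ∈ A, (B.filter (G.Adj a)).card := by
  simp [adjPairs]

lemma adjPairs_self_add_card_le (G : SimpleGraph V) (A : Finset V) :
    adjPairs G A A + A.card ≤ A.card * A.card := by
  have h : ∀ a ∈ A, (A.filter (G.Adj a)).card + 1 ≤ A.card := by
    intro a ha
    exact Finset.card_lt_card (Finset.filter_ssubset.2 ⟨a, ha, G.irrefl⟩)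
  have := Finset.sum_le_sum h
  simpa [adjPairs_eq_sum_card, Finset.sum_add_distrib] using this

lemma adjPairs_congr {G H : SimpleGraph V} {A B : Finset V}
    (h : ∀ a ∈ A, ∀ b ∈ B, G.Adj a b ↔ H.Adj a b) : adjPairs G A B = adjPairs H A B := by
  unfold adjPairs
  refine Finset.sum_congr rfl fun a ha => Finset.sum_congr rfl fun b hb => ?_
  simp [h a ha b hb]

lemma one_le_adjPairs {G : SimpleGraph V} {A B : Finset V} {a b : V} (ha : a ∈ A) (hb : b ∈ B)
    (h : G.Adj a b) : 1 ≤ adjPairs G A B := by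
  rw [adjPairs_eq_sum_card]
  refine le_trans ?_ (Finset.single_le_sum (f := fun a => (B.filter (G.Adj a)).card)
    (fun _ _ => Nat.zero_le _) ha)
  exact Finset.card_pos.2 ⟨b, by simp [hb, h]⟩

lemma ThreeColorableOn.congr {G H : SimpleGraph V} {W : Finset V} (hG : ThreeColorableOn G W)
    (h : ∀ a ∈ W, ∀ b ∈ W, H.Adj a b → G.Adj a b) : ThreeColorableOn H W := by
  obtain ⟨c, hc⟩ := hG
  exact ⟨c, fun a ha b hb hab => hc a ha b hb (h a ha b hb hab)⟩

lemma threeColorableOn_of_card_le (G : SimpleGraph V) {W : Finset V} (h : W.card ≤ 3) :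
    ThreeColorableOn G W := by
  have : Nonempty (W ↪ Fin 3) := by
    apply Function.Embedding.nonempty_of_card_le
    simpa using h
  obtain ⟨f⟩ := this
  refine ⟨fun v => if hv : v ∈ W then f ⟨v, hv⟩ else 0, fun a ha b hb hab => ?_⟩
  simp only [ha, hb, dif_pos]
  intro h
  have := f.injective h
  simp only [Subtype.mk.injEq] at this
  exact hab.ne this

/-- The simple graph obtained by applying `f` to the vertices of `G`, dropping loops. -/
def imageGraph (G : SimpleGraph V) (f : V → V) : SimpleGraph V where
  Adj p q := p ≠ q ∧ ∃ a b, f a = p ∧ f b = q ∧ G.Adj a b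
  symm := ⟨fun _ _ ⟨h, a, b, ha, hb, hab⟩ => ⟨h.symm, b, a, hb, ha, hab.symm⟩⟩
  loopless := ⟨fun _ h => h.1 rfl⟩

/-- `U` is a minimal vertex set on which `G` is a counterexample: `G` is not 3-colorable on `U`,
is 3-colorable on every proper subset, has too few edges on `U`, and every graph on fewer vertices
which is not 3-colorable has a dense non-3-colorable part. -/
structure IsMinCounterexample (G : SimpleGraph V) (U : Finset V) : Prop where
  not_colorable : ¬ ThreeColorableOn G U
  colorable_of_ssubset : ∀ W ⊂ U, ThreeColorableOn G W
  sparse : 3 * adjPairs G U U + 4 < 10 * U.card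
  exists_dense : ∀ (H : SimpleGraph V) (S : Finset V), S.card < U.card →
    ¬ ThreeColorableOn H S →
    ∃ W ⊆ S, ¬ ThreeColorableOn H W ∧ 10 * W.card ≤ 3 * adjPairs H W W + 4

namespace IsMinCounterexample

variable {G : SimpleGraph V} {U : Finset V}

lemma three_le_degree (hG : IsMinCounterexample G U) {v : V} (hv : v ∈ U) :
    3 ≤ (U.filter (G.Adj v)).card := by
  by_contra! hlt
  obtain ⟨c, hc⟩ := hG.colorable_of_ssubset _ (Finset.erase_ssubset hv)
  obtain ⟨i, hi⟩ : ∃ i, i ∉ (U.filter (G.Adj v)).image c := by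
    by_contra! hall
    have h1 : (Finset.univ : Finset (Fin 3)) ⊆ (U.filter (G.Adj v)).image c :=
      fun i _ => hall i
    have h2 := Finset.card_le_card h1
    have h3 := Finset.card_image_le (s := U.filter (G.Adj v)) (f := c)
    simp at h2
    omega
  simp only [Finset.mem_image, Finset.mem_filter, not_exists, not_and, and_imp] at hi
  refine hG.not_colorable ⟨Function.update c v i, fun a ha b hb hab => ?_⟩
  by_cases hav : a = v
  · subst hav
    rw [Function.update_self, Function.update_of_ne hab.ne']
    exact fun h => hi b hb hab h.symm
  · by_cases hbv : b = v
    · subst hbv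
      rw [Function.update_self, Function.update_of_ne hav]
      exact hi a ha hab.symm
    · rw [Function.update_of_ne hav, Function.update_of_ne hbv]
      exact hc a (by simp [hav, ha]) b (by simp [hbv, hb]) hab

lemma card_ne_four (hG : IsMinCounterexample G U) : U.card ≠ 4 := by
  intro h
  have h1 := hG.sparse
  have h2 : ∑ v ∈ U, 3 ≤ adjPairs G U U := by
    rw [adjPairs_eq_sum_card]
    exact Finset.sum_le_sum fun v hv => hG.three_le_degree hv
  simp at h2
  omega

/-- Contracting the color classes of a 3-coloring of `G` on `R` yields a larger set `A ∪ R` of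
smaller potential. -/
lemma exists_extension (hG : IsMinCounterexample G U) {R : Finset V} (hR : R ⊂ U)
    (h4 : 4 ≤ R.card) {c : V → Fin 3} (hc : ∀ a ∈ R, ∀ b ∈ R, G.Adj a b → c a ≠ c b) :
    ∃ A ⊆ U \ R, A.Nonempty ∧
      (10 * (A ∪ R).card + 3 * adjPairs G R R + 8 ≤
          3 * adjPairs G (A ∪ R) (A ∪ R) + 10 * R.card ∨
        ∃ i, 10 * (A ∪ R).card + 3 * adjPairs G R R + 6 +
            6 * adjPairs G A (R.filter fun p => c p ≠ i) ≤
          3 * adjPairs G (A ∪ R) (A ∪ R) + 10 * R.card) := by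
  obtain ⟨X, hXR, hX⟩ := Finset.exists_subset_card_eq (show 3 ≤ R.card by omega)
  let e : Fin 3 ≃ X := (X.equivFinOfCardEq hX).symm
  let r : Fin 3 → V := fun i => e i
  have hrinj : Function.Injective r := fun i j h => e.injective (Subtype.ext h)
  have hrX : ∀ i, r i ∈ X := fun i => (e i).2
  have hXr : ∀ x ∈ X, ∃ i, r i = x := fun x hx => ⟨e.symm ⟨x, hx⟩, by simp [r]⟩
  let f : V → V := fun v => if v ∈ R then r (c v) else v
  have hfR : ∀ v ∈ R, f v = r (c v) := fun v hv => if_pos hv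
  have hfn : ∀ v, v ∉ R → f v = v := fun v hv => if_neg hv
  have hfinR : ∀ v, f v ∈ R → v ∈ R := by
    intro v hv
    by_contra h
    rw [hfn v h] at hv
    exact h hv
  let H := imageGraph G f
  have hRU := hR.1
  have hcard : (U \ R ∪ X).card < U.card := by
    have h1 := Finset.card_union_le (U \ R) X
    have h2 := Finset.card_sdiff_add_card_eq_card hRU
    omega
  have hncol : ¬ ThreeColorableOn H (U \ R ∪ X) := by
    rintro ⟨d, hd⟩
    refine hG.not_colorable ⟨d ∘ f, fun a ha b hb hab => ?_⟩
    have hmem : ∀ a ∈ U, f a ∈ U \ R ∪ X := by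
      intro a ha
      by_cases h : a ∈ R
      · rw [hfR a h]
        exact Finset.mem_union_right _ (hrX _)
      · rw [hfn a h]
        simp [ha, h]
    refine hd _ (hmem a ha) _ (hmem b hb) ⟨?_, a, b, rfl, rfl, hab⟩
    intro heq
    by_cases haR : a ∈ R
    · have hbR : b ∈ R := hfinR b (by rw [← heq, hfR a haR]; exact hXR (hrX _))
      rw [hfR a haR, hfR b hbR] at heq
      exact hc a haR b hbR hab (hrinj heq)
    · have hbR : b ∉ R := fun h => haR (hfinR a (by rw [heq, hfR b h]; exact hXR (hrX _)))
      rw [hfn a haR, hfn b hbR] at heq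
      exact hab.ne heq
  obtain ⟨W, hWU, hW, hWd⟩ := hG.exists_dense H _ hcard hncol
  have hHout : ∀ a, a ∉ R → ∀ b, b ∉ R → (H.Adj a b ↔ G.Adj a b) := by
    intro a ha b hb
    constructor
    · rintro ⟨-, a', b', rfl, rfl, hab⟩
      have ha' : a' ∉ R := fun h => ha (by rw [hfR a' h]; exact hXR (hrX _))
      have hb' : b' ∉ R := fun h => hb (by rw [hfR b' h]; exact hXR (hrX _))
      rwa [hfn a' ha', hfn b' hb']
    · intro hab
      exact ⟨hab.ne, a, b, hfn a ha, hfn b hb, hab⟩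
  have hAU : W \ R ⊆ U \ R := by
    intro v hv
    simp only [Finset.mem_sdiff] at hv ⊢
    have := hWU hv.1
    simp only [Finset.mem_union, Finset.mem_sdiff] at this
    rcases this with h | h
    · exact h
    · exact absurd (hXR h) hv.2
  have hBX : W ∩ R ⊆ X := by
    intro v hv
    simp only [Finset.mem_inter] at hv
    have := hWU hv.1
    simp only [Finset.mem_union, Finset.mem_sdiff] at this
    rcases this with h | h
    · exact absurd hv.2 h.2
    · exact h
  let I : Finset (Fin 3) := Finset.univ.filter fun i => r i ∈ W
  have hB : W ∩ R = I.image r := by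
    ext v
    simp only [Finset.mem_image, I, Finset.mem_filter, Finset.mem_univ, true_and]
    constructor
    · intro hv
      obtain ⟨i, rfl⟩ := hXr v (hBX hv)
      exact ⟨i, (Finset.mem_inter.1 hv).1, rfl⟩
    · rintro ⟨i, hi, rfl⟩
      exact Finset.mem_inter.2 ⟨hi, hXR (hrX i)⟩
  have hBcard : (W ∩ R).card = I.card := by rw [hB, Finset.card_image_of_injective _ hrinj]
  have hI3 : I.card ≤ 3 := by simpa using Finset.card_le_univ I
  have hdisj : Disjoint (W \ R) (W ∩ R) := Finset.disjoint_sdiff_inter W R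
  have hWeq : W \ R ∪ W ∩ R = W := Finset.sdiff_union_inter W R
  have hWcard : (W \ R).card + (W ∩ R).card = W.card := by
    rw [← Finset.card_union_of_disjoint hdisj, hWeq]
  have hI1 : 1 ≤ I.card := by
    by_contra! h
    have hempty : W ∩ R = ∅ := by
      apply Finset.card_eq_zero.1
      omega
    have hnR : ∀ v ∈ W, v ∉ R := fun v hv hvR => by
      have : v ∈ W ∩ R := Finset.mem_inter.2 ⟨hv, hvR⟩
      simp [hempty] at this
    have hss : W ⊂ U := by
      refine ⟨fun v hv => ?_, fun h => ?_⟩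
      · have := hAU (Finset.mem_sdiff.2 ⟨hv, hnR v hv⟩)
        exact (Finset.mem_sdiff.1 this).1
      · obtain ⟨v, hv⟩ := Finset.card_pos.1 (show 0 < R.card by omega)
        exact hnR v (h (hRU hv)) hv
    exact hW ((hG.colorable_of_ssubset W hss).congr
      fun a ha b hb hab => (hHout a (hnR a ha) b (hnR b hb)).1 hab)
  have hA : (W \ R).Nonempty := by
    rw [Finset.nonempty_iff_ne_empty]
    intro h
    rw [h] at hWcard
    simp at hWcard
    exact hW (threeColorableOn_of_card_le H (by omega))
  have hHW := adjPairs_union_self H hdisj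
  rw [hWeq] at hHW
  have hHA : adjPairs H (W \ R) (W \ R) = adjPairs G (W \ R) (W \ R) :=
    adjPairs_congr fun a ha b hb =>
      hHout a (Finset.mem_sdiff.1 ha).2 b (Finset.mem_sdiff.1 hb).2
  have hHB := adjPairs_self_add_card_le H (W ∩ R)
  have hAR : Disjoint (W \ R) R := Finset.sdiff_disjoint
  have hGT := adjPairs_union_self G hAR
  have hcross : adjPairs H (W \ R) (W ∩ R) ≤ adjPairs G (W \ R) (R.filter fun p => c p ∈ I) := by
    unfold adjPairs
    refine Finset.sum_le_sum fun a ha => ?_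
    rw [hB, Finset.sum_image hrinj.injOn,
      ← Finset.sum_fiberwise_of_maps_to (t := I) (g := c) (by simp)]
    refine Finset.sum_le_sum fun i hi => ?_
    split_ifs with hadj
    · obtain ⟨-, a', b', ha', hb', hab⟩ := hadj
      have haR := (Finset.mem_sdiff.1 ha).2
      have ha'R : a' ∉ R := fun h => haR (by rw [← ha', hfR a' h]; exact hXR (hrX _))
      have hb'R : b' ∈ R := hfinR b' (by rw [hb']; exact hXR (hrX _))
      rw [hfn a' ha'R] at ha'
      rw [hfR b' hb'R] at hb'
      subst ha'
      have hci := hrinj hb'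
      rw [← Finset.sum_filter, Finset.sum_const, smul_eq_mul, mul_one]
      refine Finset.card_pos.2 ⟨b', ?_⟩
      simp [hb'R, hci, hi, hab]
    · exact Nat.zero_le _
  have hsplit : adjPairs G (W \ R) R = adjPairs G (W \ R) (R.filter fun p => c p ∈ I) +
      adjPairs G (W \ R) (R.filter fun p => c p ∉ I) := by
    rw [← adjPairs_union_right G _ (Finset.disjoint_filter_filter_not _ _ _),
      Finset.filter_union_filter_not_eq]
  have hTcard : (W \ R ∪ R).card = (W \ R).card + R.card := Finset.card_union_of_disjoint hAR
  rw [hBcard] at hHB hWcard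
  refine ⟨W \ R, hAU, hA, ?_⟩
  obtain h1 | h1 : I.card = 1 ∨ 2 ≤ I.card := by omega
  · right
    obtain ⟨i, hi⟩ := Finset.card_eq_one.1 h1
    refine ⟨i, ?_⟩
    simp only [hi, Finset.mem_singleton] at hsplit hcross
    simp only [ne_eq]
    rw [h1] at hHB hWcard
    omega
  · left
    obtain h2 | h2 : I.card = 2 ∨ I.card = 3 := by omega
    all_goals
      rw [h2] at hHB hWcard
      omega

/-- Proper subsets with at least two vertices have potential at least `6`. -/
lemma lt_potential (hG : IsMinCounterexample G U) {R : Finset V} (hR : R ⊂ U) (h2 : 2 ≤ R.card) :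
    3 * adjPairs G R R + 12 ≤ 10 * R.card := by
  induction hn : U.card - R.card using Nat.strong_induction_on generalizing R with
  | _ n ih =>
    by_contra! hlt
    obtain ⟨k, hk⟩ := even_adjPairs_self G R
    have hle := adjPairs_self_add_card_le G R
    have h4 : 4 ≤ R.card := by
      by_contra! h
      obtain h | h : R.card = 2 ∨ R.card = 3 := by omega
      all_goals
        rw [h] at hle hlt
        omega
    obtain ⟨c, hc⟩ := hG.colorable_of_ssubset R hR
    obtain ⟨A, hAU, hA, hd⟩ := hG.exists_extension hR h4 hc
    have hd' : 10 * (A ∪ R).card + 3 * adjPairs G R R + 6 ≤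
        3 * adjPairs G (A ∪ R) (A ∪ R) + 10 * R.card := by
      rcases hd with h | ⟨i, h⟩
      · omega
      · exact le_trans (by omega) h
    have hTU : A ∪ R ⊆ U := Finset.union_subset (hAU.trans Finset.sdiff_subset) hR.1
    have hdis : Disjoint A R := Finset.disjoint_of_subset_left hAU Finset.sdiff_disjoint
    have hT := Finset.card_union_of_disjoint hdis
    have hApos := Finset.card_pos.2 hA
    have hRlt := Finset.card_lt_card hR
    clear hd
    by_cases hTeq : A ∪ R = U
    · have := hG.sparse
      rw [hTeq] at hd'
      omega
    · have := ih _ (by omega) (Finset.ssubset_iff_subset_ne.2 ⟨hTU, hTeq⟩) (by omega) rfl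
      omega

/-- A proper part can be 3-colored so that two prescribed vertices get different colors. -/
lemma exists_coloring_ne (hG : IsMinCounterexample G U) {S : Finset V} (hS : S ⊂ U) {u v : V}
    (huv : u ≠ v) (hu : u ∈ S) (hv : v ∈ S) :
    ∃ c : V → Fin 3, (∀ a ∈ S, ∀ b ∈ S, G.Adj a b → c a ≠ c b) ∧ c u ≠ c v := by
  have hcol : ThreeColorableOn (G ⊔ SimpleGraph.edge u v) S := by
    by_contra hn
    obtain ⟨W, hWS, hW, hWd⟩ := hG.exists_dense _ S (Finset.card_lt_card hS) hn
    have h4 : 4 ≤ W.card := by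
      by_contra! h
      exact hW (threeColorableOn_of_card_le _ (by omega))
    have hp := hG.lt_potential (Finset.ssubset_of_subset_of_ssubset hWS hS) (by omega)
    have hle : adjPairs (G ⊔ SimpleGraph.edge u v) W W ≤ adjPairs G W W + 2 := by
      calc adjPairs (G ⊔ SimpleGraph.edge u v) W W ≤
          ∑ a ∈ W, ∑ b ∈ W, ((if G.Adj a b then 1 else 0) +
            ((if a = u then if b = v then 1 else 0 else 0) +
              if a = v then if b = u then 1 else 0 else 0)) :=
            Finset.sum_le_sum fun a _ => Finset.sum_le_sum fun b _ => by
              simp only [SimpleGraph.sup_adj, SimpleGraph.edge_adj]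
              split_ifs <;> simp_all
        _ ≤ adjPairs G W W + 2 := by
            have hone : ∀ u v : V, ∑ a ∈ W, ∑ b ∈ W,
                (if a = u then if b = v then 1 else 0 else 0) ≤ 1 := by
              intro u v
              rw [Finset.sum_comm]
              simp only [Finset.sum_ite_eq']
              split_ifs <;> simp
              split_ifs <;> simp
            have h1 := hone u v
            have h2 := hone v u
            simp only [Finset.sum_add_distrib]
            unfold adjPairs
            omega
    omega
  obtain ⟨c, hc⟩ := hcol
  refine ⟨c, fun a ha b hb hab => hc a ha b hb (Or.inl hab), hc u hu v hv (Or.inr ?_)⟩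
  simp [SimpleGraph.edge_adj, huv]

/-- A proper subset cannot be separated from the rest by a single vertex. -/
lemma exists_two_boundary (hG : IsMinCounterexample G U) {R : Finset V} (hR : R ⊂ U)
    (h2 : 2 ≤ R.card) :
    ∃ u ∈ R, ∃ v ∈ R, u ≠ v ∧ (∃ p ∈ U \ R, G.Adj p u) ∧ ∃ q ∈ U \ R, G.Adj q v := by
  obtain ⟨w, hw, hwall⟩ : ∃ w ∈ R, (∃ u ∈ R, ∃ v ∈ R, u ≠ v ∧ (∃ p ∈ U \ R, G.Adj p u) ∧
      ∃ q ∈ U \ R, G.Adj q v) ∨ ∀ u ∈ R, (∃ p ∈ U \ R, G.Adj p u) → u = w := by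
    by_cases h : ∃ w ∈ R, ∃ p ∈ U \ R, G.Adj p w
    · obtain ⟨w, hw, hp⟩ := h
      refine ⟨w, hw, ?_⟩
      by_cases h' : ∀ u ∈ R, (∃ p ∈ U \ R, G.Adj p u) → u = w
      · exact Or.inr h'
      · push Not at h'
        obtain ⟨u, hu, hq, huw⟩ := h'
        exact Or.inl ⟨u, hu, w, hw, huw, hq, hp⟩
    · obtain ⟨w, hw⟩ := Finset.card_pos.1 (show 0 < R.card by omega)
      exact ⟨w, hw, Or.inr fun u hu hp => absurd ⟨u, hu, hp⟩ h⟩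
  rcases hwall with h | hall
  · exact h
  exfalso
  obtain ⟨c, hc⟩ := hG.colorable_of_ssubset R hR
  have hss : insert w (U \ R) ⊂ U := by
    obtain ⟨z, hz, hzw⟩ := Finset.exists_mem_ne (show 1 < R.card by omega) w
    refine ⟨Finset.insert_subset (hR.1 hw) Finset.sdiff_subset, fun h => ?_⟩
    have := h (hR.1 hz)
    simp [hzw, hz] at this
  obtain ⟨d, hd⟩ := hG.colorable_of_ssubset _ hss
  have key : ∀ a ∈ R, ∀ b ∈ U, b ∉ R → G.Adj b a →
      Equiv.swap (c w) (d w) (c a) ≠ d b := by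
    intro a ha b hb hbR hab
    have hbm : b ∈ U \ R := Finset.mem_sdiff.2 ⟨hb, hbR⟩
    obtain rfl := hall a ha ⟨b, hbm, hab⟩
    rw [Equiv.swap_apply_left]
    exact hd _ (Finset.mem_insert_self _ _) b (Finset.mem_insert_of_mem hbm) hab.symm
  refine hG.not_colorable
    ⟨fun v => if v ∈ R then Equiv.swap (c w) (d w) (c v) else d v, fun a ha b hb hab => ?_⟩
  by_cases haR : a ∈ R <;> by_cases hbR : b ∈ R <;> simp only [haR, hbR, if_true, if_false]
  · exact fun h => hc a haR b hbR hab ((Equiv.swap _ _).injective h)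
  · exact key a haR b hb hbR hab.symm
  · exact (key b hbR a ha haR hab).symm
  · exact hd a (by simp [ha, haR]) b (by simp [hb, hbR]) hab

/-- Proper subsets with at least four vertices have potential at least `7`. -/
lemma lt_potential_of_four_le (hG : IsMinCounterexample G U) {R : Finset V} (hR : R ⊂ U)
    (h4 : 4 ≤ R.card) : 3 * adjPairs G R R + 12 < 10 * R.card := by
  by_contra! hle
  obtain ⟨u, hu, v, hv, huv, ⟨p, hp, hpu⟩, q, hq, hqv⟩ := hG.exists_two_boundary hR (by omega)
  obtain ⟨c, hc, hcuv⟩ := hG.exists_coloring_ne hR huv hu hv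
  obtain ⟨A, hAU, hA, hd⟩ := hG.exists_extension hR h4 hc
  have hTU : A ∪ R ⊆ U := Finset.union_subset (hAU.trans Finset.sdiff_subset) hR.1
  have hTc : R.card ≤ (A ∪ R).card := Finset.card_le_card Finset.subset_union_right
  by_cases hTeq : A ∪ R = U
  · have hsp := hG.sparse
    have hAeq : U \ R ⊆ A := by
      intro x hx
      have hx' := Finset.mem_sdiff.1 hx
      rw [← hTeq] at hx'
      simpa [hx'.2] using hx'.1
    rw [hTeq] at hd
    rcases hd with h | ⟨i, h⟩
    · omega
    · have : 1 ≤ adjPairs G A (R.filter fun p => c p ≠ i) := by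
        by_cases hi : c u = i
        · exact one_le_adjPairs (hAeq hq)
            (Finset.mem_filter.2 ⟨hv, fun h => hcuv (hi.trans h.symm)⟩) hqv
        · exact one_le_adjPairs (hAeq hp) (Finset.mem_filter.2 ⟨hu, hi⟩) hpu
      omega
  · have := hG.lt_potential (Finset.ssubset_iff_subset_ne.2 ⟨hTU, hTeq⟩) (by omega)
    rcases hd with h | ⟨i, h⟩ <;> omega

/-- A 3-coloring of `U` minus two vertices extends if the two vertices can be given colors that
differ from each other and from those of their neighbors. -/
lemma not_extends (hG : IsMinCounterexample G U) {x y : V} (hxy : x ≠ y) {c : V → Fin 3}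
    (hc : ∀ a ∈ U, a ≠ x → a ≠ y → ∀ b ∈ U, b ≠ x → b ≠ y → G.Adj a b → c a ≠ c b) {s t : Fin 3}
    (hst : s ≠ t) (hs : ∀ a ∈ U, a ≠ y → G.Adj x a → c a ≠ s)
    (ht : ∀ a ∈ U, a ≠ x → G.Adj y a → c a ≠ t) : False := by
  refine hG.not_colorable ⟨fun v => if v = x then s else if v = y then t else c v, ?_⟩
  intro a ha b hb hab
  have hne := hab.ne
  have hba := hab.symm
  by_cases hax : a = x
  · subst hax
    by_cases hby : b = y
    · subst hby
      simp [hxy.symm, hst]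
    · simpa [hne.symm, hby] using (hs b hb hby hab).symm
  · by_cases hay : a = y
    · subst hay
      by_cases hbx : b = x
      · subst hbx
        simp [hax, hst.symm]
      · simpa [hax, hbx, hne.symm] using (ht b hb hbx hab).symm
    · by_cases hbx : b = x
      · subst hbx
        simpa [hax, hay] using hs a ha hay hba
      · by_cases hby : b = y
        · subst hby
          simpa [hax, hay, hbx] using ht a ha hax hba
        · simpa [hax, hay, hbx, hby] using hc a ha hax hay b hb hbx hby hab

/-- A triangle contains at most one vertex of degree `3`. -/
lemma not_triangle (hG : IsMinCounterexample G U) {x y z : V} (hx : x ∈ U) (hy : y ∈ U)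
    (hz : z ∈ U) (hxy : G.Adj x y) (hxz : G.Adj x z) (hyz : G.Adj y z)
    (hdx : (U.filter (G.Adj x)).card = 3) (hdy : (U.filter (G.Adj y)).card = 3) : False := by
  have third : ∀ {x y z : V}, y ∈ U → z ∈ U → G.Adj x y → G.Adj x z → G.Adj y z →
      (U.filter (G.Adj x)).card = 3 →
      ∃ a ∈ U, G.Adj x a ∧ a ≠ y ∧ a ≠ z ∧ ∀ b ∈ U, G.Adj x b → b = y ∨ b = z ∨ b = a := by
    intro x y z hy hz hxy hxz hyz hd
    have hsub : {y, z} ⊆ U.filter (G.Adj x) := by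
      intro w hw
      simp only [Finset.mem_insert, Finset.mem_singleton] at hw
      rcases hw with rfl | rfl <;> simp [*]
    have h1 := Finset.card_sdiff_add_card_eq_card hsub
    rw [Finset.card_pair hyz.ne, hd] at h1
    obtain ⟨a, ha⟩ := Finset.card_eq_one.1 (show (U.filter (G.Adj x) \ {y, z}).card = 1 by omega)
    have hmem : ∀ b, b ∈ U.filter (G.Adj x) \ {y, z} ↔ b = a := by simp [ha]
    simp only [Finset.mem_sdiff, Finset.mem_filter, Finset.mem_insert, Finset.mem_singleton,
      not_or] at hmem
    obtain ⟨⟨h1, h2⟩, h3, h4⟩ := (hmem a).2 rfl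
    refine ⟨a, h1, h2, h3, h4, fun b hb hxb => ?_⟩
    have := (hmem b).1
    tauto
  obtain ⟨a, ha, hxa, hay, haz, hNx⟩ := third hy hz hxy hxz hyz hdx
  obtain ⟨b, hb, hyb, hbx, hbz, hNy⟩ := third hx hz hxy.symm hyz hxz hdy
  by_cases hab : a = b
  · subst hab
    have hTU : insert x (insert y {a, z}) ⊆ U := by
      intro w hw
      simp only [Finset.mem_insert, Finset.mem_singleton] at hw
      rcases hw with rfl | rfl | rfl | rfl <;> assumption
    have hcard : (insert x (insert y ({a, z} : Finset V))).card = 4 := by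
      rw [Finset.card_insert_of_notMem, Finset.card_insert_of_notMem, Finset.card_pair haz]
      · simp [hay.symm, hyz.ne]
      · simp [hxy.ne, hbx.symm, hxz.ne]
    have hpairs : 10 ≤ adjPairs G (insert x (insert y {a, z})) (insert x (insert y {a, z})) := by
      rw [adjPairs_insert_self G (by simp [hxy.ne, hbx.symm, hxz.ne]),
        adjPairs_insert_self G (by simp [hay.symm, hyz.ne])]
      have e1 : (insert y ({a, z} : Finset V)).filter (G.Adj x) = insert y {a, z} :=
        Finset.filter_true_of_mem (by simp [hxy, hxa, hxz])
      have e2 : ({a, z} : Finset V).filter (G.Adj y) = {a, z} :=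
        Finset.filter_true_of_mem (by simp [hyb, hyz])
      have e3 : (insert y ({a, z} : Finset V)).card = 3 :=
        Finset.card_eq_three.2 ⟨y, a, z, hay.symm, hyz.ne, haz, rfl⟩
      rw [e1, e2, e3, Finset.card_pair haz]
      omega
    by_cases hTeq : insert x (insert y {a, z}) = U
    · rw [hTeq] at hcard
      exact hG.card_ne_four hcard
    · have := hG.lt_potential (Finset.ssubset_iff_subset_ne.2 ⟨hTU, hTeq⟩) (by omega)
      omega
  · have hss : (U.erase x).erase y ⊂ U :=
      Finset.ssubset_of_subset_of_ssubset (Finset.erase_subset _ _) (Finset.erase_ssubset hx)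
    obtain ⟨c, hc, hcab⟩ := hG.exists_coloring_ne hss hab
      (by simp [ha, hay, hxa.ne']) (by simp [hb, hbx, hyb.ne'])
    have hlists : ∀ p q r : Fin 3, q ≠ r → ∃ s t, s ≠ t ∧ p ≠ s ∧ q ≠ s ∧ p ≠ t ∧ r ≠ t := by
      decide
    obtain ⟨s, t, hst, h1, h2, h3, h4⟩ := hlists (c z) (c a) (c b) hcab
    refine hG.not_extends hxy.ne (c := c)
      (fun p hp hpx hpy q hq hqx hqy => hc p (by simp [*]) q (by simp [*])) hst ?_ ?_
    · intro w hw hwy hxw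
      rcases hNx w hw hxw with rfl | rfl | rfl <;> first | contradiction | assumption
    · intro w hw hwx hyw
      rcases hNy w hw hyw with rfl | rfl | rfl <;> first | contradiction | assumption

/-- If `x` and `y` are adjacent vertices of degree `3`, the other neighbors of `x` are adjacent. -/
lemma adj_of_adj_degree_three (hG : IsMinCounterexample G U) {x y a b : V} (hx : x ∈ U)
    (hy : y ∈ U) (ha : a ∈ U) (hb : b ∈ U) (hxy : G.Adj x y) (hab : a ≠ b) (hay : a ≠ y)
    (hby : b ≠ y) (hxa : G.Adj x a) (hxb : G.Adj x b)
    (hdx : (U.filter (G.Adj x)).card = 3) (hdy : (U.filter (G.Adj y)).card = 3) :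
    G.Adj a b := by
  by_contra hnab
  have hNx : ∀ w ∈ U, G.Adj x w → w = y ∨ w = a ∨ w = b := by
    have hsub : {y, a, b} ⊆ U.filter (G.Adj x) := by
      intro w hw
      simp only [Finset.mem_insert, Finset.mem_singleton] at hw
      rcases hw with rfl | rfl | rfl <;> simp [*]
    have hcard : ({y, a, b} : Finset V).card = 3 :=
      Finset.card_eq_three.2 ⟨y, a, b, hay.symm, hby.symm, hab, rfl⟩
    have heq := Finset.eq_of_subset_of_card_le hsub (by omega)
    intro w hw hxw
    have : w ∈ U.filter (G.Adj x) := Finset.mem_filter.2 ⟨hw, hxw⟩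
    rw [← heq] at this
    simpa using this
  let f : V → V := fun v => if v = b then a else v
  have hfb : f b = a := if_pos rfl
  have hfn : ∀ v, v ≠ b → f v = v := fun v hv => if_neg hv
  let S := ((U.erase x).erase y).erase b
  have hSU : S ⊂ U := Finset.ssubset_of_subset_of_ssubset
    ((Finset.erase_subset _ _).trans (Finset.erase_subset _ _)) (Finset.erase_ssubset hx)
  have hmemS : ∀ v, v ∈ S ↔ v ≠ b ∧ v ≠ y ∧ v ≠ x ∧ v ∈ U := by simp [S]
  have haS : a ∈ S := (hmemS a).2 ⟨hab, hay, hxa.ne', ha⟩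
  let H := imageGraph G f
  have hncol : ¬ ThreeColorableOn H S := by
    rintro ⟨d, hd⟩
    have hmem : ∀ v ∈ U, v ≠ x → v ≠ y → f v ∈ S := by
      intro v hv hvx hvy
      by_cases hvb : v = b
      · rw [hvb, hfb]
        exact haS
      · rw [hfn v hvb]
        exact (hmemS v).2 ⟨hvb, hvy, hvx, hv⟩
    obtain ⟨t, ht⟩ : ∃ t, t ∉ ((U.filter (G.Adj y)).erase x).image (d ∘ f) := by
      by_contra! hall
      have h1 : (Finset.univ : Finset (Fin 3)) ⊆ _ := fun i _ => hall i
      have h2 := Finset.card_le_card h1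
      have h3 := Finset.card_image_le (s := (U.filter (G.Adj y)).erase x) (f := d ∘ f)
      rw [Finset.card_erase_of_mem (by simp [hx, hxy.symm]), hdy] at h3
      simp at h2 h3
      omega
    have hlists : ∀ p t : Fin 3, ∃ s, s ≠ t ∧ p ≠ s := by decide
    obtain ⟨s, hst, hs⟩ := hlists (d a) t
    refine hG.not_extends hxy.ne (c := d ∘ f) ?_ hst ?_ ?_
    · intro p hp hpx hpy q hq hqx hqy hpq
      refine hd _ (hmem p hp hpx hpy) _ (hmem q hq hqx hqy) ⟨?_, p, q, rfl, rfl, hpq⟩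
      by_cases hpb : p = b
      · subst hpb
        rw [hfb, hfn q hpq.ne']
        rintro rfl
        exact hnab hpq.symm
      · by_cases hqb : q = b
        · subst hqb
          rw [hfb, hfn p hpb]
          rintro rfl
          exact hnab hpq
        · rw [hfn p hpb, hfn q hqb]
          exact hpq.ne
    · intro w hw hwy hxw
      rcases hNx w hw hxw with rfl | rfl | rfl
      · contradiction
      · simpa [hfn _ hab] using hs
      · simpa [hfb] using hs
    · intro w hw hwx hyw h
      exact ht (Finset.mem_image.2 ⟨w, by simp [hw, hwx, hyw], h⟩)
  obtain ⟨W, hWS, hW, hWd⟩ := hG.exists_dense H S (Finset.card_lt_card hSU) hncol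
  have h4 : 4 ≤ W.card := by
    by_contra! h
    exact hW (threeColorableOn_of_card_le _ (by omega))
  have hbW : b ∉ W := fun h => ((hmemS b).1 (hWS h)).1 rfl
  have hHG : ∀ p, p ≠ a → ∀ q, q ≠ a → H.Adj p q → G.Adj p q := by
    rintro p hp q hq ⟨-, p', q', rfl, rfl, h⟩
    have hp' : p' ≠ b := by
      rintro rfl
      exact hp hfb
    have hq' : q' ≠ b := by
      rintro rfl
      exact hq hfb
    rwa [hfn p' hp', hfn q' hq']
  have haW : a ∈ W := by
    by_contra haW
    have hne : ∀ p ∈ W, p ≠ a := by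
      rintro p hp rfl
      exact haW hp
    exact hW ((hG.colorable_of_ssubset W (Finset.ssubset_of_subset_of_ssubset hWS hSU)).congr
      fun p hp q hq h => hHG p (hne p hp) q (hne q hq) h)
  have hxW : x ∉ insert b W := by
    simp only [Finset.mem_insert, not_or]
    exact ⟨hxb.ne, fun h => ((hmemS x).1 (hWS h)).2.2.1 rfl⟩
  have hyT : y ∉ insert x (insert b W) := by
    simp only [Finset.mem_insert, not_or]
    exact ⟨hxy.ne', hby.symm, fun h => ((hmemS y).1 (hWS h)).2.1 rfl⟩
  have hTU : insert x (insert b W) ⊂ U := by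
    refine ⟨Finset.insert_subset hx (Finset.insert_subset hb (hWS.trans hSU.1)), fun h => ?_⟩
    exact hyT (h hy)
  have hcard : (insert x (insert b W)).card = W.card + 2 := by
    rw [Finset.card_insert_of_notMem hxW, Finset.card_insert_of_notMem hbW]
  have hpx := adjPairs_insert_self G hxW
  have hpb := adjPairs_insert_self G hbW
  have htwo : 2 ≤ ((insert b W).filter (G.Adj x)).card := by
    rw [← Finset.card_pair hab]
    refine Finset.card_le_card fun w hw => ?_
    simp only [Finset.mem_insert, Finset.mem_singleton] at hw
    rcases hw with rfl | rfl <;> simp [*]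
  have hlift : adjPairs H W W ≤ adjPairs G (insert b W) (insert b W) := by
    have hWa : W = insert a (W.erase a) := (Finset.insert_erase haW).symm
    have hWe : adjPairs H (W.erase a) (W.erase a) ≤ adjPairs G (W.erase a) (W.erase a) := by
      refine Finset.sum_le_sum fun p hp => Finset.sum_le_sum fun q hq => ?_
      have := hHG p (Finset.ne_of_mem_erase hp) q (Finset.ne_of_mem_erase hq)
      split_ifs with h1 h2
      · exact le_rfl
      · exact absurd (this h1) h2
      all_goals exact Nat.zero_le _
    have hna : a ∉ W.erase a := Finset.notMem_erase a W
    have h1 := adjPairs_insert_self H hna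
    have h2 := adjPairs_insert_self G hna
    rw [← hWa] at h1 h2
    have h3 : ((W.erase a).filter (H.Adj a)).card ≤
        ((W.erase a).filter (G.Adj a)).card + (W.filter (G.Adj b)).card := by
      refine le_trans (Finset.card_le_card ?_) (Finset.card_union_le _ _)
      intro q hq
      obtain ⟨hqW, -, p', q', hp', rfl, hpq⟩ := Finset.mem_filter.1 hq
      have hq' : q' ≠ b := by
        rintro rfl
        exact Finset.ne_of_mem_erase hqW hfb
      rw [hfn q' hq'] at hqW ⊢
      by_cases hpb : p' = b
      · subst hpb
        exact Finset.mem_union_right _ (Finset.mem_filter.2 ⟨Finset.mem_of_mem_erase hqW, hpq⟩)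
      · rw [hfn p' hpb] at hp'
        subst hp'
        exact Finset.mem_union_left _ (Finset.mem_filter.2 ⟨hqW, hpq⟩)
    omega
  have := hG.lt_potential_of_four_le hTU (by omega)
  omega

/-- A vertex of degree `3` has at least two neighbors of larger degree. -/
lemma two_le_card_large_neighbors (hG : IsMinCounterexample G U) {x : V} (hx : x ∈ U)
    (hdx : (U.filter (G.Adj x)).card = 3) :
    2 ≤ ((U.filter fun v => (U.filter (G.Adj v)).card ≠ 3).filter (G.Adj x)).card := by
  by_contra! hlt
  have hsplit := Finset.card_filter_add_card_filter_not
    (s := U.filter (G.Adj x)) (fun v => (U.filter (G.Adj v)).card ≠ 3)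
  rw [hdx, Finset.filter_comm] at hsplit
  obtain ⟨y, hy, z, hz, hyz⟩ := Finset.one_lt_card.1
    (show 1 < ((U.filter (G.Adj x)).filter fun v => ¬ (U.filter (G.Adj v)).card ≠ 3).card by omega)
  simp only [Finset.mem_filter, not_not] at hy hz
  obtain ⟨w, hw, hwn⟩ : ∃ w ∈ U.filter (G.Adj x), w ∉ ({y, z} : Finset V) :=
    Finset.exists_mem_notMem_of_card_lt_card (by rw [hdx, Finset.card_pair hyz]; omega)
  simp only [Finset.mem_filter, Finset.mem_insert, Finset.mem_singleton, not_or] at hw hwn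
  have hzw := hG.adj_of_adj_degree_three hx hy.1.1 hz.1.1 hw.1 hy.1.2 (Ne.symm hwn.2) hyz.symm
    hwn.1 hz.1.2 hw.2 hdx hy.2
  exact hG.not_triangle hx hz.1.1 hw.1 hz.1.2 hw.2 hzw hdx hz.2

lemma false (hG : IsMinCounterexample G U) : False := by
  set L := U.filter fun v => (U.filter (G.Adj v)).card = 3 with hL
  set M := U.filter fun v => (U.filter (G.Adj v)).card ≠ 3 with hM
  have hcard : L.card + M.card = U.card := Finset.card_filter_add_card_filter_not _
  have hsum : adjPairs G L U + adjPairs G M U = adjPairs G U U := by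
    rw [← adjPairs_union_left G U (Finset.disjoint_filter_filter_not _ _ _),
      Finset.filter_union_filter_not_eq]
  have h1 : adjPairs G L U = 3 * L.card := by
    rw [adjPairs_eq_sum_card, Finset.sum_congr rfl fun v hv => (Finset.mem_filter.1 hv).2]
    rw [Finset.sum_const, smul_eq_mul, mul_comm]
  have h2 : 2 * L.card ≤ adjPairs G L M := by
    rw [adjPairs_eq_sum_card, mul_comm, ← smul_eq_mul, ← Finset.sum_const]
    exact Finset.sum_le_sum fun v hv =>
      hG.two_le_card_large_neighbors (Finset.mem_filter.1 hv).1 (Finset.mem_filter.1 hv).2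
  have h3 : adjPairs G L M ≤ adjPairs G M U := by
    rw [adjPairs_comm, adjPairs_eq_sum_card, adjPairs_eq_sum_card]
    exact Finset.sum_le_sum fun v _ =>
      Finset.card_le_card (Finset.filter_subset_filter _ (Finset.filter_subset _ _))
  have h4 : 4 * M.card ≤ adjPairs G M U := by
    rw [adjPairs_eq_sum_card, mul_comm, ← smul_eq_mul, ← Finset.sum_const]
    refine Finset.sum_le_sum fun v hv => ?_
    have := hG.three_le_degree (Finset.mem_filter.1 hv).1
    have := (Finset.mem_filter.1 hv).2
    omega
  have := hG.sparse
  omega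

end IsMinCounterexample

/-- Every finite graph that is not 3-colorable has a non-3-colorable part with `n` vertices and
at least `(5n - 2)/3` edges. -/
theorem exists_dense_of_not_threeColorableOn (G : SimpleGraph V) (U : Finset V)
    (hU : ¬ ThreeColorableOn G U) :
    ∃ W ⊆ U, ¬ ThreeColorableOn G W ∧ 10 * W.card ≤ 3 * adjPairs G W W + 4 := by
  induction hn : U.card using Nat.strong_induction_on generalizing G U with
  | _ n ih =>
    subst hn
    by_contra! hno
    refine IsMinCounterexample.false (G := G) (U := U) ⟨hU, fun W hW => ?_,
      hno U subset_rfl hU, fun H S hS hH => ih _ hS H S hH rfl⟩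
    by_contra hcol
    obtain ⟨T, hT, hTcol, hTd⟩ := ih _ (Finset.card_lt_card hW) G W hcol rfl
    exact absurd hTd (not_le.2 (hno T (hT.trans hW.1) hTcol))

lemma threeColorableOn_of_colorable_induce {G : SimpleGraph V} {v : V} {W : Finset V} (hv : v ∉ W)
    (h : (G.induce {u : V | u ≠ v}).Colorable 3) : ThreeColorableOn G W := by
  obtain ⟨C⟩ := h
  have hne : ∀ a ∈ W, a ≠ v := by
    rintro a ha rfl
    exact hv ha
  refine ⟨fun u => if hu : u ≠ v then C ⟨u, hu⟩ else 0, fun a ha b hb hab => ?_⟩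
  simp only [dif_pos (hne a ha), dif_pos (hne b hb)]
  exact C.valid hab

lemma colorable_three_of_chromaticNumber_lt_four {W : Type} {G : SimpleGraph W}
    (h : G.chromaticNumber < 4) : G.Colorable 3 := by
  apply SimpleGraph.chromaticNumber_le_iff_colorable.1
  exact Order.le_of_lt_add_one h

lemma adjPairs_univ [Fintype V] (G : SimpleGraph V) :
    adjPairs G Finset.univ Finset.univ = 2 * Nat.card G.edgeSet := by
  rw [adjPairs_eq_sum_card, Nat.card_eq_fintype_card, ← SimpleGraph.edgeFinset_card,
    ← G.sum_degrees_eq_twice_card_edges]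
  refine Finset.sum_congr rfl fun v _ => ?_
  rw [← SimpleGraph.card_neighborFinset_eq_degree, SimpleGraph.neighborFinset_eq_filter]

theorem five_mul_card_le_of_isFourCritical [Fintype V] {G : SimpleGraph V}
    (hcrit : IsFourCritical G) :
    5 * Fintype.card V ≤ 3 * Nat.card G.edgeSet + 2 := by
  obtain ⟨h4, hvert, -⟩ := hcrit
  have hncol : ¬ ThreeColorableOn G Finset.univ := by
    rintro ⟨c, hc⟩
    have hcol : G.Colorable 3 :=
      ⟨SimpleGraph.Coloring.mk c fun {a b} hab => hc a (Finset.mem_univ a) b (Finset.mem_univ b) hab⟩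
    have := SimpleGraph.chromaticNumber_le_iff_colorable.2 hcol
    rw [h4] at this
    exact absurd this (by decide)
  obtain ⟨W, -, hW, hd⟩ := exists_dense_of_not_threeColorableOn G Finset.univ hncol
  have hWu : W = Finset.univ := by
    refine Finset.eq_univ_of_forall fun v => ?_
    by_contra hv
    exact hW (threeColorableOn_of_colorable_induce hv
      (colorable_three_of_chromaticNumber_lt_four (hvert v)))
  rw [hWu, adjPairs_univ, Finset.card_univ] at hd
  omega

end KostochkaYancey

/-- **Kostochka–Yancey.** Every `4`-critical graph on `n` vertices has at least
`(5n - 2)/3` edges, i.e. `5n ≤ 3|E(G)| + 2`. -/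
theorem kostochka_yancey {V : Type} [Fintype V] (G : SimpleGraph V)
    (hcrit : IsFourCritical G) :
    5 * Fintype.card V ≤ 3 * Nat.card G.edgeSet + 2 := by
  exact KostochkaYancey.five_mul_card_le_of_isFourCritical hcrit
end
end

section
/- If G is a 4-critical graph on n vertices with exactly (5n − 2)/3 edges, then G is a 4-Ore graph. -/
open SimpleGraph

noncomputable section

/-- The DHGO-composition of `G1` and `G2`: delete the edge `xy` from `G1`, split the
vertex `z` of `G2` into two vertices (its incident edges going to `N1` are attached to
`x`, the others to `y`). -/
def splitCompose {V W : Type} (G1 : SimpleGraph V) (G2 : SimpleGraph W)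
    (x y : V) (z : W) (N1 : Set W) : SimpleGraph (V ⊕ {w : W // w ≠ z}) :=
  SimpleGraph.fromRel (fun a b =>
    match a, b with
    | Sum.inl a, Sum.inl b => G1.Adj a b ∧ ¬(a = x ∧ b = y) ∧ ¬(a = y ∧ b = x)
    | Sum.inl a, Sum.inr b => (a = x ∧ (b : W) ∈ N1) ∨ (a = y ∧ G2.Adj z b ∧ (b : W) ∉ N1)
    | Sum.inr _, Sum.inl _ => False
    | Sum.inr a, Sum.inr b => G2.Adj (a : W) (b : W))

/-- `4`-Ore graphs (on vertex sets `Fin n`): graphs obtained from copies of `K₄` by a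
sequence of DHGO-compositions. -/
inductive IsFourOreAux : {n : ℕ} → SimpleGraph (Fin n) → Prop
  | base {n : ℕ} (G : SimpleGraph (Fin n))
      (h : Nonempty (G ≃g (⊤ : SimpleGraph (Fin 4)))) : IsFourOreAux G
  | comp {n m k : ℕ} (G : SimpleGraph (Fin n)) (G1 : SimpleGraph (Fin m))
      (G2 : SimpleGraph (Fin k)) (x y : Fin m) (z : Fin k) (N1 : Set (Fin k))
      (hxy : G1.Adj x y) (hsub : N1 ⊆ G2.neighborSet z)
      (h1ne : N1.Nonempty) (h2ne : (G2.neighborSet z \ N1).Nonempty)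
      (hG1 : IsFourOreAux G1) (hG2 : IsFourOreAux G2)
      (hiso : Nonempty (G ≃g splitCompose G1 G2 x y z N1)) : IsFourOreAux G

/-- A graph is `4`-Ore if it is isomorphic to a `4`-Ore graph built from copies of `K₄`
by DHGO-compositions. -/
def IsFourOre {V : Type} [Fintype V] (G : SimpleGraph V) : Prop :=
  ∃ (n : ℕ) (G' : SimpleGraph (Fin n)), IsFourOreAux G' ∧ Nonempty (G ≃g G')

section CriticalGraphs

open scoped Classical

/-! ### Colourings, critical graphs and potentials -/

/-- A function `V → Fin 3` is a proper colouring of the subgraph of `G` induced on `S`. -/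
def ProperOn {V : Type} (G : SimpleGraph V) (S : Finset V) (f : V → Fin 3) : Prop :=
  ∀ a ∈ S, ∀ b ∈ S, G.Adj a b → f a ≠ f b

/-- `G` has a proper colouring with three colours. -/
def ThreeCol {V : Type} (G : SimpleGraph V) : Prop :=
  ∃ f : V → Fin 3, ∀ a b, G.Adj a b → f a ≠ f b

/-- `G` is `4`-critical up to isolated vertices. -/
def EdgeCritical {V : Type} (G : SimpleGraph V) : Prop :=
  ¬ ThreeCol G ∧ ∀ H : SimpleGraph V, H ≤ G → H ≠ G → ThreeCol H

/-- The restriction of `G` to `S`, on the same vertex type. -/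
def restrictTo {V : Type} (G : SimpleGraph V) (S : Finset V) : SimpleGraph V where
  Adj a b := G.Adj a b ∧ a ∈ S ∧ b ∈ S
  symm := ⟨fun _ _ h => ⟨h.1.symm, h.2.2, h.2.1⟩⟩
  loopless := ⟨fun _ h => h.1.ne rfl⟩

/-- The number of ordered pairs in `A × B` that are adjacent in `G`. -/
def pairCount {V : Type} (G : SimpleGraph V) (A B : Finset V) : ℤ :=
  ∑ a ∈ A, ∑ b ∈ B, if G.Adj a b then 1 else 0

/-- Twice the Kostochka–Yancey potential `5|S| - 3|E(G[S])|`. -/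
def potential {V : Type} (G : SimpleGraph V) (S : Finset V) : ℤ :=
  10 * (S.card : ℤ) - 3 * pairCount G S S

variable {V : Type}

lemma restrictTo_le (G : SimpleGraph V) (S : Finset V) : restrictTo G S ≤ G :=
  fun _ _ h => h.1

lemma ThreeCol.properOn {G : SimpleGraph V} {S : Finset V} (h : ThreeCol (restrictTo G S)) :
    ∃ f, ProperOn G S f := by
  obtain ⟨f, hf⟩ := h
  exact ⟨f, fun a ha b hb hab => hf a b ⟨hab, ha, hb⟩⟩

lemma ThreeCol.mono {G H : SimpleGraph V} (h : ThreeCol G) (hle : H ≤ G) : ThreeCol H := by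
  obtain ⟨f, hf⟩ := h
  exact ⟨f, fun a b hab => hf a b (hle hab)⟩

lemma ProperOn.mono {G H : SimpleGraph V} {S T : Finset V} {f : V → Fin 3}
    (h : ProperOn G S f) (hST : T ⊆ S) (hle : ∀ a ∈ T, ∀ b ∈ T, H.Adj a b → G.Adj a b) :
    ProperOn H T f :=
  fun a ha b hb hab => h a (hST ha) b (hST hb) (hle a ha b hb hab)

lemma ProperOn.perm {G : SimpleGraph V} {S : Finset V} {f : V → Fin 3}
    (h : ProperOn G S f) (σ : Equiv.Perm (Fin 3)) : ProperOn G S (fun v => σ (f v)) :=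
  fun a ha b hb hab e => h a ha b hb hab (σ.injective e)

lemma exists_perm_fin_three :
    ∀ a b a' b' : Fin 3, (a = b ↔ a' = b') → ∃ σ : Equiv.Perm (Fin 3), σ a = a' ∧ σ b = b' := by
  decide

lemma exists_avoid_of_card_le_two (T : Finset (Fin 3)) (h : T.card ≤ 2) : ∃ c, c ∉ T := by
  by_contra! hc
  have : T = Finset.univ := Finset.eq_univ_iff_forall.2 hc
  rw [this] at h
  simp at h

lemma EdgeCritical.threeCol_of_not_adj {G H : SimpleGraph V} (hG : EdgeCritical G) (hle : H ≤ G)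
    {a b : V} (hab : G.Adj a b) (hn : ¬ H.Adj a b) : ThreeCol H :=
  hG.2 H hle (by rintro rfl; exact hn hab)

lemma exists_color_avoiding (f : V → Fin 3) (T : Finset V) (h : T.card ≤ 2) :
    ∃ c, ∀ v ∈ T, c ≠ f v := by
  obtain ⟨c, hc⟩ := exists_avoid_of_card_le_two (T.image f) (Finset.card_image_le.trans h)
  exact ⟨c, fun v hv e => hc (Finset.mem_image.2 ⟨v, hv, e.symm⟩)⟩

lemma ProperOn.insert_update {G : SimpleGraph V} {S : Finset V} {f : V → Fin 3}
    (h : ProperOn G S f) {v : V} (hv : v ∉ S) {c : Fin 3} (hc : ∀ w ∈ S, G.Adj v w → c ≠ f w) :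
    ProperOn G (insert v S) (Function.update f v c) := by
  intro a ha b hb hab
  rw [Finset.mem_insert] at ha hb
  by_cases hav : a = v
  · subst hav
    have hba : b ≠ a := hab.ne'
    rw [Function.update_self, Function.update_of_ne hba]
    exact hc b (hb.resolve_left hba) hab
  · by_cases hbv : b = v
    · subst hbv
      rw [Function.update_self, Function.update_of_ne hav]
      exact (hc a (ha.resolve_left hav) hab.symm).symm
    · rw [Function.update_of_ne hav, Function.update_of_ne hbv]
      exact h a (ha.resolve_left hav) b (hb.resolve_left hbv) hab

/-! #### Counting adjacent pairs -/

lemma pairCount_eq_card (G : SimpleGraph V) (A B : Finset V) :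
    pairCount G A B = (((A ×ˢ B).filter fun p => G.Adj p.1 p.2).card : ℤ) := by
  unfold pairCount
  rw [Finset.card_filter, Finset.sum_product]
  push_cast
  rfl

lemma pairCount_comm (G : SimpleGraph V) (A B : Finset V) :
    pairCount G A B = pairCount G B A := by
  unfold pairCount
  rw [Finset.sum_comm]
  simp only [G.adj_comm]

lemma pairCount_nonneg (G : SimpleGraph V) (A B : Finset V) : 0 ≤ pairCount G A B := by
  rw [pairCount_eq_card]; positivity

lemma pairCount_union_left (G : SimpleGraph V) {A A' : Finset V} (B : Finset V)
    (h : Disjoint A A') : pairCount G (A ∪ A') B = pairCount G A B + pairCount G A' B :=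
  Finset.sum_union h

lemma pairCount_union_right (G : SimpleGraph V) (A : Finset V) {B B' : Finset V}
    (h : Disjoint B B') : pairCount G A (B ∪ B') = pairCount G A B + pairCount G A B' := by
  rw [pairCount_comm, pairCount_union_left _ _ h, pairCount_comm, pairCount_comm G B']

lemma pairCount_mono {G H : SimpleGraph V} {A B A' B' : Finset V} (hA : A ⊆ A') (hB : B ⊆ B')
    (h : ∀ a ∈ A, ∀ b ∈ B, G.Adj a b → H.Adj a b) : pairCount G A B ≤ pairCount H A' B' := by
  rw [pairCount_eq_card, pairCount_eq_card]
  norm_cast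
  apply Finset.card_le_card
  intro p hp
  simp only [Finset.mem_filter, Finset.mem_product] at hp ⊢
  exact ⟨⟨hA hp.1.1, hB hp.1.2⟩, h _ hp.1.1 _ hp.1.2 hp.2⟩

lemma pairCount_congr {G H : SimpleGraph V} {A B : Finset V}
    (h : ∀ a ∈ A, ∀ b ∈ B, (G.Adj a b ↔ H.Adj a b)) : pairCount G A B = pairCount H A B :=
  le_antisymm (pairCount_mono subset_rfl subset_rfl fun a ha b hb => (h a ha b hb).1)
    (pairCount_mono subset_rfl subset_rfl fun a ha b hb => (h a ha b hb).2)

/-- Gaining one edge inside `S` gains two ordered pairs. -/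
lemma pairCount_add_two_le {G H : SimpleGraph V} {S : Finset V} {u v : V} (hu : u ∈ S)
    (hv : v ∈ S) (hH : H.Adj u v) (hG : ¬ G.Adj u v)
    (h : ∀ a ∈ S, ∀ b ∈ S, G.Adj a b → H.Adj a b) :
    pairCount G S S + 2 ≤ pairCount H S S := by
  rw [pairCount_eq_card, pairCount_eq_card]
  norm_cast
  have hne : (u, v) ≠ (v, u) := by simp [hH.ne]
  rw [← Finset.card_pair hne, ← Finset.card_union_of_disjoint]
  · apply Finset.card_le_card
    intro p hp
    simp only [Finset.mem_union, Finset.mem_filter, Finset.mem_product, Finset.mem_insert,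
      Finset.mem_singleton] at hp ⊢
    rcases hp with hp | rfl | rfl
    · exact ⟨hp.1, h _ hp.1.1 _ hp.1.2 hp.2⟩
    · exact ⟨⟨hu, hv⟩, hH⟩
    · exact ⟨⟨hv, hu⟩, hH.symm⟩
  · rw [Finset.disjoint_right]
    intro p hp
    simp only [Finset.mem_filter, Finset.mem_insert, Finset.mem_singleton] at hp ⊢
    rcases hp with rfl | rfl
    · exact fun hp => hG hp.2
    · exact fun hp => hG hp.2.symm

lemma pairCount_self_le (G : SimpleGraph V) (S : Finset V) :
    pairCount G S S ≤ (S.card : ℤ) * S.card - S.card := by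
  rw [pairCount_eq_card]
  have h : ((S ×ˢ S).filter fun p => G.Adj p.1 p.2) ⊆ S.offDiag := by
    intro p hp
    simp only [Finset.mem_filter, Finset.mem_product, Finset.mem_offDiag] at hp ⊢
    exact ⟨hp.1.1, hp.1.2, hp.2.ne⟩
  have h2 := Finset.card_le_card h
  rw [Finset.offDiag_card] at h2
  have h3 : S.card ≤ S.card * S.card := Nat.le_mul_self _
  zify [h3] at h2
  exact h2

lemma pairCount_singleton_left (G : SimpleGraph V) (v : V) (B : Finset V) :
    pairCount G {v} B = ((B.filter (G.Adj v)).card : ℤ) := by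
  unfold pairCount
  rw [Finset.sum_singleton, Finset.card_filter]
  push_cast
  rfl

lemma pairCount_singleton_self (G : SimpleGraph V) (v : V) : pairCount G {v} {v} = 0 := by
  simp [pairCount]

lemma potential_union (G : SimpleGraph V) {A B : Finset V} (h : Disjoint A B) :
    potential G (A ∪ B) = potential G A + potential G B - 6 * pairCount G A B := by
  unfold potential
  rw [pairCount_union_left _ _ h, pairCount_union_right _ _ h, pairCount_union_right _ _ h,
    Finset.card_union_of_disjoint h, pairCount_comm G B A]
  push_cast
  ring

lemma potential_insert (G : SimpleGraph V) {v : V} {A : Finset V} (h : v ∉ A) :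
    potential G (insert v A) = potential G A + 10 - 6 * ((A.filter (G.Adj v)).card : ℤ) := by
  rw [Finset.insert_eq, potential_union _ (by simpa using h), pairCount_singleton_left]
  unfold potential
  rw [pairCount_singleton_self]
  simp
  ring

lemma potential_anti {G H : SimpleGraph V} {S : Finset V}
    (h : ∀ a ∈ S, ∀ b ∈ S, G.Adj a b → H.Adj a b) : potential H S ≤ potential G S := by
  unfold potential
  linarith [pairCount_mono subset_rfl subset_rfl h]

lemma potential_ge (G : SimpleGraph V) (S : Finset V) :
    13 * (S.card : ℤ) - 3 * (S.card * S.card) ≤ potential G S := by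
  unfold potential
  linarith [pairCount_self_le G S]

lemma potential_le_add_edge {G H : SimpleGraph V} {S : Finset V} {u v : V} 
    (h : ∀ a ∈ S, ∀ b ∈ S, H.Adj a b → G.Adj a b ∨ (a = u ∧ b = v) ∨ (a = v ∧ b = u)) :
    potential G S ≤ potential H S + 6 := by
  unfold potential
  suffices pairCount H S S ≤ pairCount G S S + 2 by linarith
  rw [pairCount_eq_card, pairCount_eq_card]
  norm_cast
  refine (Finset.card_le_card (t := ((S ×ˢ S).filter fun p => G.Adj p.1 p.2) ∪
    {(u, v), (v, u)}) ?_).trans ((Finset.card_union_le _ _).trans ?_)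
  · intro p hp
    simp only [Finset.mem_union, Finset.mem_filter, Finset.mem_product, Finset.mem_insert,
      Finset.mem_singleton, Prod.ext_iff] at hp ⊢
    rcases h _ hp.1.1 _ hp.1.2 hp.2 with h | h | h <;> tauto
  · exact Nat.add_le_add_left Finset.card_le_two _

/-! #### Supports and degrees -/

variable [Fintype V]

/-- The set of non-isolated vertices. -/
def supportOf (G : SimpleGraph V) : Finset V := Finset.univ.filter fun v => ∃ w, G.Adj v w

/-- The finset of neighbours of `v`. -/
def nbrs (G : SimpleGraph V) (v : V) : Finset V := Finset.univ.filter (G.Adj v)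

lemma mem_supportOf {G : SimpleGraph V} {v : V} : v ∈ supportOf G ↔ ∃ w, G.Adj v w := by
  simp [supportOf]

lemma mem_nbrs {G : SimpleGraph V} {v w : V} : w ∈ nbrs G v ↔ G.Adj v w := by
  simp [nbrs]

lemma left_mem_supportOf {G : SimpleGraph V} {v w : V} (h : G.Adj v w) : v ∈ supportOf G :=
  mem_supportOf.2 ⟨w, h⟩

lemma right_mem_supportOf {G : SimpleGraph V} {v w : V} (h : G.Adj v w) : w ∈ supportOf G :=
  mem_supportOf.2 ⟨v, h.symm⟩

lemma exists_edgeCritical_le {G : SimpleGraph V} (h : ¬ ThreeCol G) :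
    ∃ H ≤ G, EdgeCritical H := by
  obtain ⟨H, hHG, hH⟩ := (Set.toFinite {H : SimpleGraph V | ¬ ThreeCol H}).exists_le_minimal h
  refine ⟨H, hHG, hH.prop, fun K hK hne => ?_⟩
  by_contra hc
  exact hne (hH.eq_of_le hc hK)

lemma EdgeCritical.exists_properOn {G : SimpleGraph V} (hG : EdgeCritical G) {S : Finset V}
    {v : V} (hv : v ∈ supportOf G) (hvS : v ∉ S) : ∃ f, ProperOn G S f := by
  obtain ⟨w, hw⟩ := mem_supportOf.1 hv
  exact (hG.threeCol_of_not_adj (restrictTo_le G S) hw fun h => hvS h.2.1).properOn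

lemma threeCol_of_properOn {G : SimpleGraph V} {S : Finset V} {f : V → Fin 3}
    (h : ProperOn G S f) (hS : supportOf G ⊆ S) : ThreeCol G :=
  ⟨f, fun a b hab => h a (hS (left_mem_supportOf hab)) b (hS (right_mem_supportOf hab)) hab⟩

lemma EdgeCritical.three_le_card_nbrs {G : SimpleGraph V} (hG : EdgeCritical G) {v : V}
    (hv : v ∈ supportOf G) : 3 ≤ (nbrs G v).card := by
  by_contra! hlt
  obtain ⟨f, hf⟩ := hG.exists_properOn hv (Finset.notMem_erase v Finset.univ)
  obtain ⟨c, hc⟩ := exists_color_avoiding f (nbrs G v) (by omega)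
  refine hG.1 (threeCol_of_properOn
    (hf.insert_update (Finset.notMem_erase v _) fun w _ hw => hc w (mem_nbrs.2 hw)) ?_)
  intro a _
  simp

lemma four_le_card_supportOf {G : SimpleGraph V} (hG : ¬ ThreeCol G) :
    4 ≤ (supportOf G).card := by
  by_contra! hlt
  obtain ⟨e⟩ : Nonempty (supportOf G ↪ Fin 3) := by
    rw [Function.Embedding.nonempty_iff_card_le]
    simpa using Nat.lt_succ_iff.1 hlt
  refine hG (threeCol_of_properOn (S := supportOf G)
    (f := fun v => if h : v ∈ supportOf G then e ⟨v, h⟩ else 0) ?_ subset_rfl)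
  intro a ha b hb hab
  simp only [ha, hb, dif_pos]
  intro he
  exact hab.ne (congrArg Subtype.val (e.injective he))

lemma EdgeCritical.adj_of_card_eq_four {G : SimpleGraph V} (hG : ¬ ThreeCol G)
    (h4 : (supportOf G).card = 4) {a b : V} (ha : a ∈ supportOf G) (hb : b ∈ supportOf G)
    (hne : a ≠ b) : G.Adj a b := by
  by_contra hab
  obtain ⟨e⟩ : Nonempty ((supportOf G).erase b ↪ Fin 3) := by
    rw [Function.Embedding.nonempty_iff_card_le]
    rw [Fintype.card_coe, Finset.card_erase_of_mem hb, h4, Fintype.card_fin]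
  have hae : a ∈ (supportOf G).erase b := Finset.mem_erase.2 ⟨hne, ha⟩
  have hf : ProperOn G ((supportOf G).erase b)
      (fun v => if h : v ∈ (supportOf G).erase b then e ⟨v, h⟩ else 0) := by
    intro u hu v hv huv
    simp only [hu, hv, dif_pos]
    intro he
    exact huv.ne (congrArg Subtype.val (e.injective he))
  refine hG (threeCol_of_properOn (hf.insert_update (Finset.notMem_erase b _)
    (c := e ⟨a, hae⟩) ?_) ?_)
  · intro w hw hbw
    simp only [hw, dif_pos]
    intro he
    have : a = w := congrArg Subtype.val (e.injective he)
    subst this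
    exact hab hbw.symm
  · rw [Finset.insert_erase hb]

end CriticalGraphs

section Collapse

open scoped Classical

variable {V : Type}

/-! ### Replacing a coloured set by a triangle -/

/-- The graph obtained from `G` by replacing `R`, coloured by `f`, by a triangle whose vertices
represent the colour classes of `f`. -/
def collapse (G : SimpleGraph V) (R : Finset V) (f : V → Fin 3) : SimpleGraph (V ⊕ Fin 3) where
  Adj a b := match a, b with
    | .inl a, .inl b => G.Adj a b ∧ a ∉ R ∧ b ∉ R
    | .inl a, .inr i => a ∉ R ∧ ∃ r ∈ R, f r = i ∧ G.Adj a r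
    | .inr i, .inl a => a ∉ R ∧ ∃ r ∈ R, f r = i ∧ G.Adj a r
    | .inr i, .inr j => i ≠ j
  symm := ⟨by
    rintro (a | i) (b | j) h
    · exact ⟨h.1.symm, h.2.2, h.2.1⟩
    · exact h
    · exact h
    · exact Ne.symm h⟩
  loopless := ⟨by
    rintro (a | i) h
    · exact h.1.ne rfl
    · exact h rfl⟩

lemma exists_coloring_of_collapse {G : SimpleGraph V} {R : Finset V} {f : V → Fin 3}
    (hf : ProperOn G R f) (h : ThreeCol (collapse G R f)) :
    ∃ g : V → Fin 3, (∀ a b, G.Adj a b → g a ≠ g b) ∧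
      ∀ r ∈ R, ∀ s ∈ R, f r = f s → g r = g s := by
  obtain ⟨g, hg⟩ := h
  refine ⟨fun v => if v ∈ R then g (.inr (f v)) else g (.inl v), fun a b hab => ?_,
    fun r hr s hs he => by simp [hr, hs, he]⟩
  by_cases ha : a ∈ R <;> by_cases hb : b ∈ R <;> simp only [ha, hb, if_true, if_false]
  · exact hg _ _ (hf a ha b hb hab)
  · exact hg (.inr (f a)) (.inl b) ⟨hb, a, ha, rfl, hab.symm⟩
  · exact hg (.inl a) (.inr (f b)) ⟨ha, b, hb, rfl, hab⟩
  · exact hg (.inl a) (.inl b) ⟨hab, ha, hb⟩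

lemma pairCount_disjSum (W : SimpleGraph (V ⊕ Fin 3)) (B : Finset V) (X : Finset (Fin 3)) :
    pairCount W (B.disjSum X) (B.disjSum X) =
      (∑ a ∈ B, ∑ b ∈ B, if W.Adj (.inl a) (.inl b) then 1 else 0) +
      2 * (∑ a ∈ B, ∑ i ∈ X, if W.Adj (.inl a) (.inr i) then 1 else 0) +
      ∑ i ∈ X, ∑ j ∈ X, if W.Adj (.inr i) (.inr j) then 1 else 0 := by
  have hc : (∑ i ∈ X, ∑ a ∈ B, if W.Adj (.inr i) (.inl a) then (1 : ℤ) else 0) =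
      ∑ a ∈ B, ∑ i ∈ X, if W.Adj (.inl a) (.inr i) then 1 else 0 := by
    rw [Finset.sum_comm]
    simp only [W.adj_comm]
  unfold pairCount
  simp only [Finset.sum_disjSum, Finset.sum_add_distrib]
  rw [hc]
  ring

lemma card_colors_adj_le {G : SimpleGraph V} {R : Finset V} {f : V → Fin 3}
    {W : SimpleGraph (V ⊕ Fin 3)} (hW : W ≤ collapse G R f) (X : Finset (Fin 3)) (a : V) :
    (X.filter fun i => W.Adj (.inl a) (.inr i)).card ≤
      ((R.filter fun r => f r ∈ X).filter (G.Adj a)).card := by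
  refine (Finset.card_le_card (t := (((R.filter fun r => f r ∈ X).filter (G.Adj a)).image f))
    ?_).trans Finset.card_image_le
  intro i hi
  simp only [Finset.mem_filter, Finset.mem_image] at hi ⊢
  obtain ⟨_, r, hr, rfl, har⟩ := hW hi.2
  exact ⟨r, ⟨⟨hr, hi.1⟩, har⟩, rfl⟩

lemma potential_collapse_aux {G : SimpleGraph V} {R : Finset V} {f : V → Fin 3}
    {W : SimpleGraph (V ⊕ Fin 3)} (hW : W ≤ collapse G R f) {B : Finset V} (hB : Disjoint B R)
    (X : Finset (Fin 3)) :
    potential G (B ∪ R) + 6 * pairCount G B (R.filter fun r => f r ∉ X) ≤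
      potential W (B.disjSum X) + potential G R -
        potential W ((∅ : Finset V).disjSum X) := by
  have h1 : (∑ a ∈ B, ∑ b ∈ B, if W.Adj (.inl a) (.inl b) then (1 : ℤ) else 0) ≤
      pairCount G B B := by
    refine Finset.sum_le_sum fun a _ => Finset.sum_le_sum fun b _ => ?_
    by_cases h : W.Adj (.inl a) (.inl b)
    · have : G.Adj a b := (hW h).1
      simp [h, this]
    · simp only [h, if_false]
      split_ifs <;> norm_num
  have h2 : (∑ a ∈ B, ∑ i ∈ X, if W.Adj (.inl a) (.inr i) then (1 : ℤ) else 0) ≤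
      pairCount G B (R.filter fun r => f r ∈ X) := by
    refine Finset.sum_le_sum fun a _ => ?_
    have := card_colors_adj_le hW X a
    rw [Finset.card_filter, Finset.card_filter] at this
    exact_mod_cast this
  have h3 : pairCount G B R = pairCount G B (R.filter fun r => f r ∈ X) +
      pairCount G B (R.filter fun r => f r ∉ X) := by
    rw [← pairCount_union_right _ _ (Finset.disjoint_filter_filter_not _ _ _),
      Finset.filter_union_filter_not_eq]
  rw [potential_union _ hB, h3]
  unfold potential
  rw [pairCount_disjSum, pairCount_disjSum]
  simp only [Finset.card_disjSum, Finset.card_empty, Finset.sum_empty]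
  push_cast
  linarith

lemma potential_collapse {G : SimpleGraph V} {R : Finset V} {f : V → Fin 3}
    {W : SimpleGraph (V ⊕ Fin 3)} (hW : W ≤ collapse G R f) {B : Finset V} (hB : Disjoint B R)
    (X : Finset (Fin 3)) :
    potential G (B ∪ R) ≤ potential W (B.disjSum X) + potential G R -
        potential W ((∅ : Finset V).disjSum X) := by
  linarith [potential_collapse_aux hW hB X, pairCount_nonneg G B (R.filter fun r => f r ∉ X)]

lemma potential_collapse_of_missed {G : SimpleGraph V} {R : Finset V} {f : V → Fin 3}
    {W : SimpleGraph (V ⊕ Fin 3)} (hW : W ≤ collapse G R f) {B : Finset V} (hB : Disjoint B R)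
    {X : Finset (Fin 3)} {a r : V} (ha : a ∈ B) (hr : r ∈ R) (har : G.Adj a r) (hX : f r ∉ X) :
    potential G (B ∪ R) + 6 ≤ potential W (B.disjSum X) + potential G R -
        potential W ((∅ : Finset V).disjSum X) := by
  have h : 1 ≤ pairCount G B (R.filter fun r => f r ∉ X) := by
    calc (1 : ℤ) = pairCount G {a} {r} := by simp only [pairCount, Finset.sum_singleton, har, if_true]
      _ ≤ _ := pairCount_mono (by simpa using ha) (by simp [hr, hX]) fun _ _ _ _ h => h
  linarith [potential_collapse_aux hW hB X]

lemma potential_collapse_empty {G : SimpleGraph V} {R : Finset V} {f : V → Fin 3}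
    {W : SimpleGraph (V ⊕ Fin 3)} (hW : W ≤ collapse G R f) (B : Finset V) :
    potential G B ≤ potential W (B.disjSum ∅) := by
  unfold potential
  rw [pairCount_disjSum]
  simp only [Finset.card_disjSum, Finset.card_empty, Finset.sum_empty, Finset.sum_const_zero]
  have h1 : (∑ a ∈ B, ∑ b ∈ B, if W.Adj (.inl a) (.inl b) then (1 : ℤ) else 0) ≤
      pairCount G B B := by
    refine Finset.sum_le_sum fun a _ => Finset.sum_le_sum fun b _ => ?_
    by_cases h : W.Adj (.inl a) (.inl b)
    · have : G.Adj a b := (hW h).1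
      simp [h, this]
    · simp only [h, if_false]
      split_ifs <;> norm_num
  push_cast
  linarith

lemma potential_triangle_ge (W : SimpleGraph (V ⊕ Fin 3)) (X : Finset (Fin 3)) :
    13 * (X.card : ℤ) - 3 * (X.card * X.card) ≤ potential W ((∅ : Finset V).disjSum X) := by
  simpa using potential_ge W ((∅ : Finset V).disjSum X)

lemma adj_of_potential_triangle_le {W : SimpleGraph (V ⊕ Fin 3)}
    (h : potential W ((∅ : Finset V).disjSum Finset.univ) ≤ 12) {i j : Fin 3} (hij : i ≠ j) :
    W.Adj (.inr i) (.inr j) := by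
  by_contra hn
  let K : SimpleGraph (V ⊕ Fin 3) := ⊤
  have hi : Sum.inr i ∈ ((∅ : Finset V).disjSum Finset.univ) := by simp
  have hj : Sum.inr j ∈ ((∅ : Finset V).disjSum Finset.univ) := by simp
  have h2 := pairCount_add_two_le (G := W) (H := K) hi hj (by simp [K, hij]) hn
    fun a _ b _ hab => hab.ne
  have h3 := pairCount_self_le K ((∅ : Finset V).disjSum Finset.univ)
  unfold potential at h
  simp only [Finset.card_disjSum, Finset.card_empty, Finset.card_univ, Fintype.card_fin] at h h3
  push_cast at h h3
  linarith

variable [Fintype V]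

/-- A critical subgraph of the collapsed graph, described in terms of `G`. -/
lemma exists_edgeCritical_collapse {G : SimpleGraph V} {R : Finset V} {f : V → Fin 3}
    (hcol : ¬ ThreeCol (collapse G R f)) :
    ∃ (W : SimpleGraph (V ⊕ Fin 3)) (B : Finset V) (X : Finset (Fin 3)),
      W ≤ collapse G R f ∧ EdgeCritical W ∧ supportOf W = B.disjSum X ∧ B ⊆ supportOf G ∧
        Disjoint B R ∧ B.Nonempty ∧
        ((∃ g, ProperOn G B g) → X.Nonempty) := by
  obtain ⟨W, hW, hWc⟩ := exists_edgeCritical_le hcol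
  have hsupp : supportOf W = (supportOf W).toLeft.disjSum (supportOf W).toRight :=
    Finset.toLeft_disjSum_toRight.symm
  have hcoll : ∀ a ∈ (supportOf W).toLeft, a ∈ supportOf G ∧ a ∉ R := by
    intro a ha
    rw [Finset.mem_toLeft, mem_supportOf] at ha
    obtain ⟨b | i, hb⟩ := ha
    · exact ⟨left_mem_supportOf (hW hb).1, (hW hb).2.1⟩
    · obtain ⟨haR, r, _, _, har⟩ := hW hb
      exact ⟨left_mem_supportOf har, haR⟩
  refine ⟨W, (supportOf W).toLeft, (supportOf W).toRight, hW, hWc, hsupp,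
    fun a ha => (hcoll a ha).1, Finset.disjoint_left.2 fun a ha => (hcoll a ha).2, ?_, ?_⟩
  · rw [Finset.nonempty_iff_ne_empty]
    intro he
    have h4 := four_le_card_supportOf hWc.1
    rw [hsupp, Finset.card_disjSum, he] at h4
    have := Finset.card_le_univ (supportOf W).toRight
    simp at this h4
    omega
  · rintro ⟨g, hg⟩
    rw [Finset.nonempty_iff_ne_empty]
    intro he
    have hr : ∀ i : Fin 3, Sum.inr i ∉ supportOf W := by
      intro i hi
      rw [← Finset.mem_toRight, he] at hi
      simp at hi
    refine hWc.1 ⟨Sum.elim g (fun _ => 0), ?_⟩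
    rintro (a | i) (b | j) hab
    · exact hg a (Finset.mem_toLeft.2 (left_mem_supportOf hab)) b
        (Finset.mem_toLeft.2 (right_mem_supportOf hab)) (hW hab).1
    · exact absurd (right_mem_supportOf hab) (hr j)
    · exact absurd (left_mem_supportOf hab) (hr i)
    · exact absurd (left_mem_supportOf hab) (hr i)

end Collapse

section TwoCuts

open scoped Classical

variable {V : Type}

/-! ### Separations of order two -/

/-- A separation `(B, C)` of the support of `H` along `{p, q}`, where `B` has the potential of a
single vertex and `C` forces different colours on `p` and `q`. -/
structure IsTightSplit [Fintype V] (H : SimpleGraph V) (B C : Finset V) (p q : V) : Prop where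
  mem_support : ∀ v, v ∈ supportOf H ↔ v ∈ B ∨ v ∈ C
  disj : Disjoint B C
  left_mem : p ∈ B
  right_mem : q ∈ B
  ne : p ≠ q
  not_adj : ¬ H.Adj p q
  three_le_card : 3 ≤ C.card
  potential_le : potential H B ≤ 10
  sep : ∀ a ∈ B, ∀ c ∈ C, H.Adj a c → a = p ∨ a = q
  color_ne : ∀ f, ProperOn H (insert p (insert q C)) f → f p ≠ f q

/-- A separation `(B, C)` of the support of `G` along `{p, q}`, where `B` forces equal colours on
`p` and `q`, and `C` forces different ones. -/
structure IsTwoCut [Fintype V] (G : SimpleGraph V) (B C : Finset V) (p q : V) : Prop where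
  mem_support : ∀ v, v ∈ supportOf G ↔ v ∈ B ∨ v ∈ C
  disj : Disjoint B C
  left_mem : p ∈ B
  right_mem : q ∈ B
  ne : p ≠ q
  not_adj : ¬ G.Adj p q
  exists_right : ∃ c, c ∈ C
  exists_left : ∃ b ∈ B, b ≠ p ∧ b ≠ q
  sep : ∀ a ∈ B, ∀ c ∈ C, G.Adj a c → a = p ∨ a = q
  color_eq : ∀ f, ProperOn G B f → f p = f q
  color_ne : ∀ f, ProperOn G (insert p (insert q C)) f → f p ≠ f q

/-- No two vertices separate the support of `G`. -/
def NoTwoCut [Fintype V] (G : SimpleGraph V) : Prop :=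
  ∀ (C : Finset V) (p q : V), C.Nonempty → C ⊆ supportOf G → p ∉ C → q ∉ C →
    (∀ c ∈ C, ∀ d ∉ C, G.Adj c d → d = p ∨ d = q) → ∀ d ∈ supportOf G, d ∈ C ∨ d = p ∨ d = q

lemma ProperOn.glue {G : SimpleGraph V} {S C : Finset V} {p q : V} {f g : V → Fin 3}
    (hC : ∀ c ∈ C, ∀ d ∈ S, d ∉ C → G.Adj c d → d = p ∨ d = q) (hp : p ∉ C) (hq : q ∉ C)
    (hg : ProperOn G (insert p (insert q C)) g) (hf : ProperOn G (S \ C) f)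
    (hgp : g p = f p) (hgq : g q = f q) :
    ProperOn G S fun v => if v ∈ C then g v else f v := by
  have key : ∀ a ∈ C, ∀ b ∈ S, b ∉ C → G.Adj a b → g a ≠ f b := by
    intro a ha b hb hbC hab
    rcases hC a ha b hb hbC hab with rfl | rfl
    · rw [← hgp]; exact hg a (by simp [ha]) b (by simp) hab
    · rw [← hgq]; exact hg a (by simp [ha]) b (by simp) hab
  intro a ha b hb hab
  by_cases haC : a ∈ C <;> by_cases hbC : b ∈ C <;> simp only [haC, hbC, if_true, if_false]
  · exact hg a (by simp [haC]) b (by simp [hbC]) hab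
  · exact key a haC b hb hbC hab
  · exact (key b hbC a ha haC hab.symm).symm
  · exact hf a (by simp [ha, haC]) b (by simp [hb, hbC]) hab

lemma ProperOn.update_of_isolated {G : SimpleGraph V} {S : Finset V} {f : V → Fin 3}
    (hf : ProperOn G S f) {v : V} (hv : ∀ w ∈ S, ¬ G.Adj v w) (c : Fin 3) :
    ProperOn G S (Function.update f v c) := by
  intro a ha b hb hab
  have hav : a ≠ v := by rintro rfl; exact hv b hb hab
  have hbv : b ≠ v := by rintro rfl; exact hv a ha hab.symm
  rw [Function.update_of_ne hav, Function.update_of_ne hbv]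
  exact hf a ha b hb hab

lemma exists_ne_fin_three (c : Fin 3) : ∃ d, d ≠ c := ⟨c + 1, by decide +revert⟩

variable [Fintype V]

private lemma isTwoCut_of_colorings {G : SimpleGraph V} {C D : Finset V} {p q : V}
    (hC : C.Nonempty) (hD : D.Nonempty) (hCD : Disjoint C D)
    (hCs : C ⊆ supportOf G) (hDs : D ⊆ supportOf G)
    (hpC : p ∉ C) (hqC : q ∉ C) (hpD : p ∉ D) (hqD : q ∉ D)
    (hs : ∀ v ∈ supportOf G, v = p ∨ v = q ∨ v ∈ C ∨ v ∈ D)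
    (hsep : ∀ c ∈ C, ∀ d ∈ D, ¬ G.Adj c d) (hne : p ≠ q) (hadj : ¬ G.Adj p q)
    (hex : ∃ f, ProperOn G (insert p (insert q D)) f)
    (heq : ∀ f, ProperOn G (insert p (insert q D)) f → f p = f q)
    (hnq : ∀ f, ProperOn G (insert p (insert q C)) f → f p ≠ f q) :
    IsTwoCut G (insert p (insert q D)) C p q := by
  obtain ⟨f, hf⟩ := hex
  have hps : p ∈ supportOf G := by
    by_contra h
    obtain ⟨c, hc⟩ := exists_ne_fin_three (f q)
    have := heq _ (hf.update_of_isolated (v := p)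
      (fun w _ hw => h (left_mem_supportOf hw)) c)
    rw [Function.update_self, Function.update_of_ne hne.symm] at this
    exact hc this
  have hqs : q ∈ supportOf G := by
    by_contra h
    obtain ⟨c, hc⟩ := exists_ne_fin_three (f p)
    have := heq _ (hf.update_of_isolated (v := q)
      (fun w _ hw => h (left_mem_supportOf hw)) c)
    rw [Function.update_self, Function.update_of_ne hne] at this
    exact hc this.symm
  obtain ⟨d, hd⟩ := hD
  refine ⟨fun v => ⟨fun hv => ?_, ?_⟩, ?_, by simp, by simp, hne, hadj, hC, ⟨d, by simp [hd], ?_⟩,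
    ?_, heq, hnq⟩
  · have := hs v hv
    simp only [Finset.mem_insert]
    tauto
  · simp only [Finset.mem_insert]
    rintro ((rfl | rfl | h) | h)
    exacts [hps, hqs, hDs h, hCs h]
  · simp [hpC, hqC, hCD.symm]
  · exact ⟨by rintro rfl; exact hpD hd, by rintro rfl; exact hqD hd⟩
  · intro a ha c hc hac
    simp only [Finset.mem_insert] at ha
    rcases ha with h | h | h
    · exact Or.inl h
    · exact Or.inr h
    · exact absurd hac.symm (hsep c hc a h)

lemma EdgeCritical.exists_isTwoCut {G : SimpleGraph V} (hG : EdgeCritical G)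
    (h : ¬ NoTwoCut G) : ∃ B C p q, IsTwoCut G B C p q := by
  unfold NoTwoCut at h
  push Not at h
  obtain ⟨C, p, q, hC, hCs, hpC, hqC, hsep, d, hds, hdC, hdp, hdq⟩ := h
  let D := ((supportOf G \ C).erase p).erase q
  have hD : ∀ v, v ∈ D ↔ v ≠ q ∧ v ≠ p ∧ v ∈ supportOf G ∧ v ∉ C := by simp [D]
  obtain ⟨c, hc⟩ := hC
  obtain ⟨f, hf⟩ := hG.exists_properOn (S := insert p (insert q C)) hds (by simp [*])
  obtain ⟨g, hg⟩ := hG.exists_properOn (S := insert p (insert q D)) (hCs hc) (by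
    simp only [Finset.mem_insert, hD, not_or]
    refine ⟨?_, ?_, fun h => h.2.2.2 hc⟩ <;> rintro rfl <;> contradiction)
  have glue : ∀ f g, ProperOn G (insert p (insert q C)) f → ProperOn G (insert p (insert q D)) g →
      ¬ (f p = f q ↔ g p = g q) := by
    intro f g hf hg hiff
    obtain ⟨σ, hσp, hσq⟩ := exists_perm_fin_three _ _ _ _ hiff
    refine hG.1 (threeCol_of_properOn (S := supportOf G) (ProperOn.glue (p := p) (q := q)
      (fun c hc d _ => hsep c hc d) hpC hqC (hf.perm σ) (hg.mono ?_ fun _ _ _ _ h => h)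
      hσp hσq) subset_rfl)
    intro v hv
    simp only [Finset.mem_insert, hD, Finset.mem_sdiff] at hv ⊢
    tauto
  have hne : p ≠ q := by
    rintro rfl
    exact glue f g hf hg (by simp)
  have hadj : ¬ G.Adj p q := fun hpq => glue f g hf hg
    (iff_of_false (hf p (by simp) q (by simp) hpq) (hg p (by simp) q (by simp) hpq))
  have hdD : d ∈ D := (hD d).2 ⟨hdq, hdp, hds, hdC⟩
  have hCD : Disjoint C D := Finset.disjoint_left.2 fun a ha had => ((hD a).1 had).2.2.2 ha
  have hDs : D ⊆ supportOf G := fun a ha => ((hD a).1 ha).2.2.1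
  have hnoadj : ∀ c ∈ C, ∀ d ∈ D, ¬ G.Adj c d := by
    intro c hc d hd hcd
    have := (hD d).1 hd
    rcases hsep c hc d this.2.2.2 hcd with h | h
    exacts [this.2.1 h, this.1 h]
  have hpD : p ∉ D := fun h => ((hD p).1 h).2.1 rfl
  have hqD : q ∉ D := fun h => ((hD q).1 h).1 rfl
  by_cases hgpq : g p = g q
  · have hf' : ∀ f, ProperOn G (insert p (insert q C)) f → f p ≠ f q := fun f hf hpq =>
      glue f g hf hg (iff_of_true hpq hgpq)
    have hg' : ∀ g, ProperOn G (insert p (insert q D)) g → g p = g q := by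
      intro g hg
      by_contra hpq
      exact glue f g hf hg (iff_of_false (hf' f hf) hpq)
    refine ⟨_, C, p, q, isTwoCut_of_colorings ⟨c, hc⟩ ⟨d, hdD⟩ hCD hCs hDs hpC hqC hpD hqD ?_ hnoadj
      hne hadj ⟨g, hg⟩ hg' hf'⟩
    intro v hv
    rw [hD]
    tauto
  · have hf' : ∀ f, ProperOn G (insert p (insert q C)) f → f p = f q := by
      intro f hf
      by_contra hpq
      exact glue f g hf hg (iff_of_false hpq hgpq)
    have hg' : ∀ g, ProperOn G (insert p (insert q D)) g → g p ≠ g q := fun g hg hpq =>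
      glue f g hf hg (iff_of_true (hf' f hf) hpq)
    refine ⟨_, D, p, q, isTwoCut_of_colorings ⟨d, hdD⟩ ⟨c, hc⟩ hCD.symm hDs hCs hpD hqD hpC hqC ?_
      (fun d hd c hc h => hnoadj c hc d hd h.symm) hne hadj ⟨f, hf⟩ hf' hg'⟩
    intro v hv
    rw [hD]
    tauto

/-! #### The two pieces of a separation -/

/-- The side `B` of a separation along `{p, q}`, with the edge `pq` added. -/
def addEdgeOn (G : SimpleGraph V) (B : Finset V) (p q : V) : SimpleGraph V :=
  restrictTo G B ⊔ SimpleGraph.edge p q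

lemma addEdgeOn_adj {V : Type} {G : SimpleGraph V} {B : Finset V} {p q a b : V} :
    (addEdgeOn G B p q).Adj a b ↔ (G.Adj a b ∧ a ∈ B ∧ b ∈ B) ∨
      ((a = p ∧ b = q ∨ a = q ∧ b = p) ∧ a ≠ b) := by
  rw [addEdgeOn, SimpleGraph.sup_adj, SimpleGraph.edge_adj]
  rfl

/-- The edges of `G` outside `B`, with `q` merged into `p`. -/
def mergeOutside (G : SimpleGraph V) (B : Finset V) {p q : V} (hp : p ∈ B) (hq : q ∈ B) :
    SimpleGraph V where
  Adj x y := ∃ a b, G.Adj a b ∧ ¬ (a ∈ B ∧ b ∈ B) ∧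
    (if a = q then p else a) = x ∧ (if b = q then p else b) = y
  symm := ⟨by
    rintro x y ⟨a, b, hab, hB, hx, hy⟩
    exact ⟨b, a, hab.symm, fun h => hB h.symm, hy, hx⟩⟩
  loopless := ⟨by
    rintro x ⟨a, b, hab, hB, hx, hy⟩
    have : (if a = q then p else a) = (if b = q then p else b) := hx.trans hy.symm
    split_ifs at this with h1 h2 h2
    · exact hab.ne (h1.trans h2.symm)
    · exact hB ⟨h1 ▸ hq, this ▸ hp⟩
    · exact hB ⟨this ▸ hp, h2 ▸ hq⟩
    · exact hab.ne this⟩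

namespace IsTwoCut

variable {G : SimpleGraph V} {B C : Finset V} {p q : V}

lemma left_notMem (h : IsTwoCut G B C p q) : p ∉ C :=
  Finset.disjoint_left.1 h.disj h.left_mem

lemma right_notMem (h : IsTwoCut G B C p q) : q ∉ C :=
  Finset.disjoint_left.1 h.disj h.right_mem

lemma supportOf_eq (h : IsTwoCut G B C p q) : supportOf G = B ∪ C := by
  ext v; simp [h.mem_support]

lemma edgeCritical_addEdgeOn (h : IsTwoCut G B C p q) (hG : EdgeCritical G) :
    EdgeCritical (addEdgeOn G B p q) := by
  refine ⟨?_, fun H hH hne => ?_⟩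
  · rintro ⟨f, hf⟩
    refine hf p q (addEdgeOn_adj.2 (Or.inr ⟨Or.inl ⟨rfl, rfl⟩, h.ne⟩)) (h.color_eq f ?_)
    exact fun a ha b hb hab => hf a b (addEdgeOn_adj.2 (Or.inl ⟨hab, ha, hb⟩))
  · obtain ⟨a, b, hab, hn⟩ : ∃ a b, (addEdgeOn G B p q).Adj a b ∧ ¬ H.Adj a b := by
      by_contra! hc
      exact hne (le_antisymm hH fun a b => hc a b)
    rcases addEdgeOn_adj.1 hab with hab' | hab'
    · obtain ⟨f, hf⟩ := hG.threeCol_of_not_adj (H := G.deleteEdges {s(a, b)})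
        (SimpleGraph.deleteEdges_le _) hab'.1 (by simp)
      have hpq : f p ≠ f q := by
        refine h.color_ne f fun x hx y hy hxy => hf x y ?_
        rw [SimpleGraph.deleteEdges_adj]
        refine ⟨hxy, fun he => ?_⟩
        have hx' : x ∈ B := by
          rcases Sym2.eq_iff.1 (Set.mem_singleton_iff.1 he) with e | e
          exacts [e.1 ▸ hab'.2.1, e.1 ▸ hab'.2.2]
        have hy' : y ∈ B := by
          rcases Sym2.eq_iff.1 (Set.mem_singleton_iff.1 he) with e | e
          exacts [e.2 ▸ hab'.2.2, e.2 ▸ hab'.2.1]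
        have hx2 := Finset.disjoint_left.1 h.disj hx'
        have hy2 := Finset.disjoint_left.1 h.disj hy'
        simp only [Finset.mem_insert, hx2, hy2, or_false] at hx hy
        rcases hx with rfl | rfl <;> rcases hy with rfl | rfl
        exacts [hxy.ne rfl, h.not_adj hxy, h.not_adj hxy.symm, hxy.ne rfl]
      refine ⟨f, fun x y hxy => ?_⟩
      rcases addEdgeOn_adj.1 (hH hxy) with h1 | ⟨⟨rfl, rfl⟩ | ⟨rfl, rfl⟩, _⟩
      · refine hf x y ?_
        rw [SimpleGraph.deleteEdges_adj]
        refine ⟨h1.1, fun he => hn ?_⟩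
        rcases Sym2.eq_iff.1 (Set.mem_singleton_iff.1 he) with ⟨rfl, rfl⟩ | ⟨rfl, rfl⟩
        exacts [hxy, hxy.symm]
      · exact hpq
      · exact hpq.symm
    · obtain ⟨c, hc⟩ := h.exists_right
      obtain ⟨f, hf⟩ := hG.exists_properOn (S := B) ((h.mem_support c).2 (Or.inr hc))
        (Finset.disjoint_right.1 h.disj hc)
      refine ⟨f, fun x y hxy => ?_⟩
      rcases addEdgeOn_adj.1 (hH hxy) with h1 | ⟨h1, _⟩
      · exact hf x h1.2.1 y h1.2.2 h1.1
      · exfalso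
        rcases hab' with ⟨⟨rfl, rfl⟩ | ⟨rfl, rfl⟩, _⟩ <;> rcases h1 with ⟨rfl, rfl⟩ | ⟨rfl, rfl⟩
        exacts [hn hxy, hn hxy.symm, hn hxy.symm, hn hxy]

lemma supportOf_addEdgeOn (h : IsTwoCut G B C p q) : supportOf (addEdgeOn G B p q) = B := by
  ext v
  rw [mem_supportOf]
  constructor
  · rintro ⟨w, hw⟩
    rcases addEdgeOn_adj.1 hw with h1 | ⟨⟨rfl, rfl⟩ | ⟨rfl, rfl⟩, _⟩
    exacts [h1.2.1, h.left_mem, h.right_mem]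
  · intro hv
    by_cases hvp : v = p
    · exact ⟨q, addEdgeOn_adj.2 (Or.inr ⟨Or.inl ⟨hvp, rfl⟩, hvp ▸ h.ne⟩)⟩
    by_cases hvq : v = q
    · exact ⟨p, addEdgeOn_adj.2 (Or.inr ⟨Or.inr ⟨hvq, rfl⟩, hvq ▸ h.ne.symm⟩)⟩
    obtain ⟨w, hw⟩ := mem_supportOf.1 ((h.mem_support v).2 (Or.inl hv))
    refine ⟨w, addEdgeOn_adj.2 (Or.inl ⟨hw, hv, ?_⟩)⟩
    refine ((h.mem_support w).1 (right_mem_supportOf hw)).resolve_right fun hwC => ?_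
    exact (h.sep v hv w hwC hw).elim hvp hvq

lemma edgeCritical_mergeOutside (h : IsTwoCut G B C p q) (hG : EdgeCritical G) :
    EdgeCritical (mergeOutside G B h.left_mem h.right_mem) := by
  refine ⟨?_, fun H hH hne => ?_⟩
  · rintro ⟨f, hf⟩
    refine h.color_ne (fun v => f (if v = q then p else v)) (fun a ha b hb hab => ?_)
      (by simp)
    refine hf _ _ ⟨a, b, hab, fun hB => ?_, rfl, rfl⟩
    have ha2 := Finset.disjoint_left.1 h.disj hB.1
    have hb2 := Finset.disjoint_left.1 h.disj hB.2
    simp only [Finset.mem_insert, ha2, hb2, or_false] at ha hb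
    rcases ha with rfl | rfl <;> rcases hb with rfl | rfl
    exacts [hab.ne rfl, h.not_adj hab, h.not_adj hab.symm, hab.ne rfl]
  · obtain ⟨x, y, hxy, hn⟩ : ∃ a b, (mergeOutside G B h.left_mem h.right_mem).Adj a b ∧
        ¬ H.Adj a b := by
      by_contra! hc
      exact hne (le_antisymm hH fun a b => hc a b)
    obtain ⟨a, b, hab, hB, rfl, rfl⟩ := hxy
    let K : SimpleGraph V :=
      { Adj := fun x y => G.Adj x y ∧ ((x ∈ B ∧ y ∈ B) ∨
          H.Adj (if x = q then p else x) (if y = q then p else y))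
        symm := ⟨fun x y h => ⟨h.1.symm, h.2.imp And.symm fun h => h.symm⟩⟩
        loopless := ⟨fun x h => h.1.ne rfl⟩ }
    obtain ⟨f, hf⟩ := hG.threeCol_of_not_adj (H := K) (fun _ _ h => h.1) hab
      fun h => h.2.elim hB hn
    have hpq : f p = f q := h.color_eq f fun a ha b hb hab => hf a b ⟨hab, Or.inl ⟨ha, hb⟩⟩
    have hf' : ∀ v, f (if v = q then p else v) = f v := by
      intro v
      split_ifs with hv
      · rw [hv, hpq]
      · rfl
    refine ⟨f, fun x y hxy => ?_⟩
    obtain ⟨a, b, hab, hB, rfl, rfl⟩ := hH hxy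
    rw [hf', hf']
    exact hf a b ⟨hab, Or.inr hxy⟩

lemma not_common_nbr (h : IsTwoCut G B C p q) (hG : EdgeCritical G) {c : V} (hc : c ∈ C)
    (hpc : G.Adj p c) : ¬ G.Adj q c := by
  intro hqc
  obtain ⟨f, hf⟩ := hG.threeCol_of_not_adj (H := G.deleteEdges {s(p, c)})
    (SimpleGraph.deleteEdges_le _) hpc (by simp)
  have hcB := Finset.disjoint_right.1 h.disj hc
  have hpq : f p = f q := by
    refine h.color_eq f fun a ha b hb hab => hf a b ?_
    rw [SimpleGraph.deleteEdges_adj]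
    refine ⟨hab, fun he => ?_⟩
    rcases Sym2.eq_iff.1 (Set.mem_singleton_iff.1 he) with ⟨rfl, rfl⟩ | ⟨rfl, rfl⟩
    exacts [hcB hb, hcB ha]
  have hcol : f p ≠ f c := by
    rw [hpq]
    refine hf q c ?_
    rw [SimpleGraph.deleteEdges_adj]
    refine ⟨hqc, fun he => ?_⟩
    rcases Sym2.eq_iff.1 (Set.mem_singleton_iff.1 he) with e | e
    exacts [h.ne e.1.symm, hqc.ne e.1]
  refine hG.1 ⟨f, fun a b hab => ?_⟩
  by_cases he : s(a, b) = s(p, c)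
  · rcases Sym2.eq_iff.1 he with ⟨rfl, rfl⟩ | ⟨rfl, rfl⟩
    exacts [hcol, hcol.symm]
  · exact hf a b (by rw [SimpleGraph.deleteEdges_adj]; exact ⟨hab, he⟩)

lemma mergeOutside_adj_right (h : IsTwoCut G B C p q) {a b : V} (ha : a ∈ C) (hb : b ∈ C) :
    (mergeOutside G B h.left_mem h.right_mem).Adj a b ↔ G.Adj a b := by
  have haq : a ≠ q := by rintro rfl; exact h.right_notMem ha
  have hbq : b ≠ q := by rintro rfl; exact h.right_notMem hb
  constructor
  · rintro ⟨x, y, hxy, hB, hx, hy⟩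
    split_ifs at hx hy with h1 h2 h2
    · exact absurd (hx ▸ ha) h.left_notMem
    · exact absurd (hx ▸ ha) h.left_notMem
    · exact absurd (hy ▸ hb) h.left_notMem
    · exact hx ▸ hy ▸ hxy
  · intro hab
    exact ⟨a, b, hab, fun hB => Finset.disjoint_left.1 h.disj hB.1 ha, by simp [haq], by simp [hbq]⟩

lemma mergeOutside_adj_left (h : IsTwoCut G B C p q) {b : V} (hb : b ∈ C) :
    (mergeOutside G B h.left_mem h.right_mem).Adj p b ↔ G.Adj p b ∨ G.Adj q b := by
  have hbq : b ≠ q := by rintro rfl; exact h.right_notMem hb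
  have hbB := Finset.disjoint_right.1 h.disj hb
  constructor
  · rintro ⟨x, y, hxy, hB, hx, hy⟩
    split_ifs at hx hy with h1 h2 h2
    · exact absurd (hy ▸ hb) h.left_notMem
    · exact Or.inr (h1 ▸ hy ▸ hxy)
    · exact absurd (hy ▸ hb) h.left_notMem
    · exact Or.inl (hx ▸ hy ▸ hxy)
  · rintro (hpb | hqb)
    · exact ⟨p, b, hpb, fun hB => hbB hB.2, by simp, by simp [hbq]⟩
    · exact ⟨q, b, hqb, fun hB => hbB hB.2, by simp, by simp [hbq]⟩

lemma supportOf_mergeOutside (h : IsTwoCut G B C p q) (hG : EdgeCritical G) :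
    supportOf (mergeOutside G B h.left_mem h.right_mem) = insert p C := by
  ext v
  rw [mem_supportOf, Finset.mem_insert]
  constructor
  · rintro ⟨w, x, y, hxy, hB, rfl, hy⟩
    split_ifs with h1
    · exact Or.inl rfl
    · rcases (h.mem_support x).1 (left_mem_supportOf hxy) with hx | hx
      · have hyC := ((h.mem_support y).1 (right_mem_supportOf hxy)).resolve_left fun h => hB ⟨hx, h⟩
        exact Or.inl ((h.sep x hx y hyC hxy).resolve_right h1)
      · exact Or.inr hx
  · rintro (rfl | hv)
    · by_contra hc
      obtain ⟨b, hb, hbp, hbq⟩ := h.exists_left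
      obtain ⟨f, hf⟩ := hG.exists_properOn (S := insert v (insert q C))
        ((h.mem_support b).2 (Or.inl hb))
        (by simp [hbp, hbq, Finset.disjoint_left.1 h.disj hb])
      refine h.color_ne _ (hf.update_of_isolated (v := v) ?_ (f q)) ?_
      · intro w hw hvw
        simp only [Finset.mem_insert] at hw
        rcases hw with rfl | rfl | hw
        · exact hvw.ne rfl
        · exact h.not_adj hvw
        · exact hc ⟨w, (h.mergeOutside_adj_left hw).2 (Or.inl hvw)⟩
      · rw [Function.update_self, Function.update_of_ne h.ne.symm]
    · obtain ⟨w, hw⟩ := mem_supportOf.1 ((h.mem_support v).2 (Or.inr hv))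
      have hvq : v ≠ q := by rintro rfl; exact h.right_notMem hv
      exact ⟨_, v, w, hw, fun hB => Finset.disjoint_left.1 h.disj hB.1 hv, by simp [hvq], rfl⟩

lemma potential_addEdgeOn (h : IsTwoCut G B C p q) :
    potential (addEdgeOn G B p q) B = potential G B - 6 := by
  apply le_antisymm
  · have := pairCount_add_two_le (G := G) (H := addEdgeOn G B p q) h.left_mem h.right_mem
      (addEdgeOn_adj.2 (Or.inr ⟨Or.inl ⟨rfl, rfl⟩, h.ne⟩)) h.not_adj
      fun a ha b hb hab => addEdgeOn_adj.2 (Or.inl ⟨hab, ha, hb⟩)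
    unfold potential
    linarith
  · have := potential_le_add_edge (G := G) (H := addEdgeOn G B p q) (S := B) (u := p) (v := q)
      fun a _ b _ hab => (addEdgeOn_adj.1 hab).imp And.left And.left
    linarith

lemma potential_eq (h : IsTwoCut G B C p q) (hG : EdgeCritical G) :
    potential G (supportOf G) = potential (addEdgeOn G B p q) B +
      potential (mergeOutside G B h.left_mem h.right_mem) (insert p C) - 4 := by
  have h1 : potential (mergeOutside G B h.left_mem h.right_mem) C = potential G C := by
    unfold potential
    rw [pairCount_congr fun a ha b hb => h.mergeOutside_adj_right ha hb]
  have h2 : (C.filter ((mergeOutside G B h.left_mem h.right_mem).Adj p)).card =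
      (C.filter (G.Adj p)).card + (C.filter (G.Adj q)).card := by
    rw [← Finset.card_union_of_disjoint]
    · congr 1
      ext c
      simp only [Finset.mem_filter, Finset.mem_union]
      constructor
      · rintro ⟨hc, hpc⟩
        exact ((h.mergeOutside_adj_left hc).1 hpc).imp (⟨hc, ·⟩) (⟨hc, ·⟩)
      · rintro (⟨hc, hpc⟩ | ⟨hc, hpc⟩)
        exacts [⟨hc, (h.mergeOutside_adj_left hc).2 (Or.inl hpc)⟩,
          ⟨hc, (h.mergeOutside_adj_left hc).2 (Or.inr hpc)⟩]
    · rw [Finset.disjoint_left]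
      intro c hc hc'
      simp only [Finset.mem_filter] at hc hc'
      exact h.not_common_nbr hG hc.1 hc.2 hc'.2
  have h3 : pairCount G B C = ((C.filter (G.Adj p)).card : ℤ) + (C.filter (G.Adj q)).card := by
    rw [← pairCount_singleton_left, ← pairCount_singleton_left,
      ← pairCount_union_left _ _ (by simpa using h.ne), pairCount, pairCount]
    symm
    apply Finset.sum_subset
    · intro a ha
      simp only [Finset.mem_union, Finset.mem_singleton] at ha
      rcases ha with rfl | rfl
      exacts [h.left_mem, h.right_mem]
    · intro a ha ha2
      apply Finset.sum_eq_zero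
      intro c hc
      rw [if_neg]
      intro hac
      exact ha2 (by simpa using h.sep a ha c hc hac)
  rw [h.supportOf_eq, potential_union _ h.disj, potential_insert _ h.left_notMem, h1, h2,
    h.potential_addEdgeOn, h3]
  push_cast
  ring

lemma card_left_lt (h : IsTwoCut G B C p q) : B.card < (supportOf G).card := by
  obtain ⟨c, hc⟩ := h.exists_right
  rw [h.supportOf_eq, Finset.card_union_of_disjoint h.disj]
  have := Finset.card_pos.2 ⟨c, hc⟩
  omega

lemma card_right_lt (h : IsTwoCut G B C p q) : (insert p C).card < (supportOf G).card := by
  rw [h.supportOf_eq, Finset.card_union_of_disjoint h.disj, Finset.card_insert_of_notMem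
    h.left_notMem]
  have : 1 < B.card := Finset.one_lt_card.2 ⟨p, h.left_mem, q, h.right_mem, h.ne⟩
  omega

lemma isTightSplit (h : IsTwoCut G B C p q) (hG : EdgeCritical G)
    (h1 : potential (addEdgeOn G B p q) B ≤ 4) : IsTightSplit G B C p q where
  mem_support := h.mem_support
  disj := h.disj
  left_mem := h.left_mem
  right_mem := h.right_mem
  ne := h.ne
  not_adj := h.not_adj
  three_le_card := by
    have := four_le_card_supportOf (h.edgeCritical_mergeOutside hG).1
    rw [h.supportOf_mergeOutside hG, Finset.card_insert_of_notMem h.left_notMem] at this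
    omega
  potential_le := by
    rw [h.potential_addEdgeOn] at h1
    linarith
  sep := h.sep
  color_ne := h.color_ne

end IsTwoCut

end TwoCuts

section MinimalBad

open scoped Classical

variable {V : Type}

/-! ### A minimal graph of large potential -/

/-- A `4`-critical graph of potential at least that of `K₄`, other than `K₄` and without
separations of order two, such that all smaller `4`-critical graphs are understood. -/
structure IsMinimalBad [Fintype V] (G : SimpleGraph V) : Prop where
  critical : EdgeCritical G
  four_le : 4 ≤ potential G (supportOf G)
  card_ne : (supportOf G).card ≠ 4
  noTwoCut : NoTwoCut G
  smaller : ∀ (W : Type) [Fintype W] (H : SimpleGraph W), EdgeCritical H →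
    (supportOf H).card < (supportOf G).card → potential H (supportOf H) ≤ 4 ∧
      (4 ≤ potential H (supportOf H) →
        (supportOf H).card = 4 ∨ ∃ B C p q, IsTightSplit H B C p q)

lemma ten_le_potential_triangle (W : SimpleGraph (V ⊕ Fin 3)) {X : Finset (Fin 3)}
    (hX : X.Nonempty) : 10 ≤ potential W ((∅ : Finset V).disjSum X) ∧
      (2 ≤ X.card → 12 ≤ potential W ((∅ : Finset V).disjSum X)) := by
  have h := potential_triangle_ge W X
  have h1 : 1 ≤ X.card := hX.card_pos
  have h2 : X.card ≤ 3 := by simpa using X.card_le_univ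
  generalize X.card = n at *
  interval_cases n <;> simp at h ⊢ <;> omega

lemma ten_le_potential_of_card_le_three (G : SimpleGraph V) {R : Finset V} (h1 : 2 ≤ R.card)
    (h2 : R.card ≤ 3) : 12 ≤ potential G R := by
  have h := potential_ge G R
  generalize R.card = n at *
  interval_cases n <;> simp at h ⊢ <;> omega

variable [Fintype V]

namespace IsMinimalBad

variable {G : SimpleGraph V}

lemma four_lt_card (h : IsMinimalBad G) : 4 < (supportOf G).card :=
  lt_of_le_of_ne (four_le_card_supportOf h.critical.1) h.card_ne.symm

lemma exists_properOn (h : IsMinimalBad G) {R : Finset V} (hR : R ⊂ supportOf G) :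
    ∃ f, ProperOn G R f := by
  obtain ⟨v, hv, hvR⟩ := Finset.exists_of_ssubset hR
  exact h.critical.exists_properOn hv hvR

lemma exists_collapse (h : IsMinimalBad G) {R : Finset V} (hR : R ⊂ supportOf G)
    (h4 : 4 ≤ R.card) {f : V → Fin 3} (hf : ProperOn G R f) :
    ∃ (W : SimpleGraph (V ⊕ Fin 3)) (B : Finset V) (X : Finset (Fin 3)),
      W ≤ collapse G R f ∧ EdgeCritical W ∧ supportOf W = B.disjSum X ∧ B ⊆ supportOf G ∧
        Disjoint B R ∧ B.Nonempty ∧ X.Nonempty ∧ potential W (B.disjSum X) ≤ 4 ∧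
        (4 ≤ potential W (B.disjSum X) →
          (B.disjSum X).card = 4 ∨ ∃ B C p q, IsTightSplit W B C p q) := by
  obtain ⟨W, B, X, hW, hWc, hs, hB, hBR, hBne, hX⟩ :=
    exists_edgeCritical_collapse fun hc => h.critical.1
      (let ⟨g, hg⟩ := exists_coloring_of_collapse hf hc; ⟨g, hg.1⟩)
  obtain ⟨r, hr⟩ := Finset.card_pos.1 (by omega : 0 < R.card)
  have hX' := hX (h.critical.exists_properOn (hR.1 hr) (Finset.disjoint_right.1 hBR hr))
  have hcard : (supportOf W).card < (supportOf G).card := by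
    have h1 : B.card + R.card ≤ (supportOf G).card := by
      rw [← Finset.card_union_of_disjoint hBR]
      exact Finset.card_le_card (Finset.union_subset hB hR.1)
    have h2 : X.card ≤ 3 := by simpa using X.card_le_univ
    rw [hs, Finset.card_disjSum]
    omega
  have := h.smaller _ W hWc hcard
  rw [hs] at this
  exact ⟨W, B, X, hW, hWc, hs, hB, hBR, hBne, hX', this⟩

lemma ten_le_potential (h : IsMinimalBad G) {R : Finset V} (hR : R ⊂ supportOf G)
    (h2 : 2 ≤ R.card) : 10 ≤ potential G R := by
  by_contra! hlt
  induction hk : (supportOf G).card - R.card using Nat.strong_induction_on generalizing R with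
  | _ k ih =>
  have h4 : 4 ≤ R.card := by
    by_contra! h3
    linarith [ten_le_potential_of_card_le_three G h2 (by omega)]
  obtain ⟨f, hf⟩ := h.exists_properOn hR
  obtain ⟨W, B, X, hW, -, -, hB, hBR, hBne, hX, hpot, -⟩ := h.exists_collapse hR h4 hf
  have h1 := potential_collapse hW hBR X
  have h3 := (ten_le_potential_triangle W hX).1
  by_cases he : B ∪ R = supportOf G
  · have := h.four_le
    rw [← he] at this
    linarith
  · have hss : B ∪ R ⊂ supportOf G :=
      lt_of_le_of_ne (Finset.union_subset hB hR.1) he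
    have hc : (B ∪ R).card = B.card + R.card := Finset.card_union_of_disjoint hBR
    have := hBne.card_pos
    have := Finset.card_lt_card hss
    exact ih _ (by omega) hss (by omega) (by linarith) rfl

lemma eq_of_boundary (h : IsMinimalBad G) {R : Finset V} (hR : R ⊂ supportOf G)
    (h4 : 4 ≤ R.card) (hpot : potential G R ≤ 10) {f : V → Fin 3} (hf : ProperOn G R f)
    {r s a b : V} (hr : r ∈ R) (hs : s ∈ R) (ha : a ∉ R) (hb : b ∉ R) (hra : G.Adj r a)
    (hsb : G.Adj s b) : f r = f s := by
  obtain ⟨W, B, X, hW, -, -, hB, hBR, hBne, hX, hpotW, -⟩ := h.exists_collapse hR h4 hf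
  have h1 := potential_collapse hW hBR X
  have h3 := ten_le_potential_triangle W hX
  have he : B ∪ R = supportOf G := by
    by_contra he
    have := h.ten_le_potential (lt_of_le_of_ne (Finset.union_subset hB hR.1) he)
      ((by omega : 2 ≤ R.card).trans (Finset.card_le_card Finset.subset_union_right))
    linarith
  have h5 := h.four_le
  rw [← he] at h5
  have hX1 : X.card ≤ 1 := by
    by_contra! hc
    linarith [h3.2 hc]
  have key : ∀ r a, r ∈ R → a ∉ R → G.Adj r a → f r ∈ X := by
    intro r a hr ha hra
    by_contra hn
    have haB : a ∈ B := by
      have := right_mem_supportOf hra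
      rw [← he, Finset.mem_union] at this
      tauto
    linarith [potential_collapse_of_missed hW hBR haB hr hra.symm hn]
  exact Finset.card_le_one.1 hX1 _ (key r a hr ha hra) _ (key s b hs hb hsb)

lemma exists_boundary (h : IsMinimalBad G) {R : Finset V} (hR : R ⊂ supportOf G) {u v x : V}
    (hu : u ∈ R) (hv : v ∈ R) (hx : x ∈ R) (hxu : x ≠ u) (hxv : x ≠ v) :
    ∃ s ∈ R, s ≠ u ∧ s ≠ v ∧ ∃ a ∉ R, G.Adj s a := by
  by_contra! hc
  obtain ⟨d, hd, hdR⟩ := Finset.exists_of_ssubset hR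
  have := h.noTwoCut ((R.erase u).erase v) u v ⟨x, by simp [*]⟩
    (((Finset.erase_subset _ _).trans (Finset.erase_subset _ _)).trans hR.1) (by simp) (by simp)
    (fun c hc' e he hce => by
      simp only [Finset.mem_erase] at hc' he
      by_contra! hne
      exact hc c hc'.2.2 hc'.2.1 hc'.1 e (fun heR => he ⟨hne.2, hne.1, heR⟩) hce) d hd
  simp only [Finset.mem_erase] at this
  rcases this with h1 | rfl | rfl
  exacts [hdR h1.2.2, hdR hu, hdR hv]

lemma exists_two_boundary (h : IsMinimalBad G) {R : Finset V} (hR : R ⊂ supportOf G)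
    (h2 : 2 ≤ R.card) :
    ∃ u ∈ R, ∃ v ∈ R, u ≠ v ∧ (∃ a ∉ R, G.Adj u a) ∧ ∃ b ∉ R, G.Adj v b := by
  obtain ⟨x, hx, y, hy, hxy⟩ := Finset.one_lt_card.1 h2
  obtain ⟨u, hu, -, -, hua⟩ := h.exists_boundary hR hx hx hy hxy.symm hxy.symm
  obtain ⟨z, hz, hzu⟩ : ∃ z ∈ R, z ≠ u := by
    by_cases hxu : x = u
    · exact ⟨y, hy, hxu ▸ hxy.symm⟩
    · exact ⟨x, hx, hxu⟩
  obtain ⟨v, hv, hvu, -, hvb⟩ := h.exists_boundary hR hu hu hz hzu hzu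
  exact ⟨u, hu, v, hv, hvu.symm, hua, hvb⟩

lemma exists_addEdgeOn (h : IsMinimalBad G) {S : Finset V} (hS : S ⊂ supportOf G) {u v : V}
    (hu : u ∈ S) (hv : v ∈ S) (huv : u ≠ v) (hcol : ∀ f, ProperOn G S f → f u = f v) :
    ∃ W ≤ addEdgeOn G S u v, EdgeCritical W ∧ W.Adj u v ∧ supportOf W ⊆ S ∧
      potential W (supportOf W) ≤ 4 ∧
      (4 ≤ potential W (supportOf W) →
        (supportOf W).card = 4 ∨ ∃ B C p q, IsTightSplit W B C p q) ∧
      potential G (supportOf W) ≤ 10 := by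
  obtain ⟨W, hW, hWc⟩ := exists_edgeCritical_le (G := addEdgeOn G S u v) (by
    rintro ⟨f, hf⟩
    exact hf u v (addEdgeOn_adj.2 (Or.inr ⟨Or.inl ⟨rfl, rfl⟩, huv⟩)) (hcol f
      fun a ha b hb hab => hf a b (addEdgeOn_adj.2 (Or.inl ⟨hab, ha, hb⟩))))
  have hadj : W.Adj u v := by
    by_contra hn
    obtain ⟨f, hf⟩ := h.exists_properOn hS
    refine hWc.1 ⟨f, fun a b hab => ?_⟩
    rcases addEdgeOn_adj.1 (hW hab) with h1 | ⟨⟨rfl, rfl⟩ | ⟨rfl, rfl⟩, -⟩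
    exacts [hf a h1.2.1 b h1.2.2 h1.1, absurd hab hn, absurd hab.symm hn]
  have hsub : supportOf W ⊆ S := by
    intro a ha
    obtain ⟨b, hab⟩ := mem_supportOf.1 ha
    rcases addEdgeOn_adj.1 (hW hab) with h1 | ⟨⟨rfl, rfl⟩ | ⟨rfl, rfl⟩, -⟩
    exacts [h1.2.1, hu, hv]
  have hlt : (supportOf W).card < (supportOf G).card :=
    (Finset.card_le_card hsub).trans_lt (Finset.card_lt_card hS)
  have h1 := h.smaller _ W hWc hlt
  refine ⟨W, hW, hWc, hadj, hsub, h1.1, h1.2, ?_⟩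
  have := potential_le_add_edge (G := G) (H := W) (S := supportOf W) (u := u) (v := v)
    fun a _ b _ hab => by
      rcases addEdgeOn_adj.1 (hW hab) with h1 | h1
      exacts [Or.inl h1.1, Or.inr h1.1]
  linarith [h1.1]

end IsMinimalBad

end MinimalBad

section NoTightSet

open scoped Classical

variable {V : Type} [Fintype V]

namespace IsMinimalBad

variable {G : SimpleGraph V}

private lemma false_of_rainbow (h : IsMinimalBad G) {R B C T : Finset V} (hR : R ⊂ supportOf G)
    {p q u w : V} (hBR : B ⊆ R) (hCR : C ⊆ R) (hBC : Disjoint B C) (hp : p ∈ B) (hq : q ∈ B)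
    (hpq : p ≠ q) (hu : u ∈ B) (hup : u ≠ p) (huq : u ≠ q)
    (hw : w ∈ C) (hT : T = insert p (insert q C)) (hadj : ¬ G.Adj p q) (hpotB : potential G B ≤ 16)
    (hcol : ∀ g, ProperOn G T g → g p ≠ g q ∧ g w ≠ g p ∧ g w ≠ g q) : False := by
  have hpC := Finset.disjoint_left.1 hBC hp
  have hqC := Finset.disjoint_left.1 hBC hq
  have huC := Finset.disjoint_left.1 hBC hu
  have huT : u ∉ T := by simp [*]
  have hTR : T ⊆ R := by
    rw [hT]
    simp only [Finset.insert_subset_iff]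
    exact ⟨hBR hp, hBR hq, hCR⟩
  have hwp : w ≠ p := by rintro rfl; exact hpC hw
  have hwq : w ≠ q := by rintro rfl; exact hqC hw
  let K := restrictTo G T ⊔ SimpleGraph.edge u p ⊔ SimpleGraph.edge u q ⊔ SimpleGraph.edge u w
  have hK : ∀ a b, K.Adj a b → (G.Adj a b ∧ a ∈ T ∧ b ∈ T) ∨
      (a = u ∧ (b = p ∨ b = q ∨ b = w)) ∨ (b = u ∧ (a = p ∨ a = q ∨ a = w)) := by
    intro a b hab
    simp only [K, SimpleGraph.sup_adj, SimpleGraph.edge_adj] at hab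
    rcases hab with ((hab | hab) | hab) | hab
    · exact Or.inl hab
    all_goals tauto
  obtain ⟨W, hW, hWc⟩ := exists_edgeCritical_le (G := K) (by
    rintro ⟨f, hf⟩
    have h1 := hcol f fun a ha b hb hab => hf a b (by
      simp only [K, SimpleGraph.sup_adj]; exact Or.inl (Or.inl (Or.inl ⟨hab, ha, hb⟩)))
    have h2 := hf u p (by simp [K, SimpleGraph.edge_adj, hup])
    have h3 := hf u q (by simp [K, SimpleGraph.edge_adj, huq])
    have h4 := hf u w (by
      have : u ≠ w := by rintro rfl; exact huC hw
      simp [K, SimpleGraph.edge_adj, this])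
    obtain ⟨h5, h6, h7⟩ := h1
    generalize f u = a at *
    generalize f p = b at *
    generalize f q = c at *
    generalize f w = d at *
    clear hf hcol
    revert h2 h3 h4 h5 h6 h7
    clear * -
    decide +revert)
  have huW : u ∈ supportOf W := by
    by_contra hn
    obtain ⟨f, hf⟩ := h.exists_properOn (lt_of_le_of_lt hTR hR)
    refine hWc.1 ⟨f, fun a b hab => ?_⟩
    rcases hK a b (hW hab) with h1 | ⟨rfl, -⟩ | ⟨rfl, -⟩
    exacts [hf a h1.2.1 b h1.2.2 h1.1, absurd (left_mem_supportOf hab) hn,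
      absurd (right_mem_supportOf hab) hn]
  have hnb : nbrs W u ⊆ {p, q, w} := by
    intro b hb
    rcases hK u b (hW (mem_nbrs.1 hb)) with h1 | h1 | h1
    · exact absurd h1.2.1 huT
    · simpa using h1.2
    · exact absurd ((mem_nbrs.1 hb).ne h1.1.symm) (by simp)
  have hnb' : nbrs W u = {p, q, w} :=
    Finset.eq_of_subset_of_card_le hnb ((Finset.card_le_three).trans (hWc.three_le_card_nbrs huW))
  have hsub : supportOf W ⊆ insert u T := by
    intro a ha
    obtain ⟨b, hab⟩ := mem_supportOf.1 ha
    rcases hK a b (hW hab) with h1 | ⟨rfl, -⟩ | ⟨-, rfl | rfl | rfl⟩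
    · exact Finset.mem_insert_of_mem h1.2.1
    all_goals simp [hT, hw]
  have hlt : (supportOf W).card < (supportOf G).card :=
    (Finset.card_le_card (hsub.trans (Finset.insert_subset (hBR hu) hTR))).trans_lt
      (Finset.card_lt_card hR)
  have hpot := (h.smaller _ W hWc hlt).1
  set A := (supportOf W).erase u with hA
  have hAT : A ⊆ T := by
    intro a ha
    rw [hA, Finset.mem_erase] at ha
    exact (Finset.mem_insert.1 (hsub ha.2)).resolve_left ha.1
  have hpA : p ∈ A := Finset.mem_erase.2 ⟨hup.symm,
    right_mem_supportOf (mem_nbrs.1 (by rw [hnb']; simp : p ∈ nbrs W u))⟩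
  have hqA : q ∈ A := Finset.mem_erase.2 ⟨huq.symm,
    right_mem_supportOf (mem_nbrs.1 (by rw [hnb']; simp : q ∈ nbrs W u))⟩
  have hpotA : potential G A ≤ 12 := by
    have h1 := potential_insert W (Finset.notMem_erase u (supportOf W))
    rw [Finset.insert_erase huW, ← hA] at h1
    have h2 : (A.filter (W.Adj u)).card ≤ 3 := by
      refine (Finset.card_le_card (t := nbrs W u) fun x hx => mem_nbrs.2
        (Finset.mem_filter.1 hx).2).trans ?_
      rw [hnb']
      exact Finset.card_le_three
    have h3 : potential G A ≤ potential W A := potential_anti fun a ha b hb hab => by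
      rcases hK a b (hW hab) with h1 | ⟨rfl, -⟩ | ⟨rfl, -⟩
      exacts [h1.1, absurd ha (by simp [hA]), absurd hb (by simp [hA])]
    have : ((A.filter (W.Adj u)).card : ℤ) ≤ 3 := by exact_mod_cast h2
    linarith
  set D := A \ {p, q} with hD
  have hDC : D ⊆ C := by
    intro x hx
    simp only [hD, Finset.mem_sdiff, Finset.mem_insert, Finset.mem_singleton, not_or] at hx
    have := hAT hx.1
    simp only [hT, Finset.mem_insert] at this
    tauto
  have hDB : Disjoint D B := (hBC.symm).mono_left hDC
  have hpqB : ({p, q} : Finset V) ⊆ B := by simp [Finset.insert_subset_iff, hp, hq]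
  have hpqA : ({p, q} : Finset V) ⊆ A := by simp [Finset.insert_subset_iff, hpA, hqA]
  have h1 := potential_union G hDB
  have h2 := potential_union G (Finset.sdiff_disjoint : Disjoint (A \ {p, q}) {p, q})
  rw [Finset.sdiff_union_of_subset hpqA, ← hD] at h2
  have h3 : pairCount G D {p, q} ≤ pairCount G D B :=
    pairCount_mono subset_rfl hpqB fun _ _ _ _ h => h
  have h4 : potential G {p, q} = 20 := by
    have h := potential_insert G (v := p) (A := {q}) (by simpa using hpq)
    rw [h]
    simp [Finset.filter_singleton, hadj, potential, pairCount]
  have h5 := h.ten_le_potential (R := D ∪ B)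
    (lt_of_le_of_lt (Finset.union_subset (hDC.trans hCR) hBR) hR)
    ((Finset.card_pair hpq).symm.le.trans
      (Finset.card_le_card (hpqB.trans Finset.subset_union_right)))
  linarith

lemma eleven_le_potential (h : IsMinimalBad G) {R : Finset V} (hR : R ⊂ supportOf G)
    (h2 : 2 ≤ R.card) : 11 ≤ potential G R := by
  induction hk : R.card using Nat.strong_induction_on generalizing R with
  | _ k ih =>
  by_contra! hlt
  have hmin : ∀ A ⊆ R, A.card < R.card → 2 ≤ A.card → 11 ≤ potential G A := fun A hA hc h2 =>
    ih _ (hk ▸ hc) (lt_of_le_of_lt hA hR) h2 rfl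
  clear ih hk
  have h4 : 4 ≤ R.card := by
    by_contra! h3
    linarith [ten_le_potential_of_card_le_three G h2 (by omega)]
  have hconst : ∀ f, ProperOn G R f → ∀ r ∈ R, ∀ s ∈ R, (∃ a ∉ R, G.Adj r a) →
      (∃ b ∉ R, G.Adj s b) → f r = f s := fun f hf r hr s hs ⟨a, ha, hra⟩ ⟨b, hb, hsb⟩ =>
    h.eq_of_boundary hR h4 (by omega) hf hr hs ha hb hra hsb
  obtain ⟨u, hu, v, hv, huv, hub, hvb⟩ := h.exists_two_boundary hR h2
  obtain ⟨W, hW, hWc, hWuv, hsub, hpot4, hsplit, hpotG⟩ := h.exists_addEdgeOn hR hu hv huv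
    fun f hf => hconst f hf u hu v hv hub hvb
  have hWR : supportOf W = R := by
    refine Finset.eq_of_subset_of_card_le hsub ?_
    by_contra! hc
    linarith [hmin _ hsub hc ((by omega : 2 ≤ 4).trans (four_le_card_supportOf hWc.1))]
  rw [hWR] at hpot4 hsplit hpotG
  have hGadj : ∀ a b, W.Adj a b → G.Adj a b ∨ (a = u ∧ b = v) ∨ (a = v ∧ b = u) := by
    intro a b hab
    rcases addEdgeOn_adj.1 (hW hab) with h1 | h1
    exacts [Or.inl h1.1, Or.inr h1.1]
  have hpotW : potential G R ≤ potential W R + 6 := potential_le_add_edge fun a _ b _ => hGadj a b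
  have hlow := h.ten_le_potential hR h2
  have hWadj : ∀ a ∈ R, ∀ b ∈ R, G.Adj a b → W.Adj a b := by
    intro a ha b hb hab
    by_contra hn
    let K := W.deleteEdges {s(u, v)}
    have hKG : ∀ a ∈ R, ∀ b ∈ R, K.Adj a b → G.Adj a b := by
      intro a _ b _ hab
      rw [SimpleGraph.deleteEdges_adj] at hab
      refine (hGadj a b hab.1).resolve_right fun he => hab.2 ?_
      simpa [Sym2.eq_iff] using he
    have hle := pairCount_add_two_le (G := K) (H := G) ha hb hab
      (fun hk => hn (SimpleGraph.deleteEdges_le _ hk)) hKG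
    have hKW : potential K R ≤ potential W R + 6 :=
      potential_le_add_edge (u := u) (v := v) fun a _ b _ hab => by
        by_cases he : (a = u ∧ b = v) ∨ (a = v ∧ b = u)
        · exact Or.inr he
        · refine Or.inl ((SimpleGraph.deleteEdges_adj).2 ⟨hab, fun hm => he ?_⟩)
          simpa [Sym2.eq_iff] using hm
    unfold potential at *
    linarith
  rcases hsplit (by linarith) with h4' | ⟨B, C, p, q, hs⟩
  · obtain ⟨x, hx, hxuv⟩ : ∃ x ∈ R, x ∉ ({u, v} : Finset V) :=
      Finset.exists_mem_notMem_of_card_lt_card (Finset.card_le_two.trans_lt (by omega))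
    simp only [Finset.mem_insert, Finset.mem_singleton, not_or] at hxuv
    obtain ⟨s, hsR, hsu, hsv, hsb⟩ := h.exists_boundary hR hu hv hx hxuv.1 hxuv.2
    have hus := EdgeCritical.adj_of_card_eq_four hWc.1 (hWR ▸ h4') (hWR ▸ hu) (hWR ▸ hsR) hsu.symm
    obtain ⟨f, hf⟩ := h.exists_properOn hR
    have hus' : G.Adj u s := (hGadj u s hus).resolve_right (by tauto)
    exact hf u hu s hsR hus' (hconst f hf u hu s hsR hub hsb)
  have hmem : ∀ x, x ∈ R ↔ x ∈ B ∨ x ∈ C := fun x => hWR ▸ hs.mem_support x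
  have hBR : B ⊆ R := fun x hx => (hmem x).2 (Or.inl hx)
  have hCR : C ⊆ R := fun x hx => (hmem x).2 (Or.inr hx)
  have hRcard : R.card = B.card + C.card := by
    rw [← Finset.card_union_of_disjoint hs.disj]
    congr 1
    ext x
    simp [hmem]
  have hC3 := hs.three_le_card
  have hpairB : ({p, q} : Finset V) ⊆ B := by
    simp [Finset.insert_subset_iff, hs.left_mem, hs.right_mem]
  have hB2 : 2 ≤ B.card := (Finset.card_pair hs.ne).symm.le.trans (Finset.card_le_card hpairB)
  have huvB : u ∈ B ∧ v ∈ B := by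
    by_contra hn
    have h1 := hmin B hBR (by omega) hB2
    have h2 : potential G B ≤ potential W B := potential_anti fun a ha b hb hab =>
      (hGadj a b hab).resolve_right (by rintro (⟨rfl, rfl⟩ | ⟨rfl, rfl⟩) <;> tauto)
    linarith [hs.potential_le]
  obtain ⟨huB, hvB⟩ := huvB
  have hCB := hs.disj
  have hpC := Finset.disjoint_left.1 hCB hs.left_mem
  have hqC := Finset.disjoint_left.1 hCB hs.right_mem
  have huC := Finset.disjoint_left.1 hCB huB
  have hsepG : ∀ c ∈ C, ∀ d ∈ R, d ∉ C → G.Adj c d → d = p ∨ d = q := fun c hc d hd hdC hcd =>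
    hs.sep d (((hmem d).1 hd).resolve_right hdC) c hc (hWadj _ (hCR hc) _ hd hcd).symm
  obtain ⟨w, hwC, hwb⟩ : ∃ w ∈ C, ∃ d ∉ R, G.Adj w d := by
    by_contra! hc
    obtain ⟨d, hd, hdR⟩ := Finset.exists_of_ssubset hR
    rcases h.noTwoCut C p q (Finset.card_pos.1 (by omega)) (hCR.trans hR.1) hpC hqC
      (fun c hc' d hd hcd => by
        by_cases hdR : d ∈ R
        · exact hsepG c hc' d hdR hd hcd
        · exact absurd hcd (hc c hc' d hdR)) d hd with h1 | rfl | rfl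
    exacts [hdR (hCR h1), hdR (hBR hs.left_mem), hdR (hBR hs.right_mem)]
  obtain ⟨T, hT⟩ : ∃ T, T = insert p (insert q C) := ⟨_, rfl⟩
  have hpT : p ∈ T := by simp [hT]
  have hqT : q ∈ T := by simp [hT]
  have hwT : w ∈ T := by simp [hT, hwC]
  have hTR : T ⊆ R := by
    rw [hT]
    simp only [Finset.insert_subset_iff]
    exact ⟨hBR hs.left_mem, hBR hs.right_mem, hCR⟩
  have huvT : ¬ (u ∈ T ∧ v ∈ T) := by
    have hvC := Finset.disjoint_left.1 hCB hvB
    simp only [hT, Finset.mem_insert, huC, hvC, or_false]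
    rintro ⟨rfl | rfl, rfl | rfl⟩
    exacts [huv rfl, hs.not_adj hWuv, hs.not_adj hWuv.symm, huv rfl]
  have hTlt : T.card < R.card := by
    refine Finset.card_lt_card (lt_of_le_of_ne hTR ?_)
    rintro rfl
    exact huvT ⟨hu, hv⟩
  have hcolT : ∀ g, ProperOn G T g → g p ≠ g q := fun g hg => hs.color_ne g (by
    rw [← hT]
    refine hg.mono subset_rfl fun a ha b hb hab => (hGadj a b hab).resolve_right ?_
    rintro (⟨rfl, rfl⟩ | ⟨rfl, rfl⟩) <;> tauto)
  have hTG : T ⊂ supportOf G := lt_of_le_of_lt hTR hR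
  obtain ⟨f, hf⟩ := h.exists_properOn hR
  have hfpq := hcolT f (hf.mono hTR fun _ _ _ _ h => h)
  have hglue : ∀ g, ProperOn G T g → ∃ σ : Equiv.Perm (Fin 3), σ (g p) = f p ∧ σ (g q) = f q ∧
      σ (g w) = f u := by
    intro g hg
    obtain ⟨σ, hσp, hσq⟩ := exists_perm_fin_three (g p) (g q) (f p) (f q)
      (iff_of_false (hcolT g hg) hfpq)
    refine ⟨σ, hσp, hσq, ?_⟩
    have hg' := hg.perm σ
    rw [hT] at hg'
    have hglued := ProperOn.glue hsepG hpC hqC hg'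
      (hf.mono Finset.sdiff_subset fun _ _ _ _ h => h) hσp hσq
    simpa [hwC, huC] using hconst _ hglued w (hCR hwC) u hu hwb hub
  have hsmall : ∀ x ∈ T, w ≠ x → ¬ ∀ g, ProperOn G T g → g w = g x := by
    intro x hx hwx hall
    obtain ⟨Y, -, hYc, -, hYs, -, -, hYpot⟩ := h.exists_addEdgeOn hTG hwT hx hwx hall
    linarith [hmin _ (hYs.trans hTR) ((Finset.card_le_card hYs).trans_lt hTlt)
      ((by omega : 2 ≤ 4).trans (four_le_card_supportOf hYc.1))]
  have hwp : w ≠ p := by rintro rfl; exact hpC hwC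
  have hwq : w ≠ q := by rintro rfl; exact hqC hwC
  have hup : f u ≠ f p := fun he => hsmall p hpT hwp fun g hg => by
    obtain ⟨σ, hσp, -, hσw⟩ := hglue g hg
    exact σ.injective (by rw [hσw, hσp, he])
  have huq : f u ≠ f q := fun he => hsmall q hqT hwq fun g hg => by
    obtain ⟨σ, -, hσq, hσw⟩ := hglue g hg
    exact σ.injective (by rw [hσw, hσq, he])
  refine h.false_of_rainbow hR hBR hCR hCB hs.left_mem hs.right_mem hs.ne huB
    (by rintro rfl; exact hup rfl) (by rintro rfl; exact huq rfl) hwC hT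
    (fun hpq => hs.not_adj (hWadj _ (hBR hs.left_mem) _ (hBR hs.right_mem) hpq)) ?_ ?_
  · have : potential G B ≤ potential W B + 6 := potential_le_add_edge fun a _ b _ => hGadj a b
    linarith [hs.potential_le]
  · intro g hg
    obtain ⟨σ, hσp, hσq, hσw⟩ := hglue g hg
    refine ⟨hcolT g hg, fun he => hup ?_, fun he => huq ?_⟩
    · rw [← hσw, ← hσp, he]
    · rw [← hσw, ← hσq, he]

lemma exists_properOn_ne (h : IsMinimalBad G) {S : Finset V} (hS : S ⊂ supportOf G) {u v : V}
    (hu : u ∈ S) (hv : v ∈ S) (huv : u ≠ v) : ∃ f, ProperOn G S f ∧ f u ≠ f v := by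
  by_contra! hc
  obtain ⟨W, -, hWc, -, hsub, -, -, hpot⟩ := h.exists_addEdgeOn hS hu hv huv hc
  linarith [h.eleven_le_potential (lt_of_le_of_lt hsub hS)
    ((by omega : 2 ≤ 4).trans (four_le_card_supportOf hWc.1))]

end IsMinimalBad

end NoTightSet

section CubicVertices

open scoped Classical

variable {V : Type}

lemma exists_eq_insert_of_card_eq_three {s : Finset V} (h : s.card = 3) {a b : V} (ha : a ∈ s)
    (hb : b ∈ s) (hab : a ≠ b) : ∃ c, c ≠ a ∧ c ≠ b ∧ s = {a, b, c} := by
  have hsub : ({a, b} : Finset V) ⊆ s := by simp [Finset.insert_subset_iff, ha, hb]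
  have h1 : (s \ {a, b}).card = 1 := by
    rw [Finset.card_sdiff_of_subset hsub, Finset.card_pair hab, h]
  obtain ⟨c, hc⟩ := Finset.card_eq_one.1 h1
  have hc' : c ∈ s \ {a, b} := by simp [hc]
  simp only [Finset.mem_sdiff, Finset.mem_insert, Finset.mem_singleton, not_or] at hc'
  refine ⟨c, hc'.2.1, hc'.2.2, ?_⟩
  rw [← Finset.sdiff_union_of_subset hsub, hc]
  ext x
  simp only [Finset.mem_union, Finset.mem_singleton, Finset.mem_insert]
  tauto

lemma potential_le_ten_mul_card (G : SimpleGraph V) (S : Finset V) :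
    potential G S ≤ 10 * S.card := by
  unfold potential
  linarith [pairCount_nonneg G S S]

lemma card_le_card_filter_adj {G : SimpleGraph V} {v : V} {T S : Finset V} (hTS : T ⊆ S)
    (h : ∀ w ∈ T, G.Adj v w) : (T.card : ℤ) ≤ ((S.filter (G.Adj v)).card : ℤ) := by
  exact_mod_cast Finset.card_le_card fun w hw => Finset.mem_filter.2 ⟨hTS hw, h w hw⟩

variable [Fintype V]

namespace IsMinimalBad

variable {G : SimpleGraph V}

/-- Two adjacent vertices of degree three do not lie in a common triangle. -/
lemma not_triangle (h : IsMinimalBad G) {b c d : V} (hb : (nbrs G b).card = 3)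
    (hc : (nbrs G c).card = 3) (hbc : G.Adj b c) (hbd : G.Adj b d) : ¬ G.Adj c d := by
  intro hcd
  obtain ⟨p, hpc, hpd, hbN⟩ := exists_eq_insert_of_card_eq_three hb (mem_nbrs.2 hbc)
    (mem_nbrs.2 hbd) hcd.ne
  obtain ⟨q, hqb, hqd, hcN⟩ := exists_eq_insert_of_card_eq_three hc (mem_nbrs.2 hbc.symm)
    (mem_nbrs.2 hcd) hbd.ne
  have hbp : G.Adj b p := mem_nbrs.1 (by simp [hbN])
  have hcq : G.Adj c q := mem_nbrs.1 (by simp [hcN])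
  have hbs := left_mem_supportOf hbc
  have hcs := right_mem_supportOf hbc
  have hmem : ∀ x, x ∈ ((supportOf G).erase c).erase b ↔ x ≠ b ∧ x ≠ c ∧ x ∈ supportOf G := by
    simp
  by_cases hpq : p = q
  · subst hpq
    have h1 : potential G {b, c, d, p} ≤ 10 := by
      have hbT : b ∉ ({c, d, p} : Finset V) := by simp [hbc.ne, hbd.ne, hbp.ne]
      have hcT : c ∉ ({d, p} : Finset V) := by simp [hcd.ne, hpc.symm]
      rw [potential_insert G hbT, potential_insert G hcT]
      have h2 := card_le_card_filter_adj (G := G) (v := b) (subset_rfl : ({c, d, p} : Finset V) ⊆ _)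
        (by simp [hbc, hbd, hbp])
      have h3 := card_le_card_filter_adj (G := G) (v := c) (subset_rfl : ({d, p} : Finset V) ⊆ _)
        (by simp [hcd, hcq])
      have h4 := potential_le_ten_mul_card G {d, p}
      rw [Finset.card_insert_of_notMem hcT, Finset.card_pair hpd.symm] at h2
      rw [Finset.card_pair hpd.symm] at h3 h4
      push_cast at *
      linarith
    have hsub : ({b, c, d, p} : Finset V) ⊂ supportOf G := by
      refine Finset.ssubset_iff_subset_ne.2 ⟨?_, fun he => ?_⟩
      · simp only [Finset.insert_subset_iff, Finset.singleton_subset_iff]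
        exact ⟨hbs, hcs, right_mem_supportOf hbd, right_mem_supportOf hbp⟩
      · have := h.four_lt_card
        rw [← he] at this
        exact absurd (Finset.card_le_four (a := b) (b := c) (c := d) (d := p)) (by omega)
    have h2 : ({b, c} : Finset V).card ≤ ({b, c, d, p} : Finset V).card :=
      Finset.card_le_card (by intro x; simp only [Finset.mem_insert, Finset.mem_singleton]; tauto)
    rw [Finset.card_pair hbc.ne] at h2
    linarith [h.eleven_le_potential hsub h2]
  · have hS : ((supportOf G).erase c).erase b ⊂ supportOf G :=
      Finset.ssubset_iff_subset_ne.2 ⟨(Finset.erase_subset _ _).trans (Finset.erase_subset _ _),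
        fun he => ((hmem b).1 (by rwa [he])).1 rfl⟩
    obtain ⟨f, hf, hfpq⟩ := h.exists_properOn_ne hS
      ((hmem p).2 ⟨hbp.ne.symm, hpc, right_mem_supportOf hbp⟩)
      ((hmem q).2 ⟨hqb, hcq.ne.symm, right_mem_supportOf hcq⟩) hpq
    obtain ⟨x, y, hxd, hxp, hyd, hyq, hxy⟩ : ∃ x y : Fin 3, x ≠ f d ∧ x ≠ f p ∧ y ≠ f d ∧
        y ≠ f q ∧ y ≠ x := by
      generalize f d = i at *
      generalize f p = j at *
      generalize f q = k at *
      clear * - hfpq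
      decide +revert
    have h1 := hf.insert_update (v := b) (c := x) (by simp) (by
      intro w hw hbw
      have : w ∈ nbrs G b := mem_nbrs.2 hbw
      have hwc := ((hmem w).1 hw).2.1
      rw [hbN] at this
      simp only [Finset.mem_insert, Finset.mem_singleton] at this
      rcases this with rfl | rfl | rfl
      exacts [absurd rfl hwc, hxd, hxp])
    rw [Finset.insert_erase (Finset.mem_erase.2 ⟨hbc.ne, hbs⟩)] at h1
    have h2 := h1.insert_update (v := c) (c := y) (by simp) (by
      intro w hw hcw
      have : w ∈ nbrs G c := mem_nbrs.2 hcw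
      rw [hcN] at this
      simp only [Finset.mem_insert, Finset.mem_singleton] at this
      rcases this with rfl | rfl | rfl
      · rwa [Function.update_self]
      · rwa [Function.update_of_ne hbd.ne.symm]
      · rwa [Function.update_of_ne hqb])
    rw [Finset.insert_erase hcs] at h2
    exact h.critical.1 (threeCol_of_properOn h2 subset_rfl)

lemma card_le_of_potential_le (h : IsMinimalBad G) {R : Finset V} (hR : R ⊂ supportOf G)
    (h4 : 4 ≤ R.card) (hpot : potential G R ≤ 12) : (supportOf G).card ≤ R.card + 1 := by
  by_contra! hlt
  induction hk : (supportOf G).card - R.card using Nat.strong_induction_on generalizing R with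
  | _ k ih =>
  have hmax : ∀ Q, Q ⊂ supportOf G → R.card < Q.card → potential G Q ≤ 12 →
      (supportOf G).card ≤ Q.card + 1 := by
    intro Q hQ hc hp
    by_contra! hlt'
    exact ih _ (by omega) hQ (by omega) hp hlt' rfl
  clear ih hk
  obtain ⟨u, hu, v, hv, huv, ⟨a, ha, hua⟩, b, hb, hvb⟩ := h.exists_two_boundary hR (by omega)
  obtain ⟨f, hf, hfuv⟩ := h.exists_properOn_ne hR hu hv huv
  obtain ⟨W, B, X, hW, hWc, hs, hB, hBR, hBne, hX, hpotW, hsplit⟩ := h.exists_collapse hR h4 hf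
  have h1 := potential_collapse hW hBR X
  have h3 := ten_le_potential_triangle W hX
  have he : B ∪ R = supportOf G := by
    by_contra he
    have := h.eleven_le_potential (lt_of_le_of_ne (Finset.union_subset hB hR.1) he)
      ((by omega : 2 ≤ R.card).trans (Finset.card_le_card Finset.subset_union_right))
    linarith
  have h5 := h.four_le
  rw [← he] at h5
  have key : ∀ r a, r ∈ R → a ∉ R → G.Adj r a → f r ∈ X := by
    intro r a hr ha hra
    by_contra hn
    have haB : a ∈ B := by
      have := right_mem_supportOf hra
      rw [← he, Finset.mem_union] at this
      tauto
    linarith [potential_collapse_of_missed hW hBR haB hr hra.symm hn]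
  have hX2 : 2 ≤ X.card := Finset.one_lt_card.2
    ⟨_, key u a hu ha hua, _, key v b hv hb hvb, hfuv⟩
  have hX3 : X = Finset.univ := by
    rw [← Finset.card_eq_iff_eq_univ, Fintype.card_fin]
    have hle : X.card ≤ 3 := by simpa using X.card_le_univ
    by_contra hne
    have hX2 : X.card = 2 := by omega
    have := potential_triangle_ge W X
    rw [hX2] at this
    push_cast at this
    linarith
  subst hX3
  have h12 := h3.2 (by simp)
  have htri : ∀ i j : Fin 3, i ≠ j → W.Adj (.inr i) (.inr j) := fun i j =>
    adj_of_potential_triangle_le (by linarith)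
  have hBRc : B.card + R.card = (supportOf G).card := by
    rw [← he, Finset.card_union_of_disjoint hBR]
  rcases hsplit (by linarith) with hc4 | ⟨B', C, p, q, hsp⟩
  · rw [Finset.card_disjSum] at hc4
    simp at hc4
    omega
  obtain ⟨D, hD⟩ : ∃ D, D = B'.toLeft := ⟨_, rfl⟩
  obtain ⟨J, hJ⟩ : ∃ J, J = B'.toRight := ⟨_, rfl⟩
  have hB' : B' = D.disjSum J := by rw [hD, hJ, Finset.toLeft_disjSum_toRight]
  have hinlB : ∀ x, Sum.inl x ∈ B' ↔ x ∈ D := by simp [hB']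
  have hinrB : ∀ i, Sum.inr i ∈ B' ↔ i ∈ J := by simp [hB']
  have hmem := hsp.mem_support
  rw [hs] at hmem
  have hDB : D ⊆ B := fun x hx => by simpa using (hmem (.inl x)).2 (Or.inl ((hinlB x).2 hx))
  have hcard : B'.card + C.card = B.card + 3 := by
    rw [← Finset.card_union_of_disjoint hsp.disj]
    have : B' ∪ C = B.disjSum Finset.univ := by
      ext x
      rw [Finset.mem_union, hmem]
    rw [this, Finset.card_disjSum]
    simp
  have hB'c : B'.card = D.card + J.card := by rw [hB', Finset.card_disjSum]
  have hC3 := hsp.three_le_card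
  have hB'2 : 2 ≤ B'.card := Finset.one_lt_card.2 ⟨p, hsp.left_mem, q, hsp.right_mem, hsp.ne⟩
  have hpotB := hsp.potential_le
  have hJ3 : J.card ≤ 3 := by simpa using J.card_le_univ
  have hDR : Disjoint D R := hBR.mono_left hDB
  have hDRc : (D ∪ R).card = D.card + R.card := Finset.card_union_of_disjoint hDR
  have hDRs : D.card < B.card → D ∪ R ⊂ supportOf G := fun hlt =>
    Finset.ssubset_iff_subset_ne.2 ⟨Finset.union_subset (hDB.trans hB) hR.1, fun he' => by
      rw [he'] at hDRc
      omega⟩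
  rcases J.eq_empty_or_nonempty with rfl | hJne
  · rw [Finset.card_empty] at hB'c
    have := potential_collapse_empty hW D
    rw [← hB'] at this
    obtain ⟨r, hr⟩ := Finset.card_pos.1 (by omega : 0 < R.card)
    linarith [h.eleven_le_potential (R := D) (Finset.ssubset_iff_subset_ne.2 ⟨hDB.trans hB,
      fun he => Finset.disjoint_right.1 hDR hr (he ▸ hR.1 hr)⟩) (by omega)]
  have hpotDR := potential_collapse hW hDR J
  rw [← hB'] at hpotDR
  have hJpot := ten_le_potential_triangle W hJne
  have hDlt : D.card < B.card := by
    have := hJne.card_pos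
    omega
  have hDRs := hDRs hDlt
  have hJ1 : J.card = 1 := by
    have := hJne.card_pos
    by_contra hne
    linarith [hJpot.2 (by omega), h.eleven_le_potential hDRs (by omega)]
  have hD1 := hmax _ hDRs (by omega) (by linarith)
  obtain ⟨x, hx⟩ := Finset.card_eq_one.1 (by
    rw [Finset.card_sdiff_of_subset hDB]
    omega : (B \ D).card = 1)
  have hxBD : x ∈ B ∧ x ∉ D := Finset.mem_sdiff.1 (by simp [hx])
  have hxC : Sum.inl x ∈ C := ((hmem _).1 (by simpa using hxBD.1)).resolve_left
    fun hc => hxBD.2 ((hinlB x).1 hc)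
  obtain ⟨k, rfl⟩ := Finset.card_eq_one.1 hJ1
  have hkpq : Sum.inr k = p ∨ Sum.inr k = q := by
    obtain ⟨i, hi⟩ := exists_ne_fin_three k
    exact hsp.sep _ ((hinrB k).2 (by simp)) (.inr i)
      (((hmem _).1 (by simp)).resolve_left fun hc => hi (by simpa using (hinrB i).1 hc))
      (htri k i hi.symm)
  have hnb : nbrs W (.inl x) ⊆ ((Finset.univ : Finset (Fin 3)).filter
      fun i => W.Adj (.inl x) (.inr i)).image Sum.inr ∪ ({p, q} : Finset _).erase (.inr k) := by
    intro y hy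
    have hxy := mem_nbrs.1 hy
    rcases y with y | i
    · refine Finset.mem_union_right _ (Finset.mem_erase.2 ⟨by simp, ?_⟩)
      have hys := right_mem_supportOf hxy
      rw [hs] at hys
      rcases (hmem _).1 hys with hyB | hyC
      · simpa using hsp.sep _ hyB _ hxC hxy.symm
      · have hyD : y ∉ D := fun hyD =>
          Finset.disjoint_left.1 hsp.disj ((hinlB y).2 hyD) hyC
        have : y ∈ B \ D := Finset.mem_sdiff.2 ⟨by simpa using hys, hyD⟩
        rw [hx, Finset.mem_singleton] at this
        exact absurd hxy (by simp [this])
    · exact Finset.mem_union_left _ (by simpa using hxy)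
  have hfil : 2 ≤ ((Finset.univ : Finset (Fin 3)).filter fun i => W.Adj (.inl x) (.inr i)).card := by
    have h1 := hWc.three_le_card_nbrs (v := .inl x) (by rw [hs]; simpa using hxBD.1)
    have h2 := (Finset.card_le_card hnb).trans (Finset.card_union_le _ _)
    have h3 : (({p, q} : Finset _).erase (.inr k)).card + 1 = 2 := by
      rw [Finset.card_erase_add_one (by simpa using hkpq), Finset.card_pair hsp.ne]
    have h4 := Finset.card_image_le (f := (Sum.inr : Fin 3 → V ⊕ Fin 3))
      (s := (Finset.univ : Finset (Fin 3)).filter fun i => W.Adj (.inl x) (.inr i))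
    omega
  have hxR : x ∉ R := Finset.disjoint_left.1 hBR hxBD.1
  have h6 := potential_insert G hxR
  have h7 : 2 ≤ (R.filter (G.Adj x)).card := by
    have := card_colors_adj_le hW Finset.univ x
    simp only [Finset.mem_univ, Finset.filter_true] at this
    omega
  have h8 : (2 : ℤ) ≤ ((R.filter (G.Adj x)).card : ℤ) := by exact_mod_cast h7
  have h9 := Finset.card_insert_of_notMem hxR
  have h10 := h.eleven_le_potential (R := insert x R) (Finset.ssubset_iff_subset_ne.2
    ⟨Finset.insert_subset (hB hxBD.1) hR.1, fun he => by rw [he] at h9; omega⟩) (by omega)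
  linarith

/-- The other two neighbours of a leaf of a cherry of vertices of degree three are adjacent. -/
lemma adj_of_cherry (h : IsMinimalBad G) {x y a b c : V} (hx : (nbrs G x).card = 3)
    (hy : (nbrs G y).card = 3) (hc : (nbrs G c).card = 3) (hyc : G.Adj y c) (hcx : c ≠ x)
    (hxN : nbrs G x = {y, a, b}) : G.Adj a b := by
  by_contra hab
  have hxy : G.Adj x y := mem_nbrs.1 (by simp [hxN])
  have hxa : G.Adj x a := mem_nbrs.1 (by simp [hxN])
  have hxb : G.Adj x b := mem_nbrs.1 (by simp [hxN])
  obtain ⟨hya, hyb, hab'⟩ : y ≠ a ∧ y ≠ b ∧ a ≠ b := by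
    rw [hxN] at hx
    have h2 : ∀ u v : V, ({u, v} : Finset V).card ≤ 2 := fun u v => Finset.card_le_two
    refine ⟨?_, ?_, ?_⟩
    · rintro rfl
      rw [Finset.insert_idem] at hx
      exact absurd (h2 y b) (by omega)
    · rintro rfl
      rw [Finset.insert_comm, Finset.pair_eq_singleton] at hx
      exact absurd (h2 a y) (by omega)
    · rintro rfl
      rw [Finset.pair_eq_singleton] at hx
      exact absurd (h2 y a) (by omega)
  obtain ⟨d, hdx, hdc, hyN⟩ := exists_eq_insert_of_card_eq_three hy (mem_nbrs.2 hxy.symm)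
    (mem_nbrs.2 hyc) hcx.symm
  have hxs := left_mem_supportOf hxy
  have hys := right_mem_supportOf hxy
  have has := right_mem_supportOf hxa
  have hbs := right_mem_supportOf hxb
  have hS : ∀ v, v ∈ ((supportOf G).erase x).erase y ↔ v ≠ y ∧ v ≠ x ∧ v ∈ supportOf G := by
    simp
  set S := ((supportOf G).erase x).erase y with hSdef
  have hRp : ProperOn (restrictTo G S) {a, b} fun _ => 0 := by
    intro v hv w hw hvw
    simp only [Finset.mem_insert, Finset.mem_singleton] at hv hw
    rcases hv with rfl | rfl <;> rcases hw with rfl | rfl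
    exacts [absurd rfl hvw.1.ne, absurd hvw.1 hab, absurd hvw.1.symm hab, absurd rfl hvw.1.ne]
  obtain ⟨W, B, X, hW, hWc, hs, hBs, hBR, hBne, hX⟩ := exists_edgeCritical_collapse
    (G := restrictTo G S) (R := {a, b}) (f := fun _ => 0) (by
    intro hcol
    obtain ⟨f, hf, hfab⟩ := exists_coloring_of_collapse hRp hcol
    have hfab := hfab a (by simp) b (by simp) rfl
    have hfS : ProperOn G S f := fun v hv w hw hvw => hf v w ⟨hvw, hv, hw⟩
    obtain ⟨i, hi⟩ := exists_color_avoiding f {c, d} Finset.card_le_two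
    have h1 := hfS.insert_update (v := y) (c := i) (by simp [hSdef]) (by
      intro w hw hyw
      refine hi w ?_
      have : w ∈ nbrs G y := mem_nbrs.2 hyw
      rw [hyN, Finset.mem_insert] at this
      exact this.resolve_left ((hS w).1 hw).2.1)
    rw [hSdef, Finset.insert_erase (Finset.mem_erase.2 ⟨hxy.ne.symm, hys⟩)] at h1
    obtain ⟨j, hj⟩ := exists_color_avoiding (Function.update f y i) {y, a} Finset.card_le_two
    have h2 := h1.insert_update (v := x) (c := j) (by simp) (by
      intro w hw hxw
      have : w ∈ nbrs G x := mem_nbrs.2 hxw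
      rw [hxN] at this
      simp only [Finset.mem_insert, Finset.mem_singleton] at this
      rcases this with rfl | rfl | rfl
      · exact hj w (by simp)
      · exact hj w (by simp)
      · have := hj a (by simp)
        rwa [Function.update_of_ne hya.symm, hfab, ← Function.update_of_ne hyb.symm i f] at this)
    rw [Finset.insert_erase hxs] at h2
    exact h.critical.1 (threeCol_of_properOn h2 subset_rfl))
  have hBS : B ⊆ S := by
    intro v hv
    obtain ⟨w, hw⟩ := mem_supportOf.1 (hBs hv)
    exact hw.2.1
  have hxS : x ∉ S := by simp [hS]
  have hyS : y ∉ S := by simp [hS]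
  have haS : a ∈ S := (hS a).2 ⟨hya.symm, hxa.ne.symm, has⟩
  have hbS : b ∈ S := (hS b).2 ⟨hyb.symm, hxb.ne.symm, hbs⟩
  have hQS : B ∪ {a, b} ⊆ S := Finset.union_subset hBS
    (by simp [Finset.insert_subset_iff, haS, hbS])
  have hcardQ : (B ∪ {a, b}).card = B.card + 2 := by
    rw [Finset.card_union_of_disjoint hBR, Finset.card_pair hab']
  have hcardS : S.card + 2 = (supportOf G).card := by
    have h1 : S.card + 1 = ((supportOf G).erase x).card :=
      Finset.card_erase_add_one (Finset.mem_erase.2 ⟨hxy.ne.symm, hys⟩)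
    have h2 := Finset.card_erase_add_one hxs
    omega
  have hlt : (supportOf W).card < (supportOf G).card := by
    have h1 := Finset.card_le_card hQS
    have h2 : X.card ≤ 3 := by simpa using X.card_le_univ
    rw [hs, Finset.card_disjSum]
    omega
  have hpotW := (h.smaller _ W hWc hlt).1
  rw [hs] at hpotW
  have hSss : S ⊂ supportOf G := Finset.ssubset_iff_subset_ne.2
    ⟨fun v hv => ((hS v).1 hv).2.2, fun he => hxS (he ▸ hxs)⟩
  have hXne := hX (by
    obtain ⟨f, hf⟩ := h.exists_properOn hSss
    exact ⟨f, hf.mono hBS fun _ _ _ _ h => h.1⟩)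
  have h1 := potential_collapse hW hBR X
  have h2 := (ten_le_potential_triangle W hXne).1
  have h3 := potential_le_ten_mul_card (restrictTo G S) {a, b}
  rw [Finset.card_pair hab'] at h3
  have h4 : potential G (B ∪ {a, b}) ≤ potential (restrictTo G S) (B ∪ {a, b}) :=
    potential_anti fun _ _ _ _ h => h.1
  have hxQ : x ∉ B ∪ {a, b} := fun hx => hxS (hQS hx)
  have h5 := potential_insert G hxQ
  have h6 := card_le_card_filter_adj (G := G) (v := x) (T := {a, b}) (S := B ∪ {a, b})
    Finset.subset_union_right (by simp [hxa, hxb])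
  rw [Finset.card_pair hab'] at h6
  have hyQ : y ∉ insert x (B ∪ {a, b}) := by
    rw [Finset.mem_insert, not_or]
    exact ⟨hxy.ne.symm, fun hy => hyS (hQS hy)⟩
  have hQsub : insert x (B ∪ {a, b}) ⊆ supportOf G :=
    Finset.insert_subset hxs (hQS.trans hSss.1)
  have hQc : (insert x (B ∪ {a, b})).card = B.card + 3 := by
    rw [Finset.card_insert_of_notMem hxQ, hcardQ]
  have hBpos := hBne.card_pos
  have h7 := h.card_le_of_potential_le (R := insert x (B ∪ {a, b}))
    (Finset.ssubset_iff_subset_ne.2 ⟨hQsub, fun he => hyQ (he ▸ hys)⟩) (by omega)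
    (by push_cast at *; linarith)
  have hQeq : insert x (B ∪ {a, b}) = (supportOf G).erase y :=
    Finset.eq_of_subset_of_card_le (fun v hv => Finset.mem_erase.2
      ⟨by rintro rfl; exact hyQ hv, hQsub hv⟩) (by
        have := Finset.card_erase_add_one hys
        omega)
  have hcB : c ∈ B := by
    have hcQ : c ∈ insert x (B ∪ {a, b}) := by
      rw [hQeq]
      exact Finset.mem_erase.2 ⟨hyc.ne.symm, right_mem_supportOf hyc⟩
    simp only [Finset.mem_insert, Finset.mem_union, Finset.mem_singleton] at hcQ
    rcases hcQ with h' | h' | rfl | rfl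
    · exact absurd h' hcx
    · exact h'
    · exact absurd hyc (h.not_triangle hx hy hxy hxa)
    · exact absurd hyc (h.not_triangle hx hy hxy hxb)
  have hnb : nbrs W (.inl c) ⊆ ((nbrs G c).erase y).image
      fun w => if w ∈ ({a, b} : Finset V) then Sum.inr 0 else Sum.inl w := by
    intro z hz
    have hcz := hW (mem_nbrs.1 hz)
    rw [Finset.mem_image]
    rcases z with w | i
    · obtain ⟨hcw, -, hwR⟩ := hcz
      refine ⟨w, Finset.mem_erase.2 ⟨?_, mem_nbrs.2 hcw.1⟩, by simp [hwR]⟩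
      rintro rfl
      exact hyS hcw.2.2
    · obtain ⟨-, r, hr, rfl, hcr⟩ := hcz
      refine ⟨r, Finset.mem_erase.2 ⟨?_, mem_nbrs.2 hcr.1⟩, by simp only [hr, if_true]⟩
      rintro rfl
      exact hyS hcr.2.2
  have h8 := hWc.three_le_card_nbrs (v := .inl c) (by rw [hs]; simpa using hcB)
  have h9 := (Finset.card_le_card hnb).trans Finset.card_image_le
  have h10 := Finset.card_erase_add_one (mem_nbrs.2 hyc.symm)
  omega

end IsMinimalBad

end CubicVertices

section Discharging

open scoped Classical

variable {V : Type} [Fintype V]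

/-! ### Discharging -/

/-- A cubic vertex with at least two cubic neighbours. -/
def IsCherryCenter (G : SimpleGraph V) (u : V) : Prop :=
  (nbrs G u).card = 3 ∧ ∃ v w, G.Adj u v ∧ G.Adj u w ∧ v ≠ w ∧ (nbrs G v).card = 3 ∧
    (nbrs G w).card = 3

/-- A cubic vertex adjacent to the centre of a cherry. -/
def IsCherryLeaf (G : SimpleGraph V) (u : V) : Prop :=
  (nbrs G u).card = 3 ∧ ∃ v, G.Adj u v ∧ IsCherryCenter G v

/-- The charge that `u` sends to its neighbour `v`. -/
def charge (G : SimpleGraph V) (u v : V) : ℤ :=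
  if (nbrs G u).card = 3 then
    if IsCherryCenter G u then 2
    else if (nbrs G v).card = 3 then 0
    else if IsCherryLeaf G u then 4
    else 3
  else 0

lemma charge_le_four (G : SimpleGraph V) (u v : V) : charge G u v ≤ 4 := by
  unfold charge
  split_ifs <;> norm_num

lemma potential_supportOf (G : SimpleGraph V) :
    potential G (supportOf G) = ∑ v ∈ supportOf G, (10 - 3 * ((nbrs G v).card : ℤ)) := by
  unfold potential pairCount
  rw [Finset.sum_sub_distrib, ← Finset.mul_sum]
  simp only [Finset.sum_const, nsmul_eq_mul]
  rw [mul_comm]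
  congr 2
  refine Finset.sum_congr rfl fun v _ => ?_
  have : (supportOf G).filter (G.Adj v) = nbrs G v := by
    ext w
    rw [Finset.mem_filter, mem_nbrs]
    exact ⟨fun h => h.2, fun h => ⟨right_mem_supportOf h, h⟩⟩
  rw [← Finset.sum_filter, this]
  simp

lemma sum_charge_comm (G : SimpleGraph V) (F : V → V → ℤ) :
    ∑ v ∈ supportOf G, ∑ u ∈ nbrs G v, F u v = ∑ v ∈ supportOf G, ∑ u ∈ nbrs G v, F v u := by
  have h : ∀ (F : V → V → ℤ), ∑ v ∈ supportOf G, ∑ u ∈ nbrs G v, F v u =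
      ∑ v, ∑ u, if G.Adj v u then F v u else 0 := by
    intro F
    have h1 : ∀ v, ∑ u ∈ nbrs G v, F v u = ∑ u, if G.Adj v u then F v u else 0 := fun v => by
      rw [nbrs, Finset.sum_filter]
    simp only [← h1]
    refine Finset.sum_subset (Finset.subset_univ _) fun v _ hv => ?_
    refine Finset.sum_eq_zero fun u hu => absurd (left_mem_supportOf (mem_nbrs.1 hu)) hv
  refine (h fun v u => F u v).trans ?_
  rw [h, Finset.sum_comm]
  simp only [G.adj_comm]

lemma sum_triple {V M : Type} [AddCommMonoid M] {s : Finset V} {a b c : V}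
    (hs : s = {a, b, c}) (h3 : s.card = 3) (F : V → M) : ∑ x ∈ s, F x = F a + (F b + F c) := by
  subst hs
  have h2 : ∀ u v : V, ({u, v} : Finset V).card ≤ 2 := fun u v => Finset.card_le_two
  have hbc : b ≠ c := by
    rintro rfl
    rw [Finset.pair_eq_singleton] at h3
    exact absurd (h2 a b) (by omega)
  have ha : a ∉ ({b, c} : Finset V) := fun ha => by
    rw [Finset.insert_eq_of_mem ha] at h3
    exact absurd (h2 b c) (by omega)
  rw [Finset.sum_insert ha, Finset.sum_pair hbc]

namespace IsMinimalBad

variable {G : SimpleGraph V}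

lemma leaf_nbrs (h : IsMinimalBad G) {x y : V} (hx : (nbrs G x).card = 3) (hxy : G.Adj x y)
    (hy : IsCherryCenter G y) : ∃ a b, nbrs G x = {y, a, b} ∧ G.Adj a b ∧
      (nbrs G a).card ≠ 3 ∧ (nbrs G b).card ≠ 3 := by
  obtain ⟨hy3, c, hyc, hcx, hc⟩ : (nbrs G y).card = 3 ∧ ∃ c, G.Adj y c ∧ c ≠ x ∧
      (nbrs G c).card = 3 := by
    obtain ⟨hy3, v, w, hv, hw, hvw, hv3, hw3⟩ := hy
    by_cases hvx : v = x
    · exact ⟨hy3, w, hw, fun hwx => hvw (hvx.trans hwx.symm), hw3⟩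
    · exact ⟨hy3, v, hv, hvx, hv3⟩
  obtain ⟨a, ha, hay⟩ : ∃ a ∈ nbrs G x, a ≠ y := by
    by_contra! hall
    have := Finset.card_le_card (t := {y}) fun z hz => Finset.mem_singleton.2 (hall z hz)
    simp at this
    omega
  obtain ⟨b, -, -, hN⟩ := exists_eq_insert_of_card_eq_three hx (mem_nbrs.2 hxy) ha hay.symm
  have hab := h.adj_of_cherry hx hy3 hc hyc hcx hN
  have hxb : G.Adj x b := mem_nbrs.1 (by simp [hN])
  have hxa : G.Adj x a := mem_nbrs.1 ha
  exact ⟨a, b, hN, hab, fun ha3 => h.not_triangle hx ha3 hxa hxb hab,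
    fun hb3 => h.not_triangle hx hb3 hxb hxa hab.symm⟩

lemma not_adj_centers (h : IsMinimalBad G) {u w : V} (hu : IsCherryCenter G u)
    (hw : IsCherryCenter G w) : ¬ G.Adj u w := by
  intro huw
  obtain ⟨a, b, hN, -, ha, hb⟩ := h.leaf_nbrs hu.1 huw hw
  obtain ⟨-, v, z, hv, hz, hvz, hv3, hz3⟩ := hu
  have h1 : ∀ v, G.Adj u v → (nbrs G v).card = 3 → v = w := by
    intro v hv hv3
    have := mem_nbrs.2 hv
    rw [hN] at this
    simp only [Finset.mem_insert, Finset.mem_singleton] at this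
    rcases this with h' | rfl | rfl
    exacts [h', absurd hv3 ha, absurd hv3 hb]
  exact hvz ((h1 v hv hv3).trans (h1 z hz hz3).symm)

lemma final_charge_cubic (h : IsMinimalBad G) {v : V} (hv : (nbrs G v).card = 3) :
    6 + ∑ u ∈ nbrs G v, charge G u v ≤ ∑ u ∈ nbrs G v, charge G v u := by
  by_cases hcen : IsCherryCenter G v
  · have h1 : ∑ u ∈ nbrs G v, charge G u v = 0 := Finset.sum_eq_zero fun u hu => by
      unfold charge
      have : ¬ IsCherryCenter G u := fun hu' => h.not_adj_centers hcen hu' (mem_nbrs.1 hu)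
      simp [this, hv]
    have h2 : ∑ u ∈ nbrs G v, charge G v u = 6 := by
      rw [Finset.sum_congr rfl fun u _ => show charge G v u = 2 by simp [charge, hv, hcen]]
      simp [hv]
    linarith
  by_cases hleaf : IsCherryLeaf G v
  · obtain ⟨-, y, hvy, hy⟩ := hleaf
    obtain ⟨a, b, hN, -, ha, hb⟩ := h.leaf_nbrs hv hvy hy
    have hleaf : IsCherryLeaf G v := ⟨hv, y, hvy, hy⟩
    rw [sum_triple hN hv, sum_triple hN hv]
    simp [charge, ha, hb, hy, hy.1, hv, hleaf, hcen]
  · have h1 : ∑ u ∈ nbrs G v, charge G u v = 0 := Finset.sum_eq_zero fun u hu => by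
      unfold charge
      have : ¬ IsCherryCenter G u := fun hu' => hleaf ⟨hv, u, mem_nbrs.1 hu, hu'⟩
      simp [this, hv]
    obtain ⟨a, b, c, hab, hac, hbc, hN⟩ := Finset.card_eq_three.1 hv
    have hmem : ∀ x ∈ ({a, b, c} : Finset V), G.Adj v x := fun x hx => mem_nbrs.1 (hN ▸ hx)
    have hne : ∀ x y, G.Adj v x → G.Adj v y → x ≠ y →
        ¬ ((nbrs G x).card = 3 ∧ (nbrs G y).card = 3) :=
      fun x y hx hy hxy h3 => hcen ⟨hv, x, y, hx, hy, hxy, h3⟩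
    have h2 := hne a b (hmem a (by simp)) (hmem b (by simp)) hab
    have h3 := hne a c (hmem a (by simp)) (hmem c (by simp)) hac
    have h4 := hne b c (hmem b (by simp)) (hmem c (by simp)) hbc
    rw [h1, sum_triple hN hv]
    by_cases ha : (nbrs G a).card = 3 <;> by_cases hb : (nbrs G b).card = 3 <;>
      by_cases hc : (nbrs G c).card = 3 <;> simp_all [charge]

lemma final_charge_big (h : IsMinimalBad G) {v : V} (hv : 4 ≤ (nbrs G v).card) :
    60 - 18 * ((nbrs G v).card : ℤ) + ∑ u ∈ nbrs G v, charge G u v ≤ 0 := by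
  have hle : ∑ u ∈ nbrs G v, charge G u v ≤ 4 * ((nbrs G v).card : ℤ) := by
    refine (Finset.sum_le_sum fun u _ => charge_le_four G u v).trans ?_
    simp [mul_comm]
  rcases Nat.lt_or_ge 4 (nbrs G v).card with h5 | h4
  · have : (5 : ℤ) ≤ (nbrs G v).card := by exact_mod_cast h5
    linarith
  have h4 : (nbrs G v).card = 4 := by omega
  suffices ∑ u ∈ nbrs G v, charge G u v ≤ 12 by rw [h4]; push_cast; linarith
  by_cases hleaf : ∃ x ∈ nbrs G v, IsCherryLeaf G x
  · obtain ⟨x, hxv, hx3, y, hxy, hy⟩ := hleaf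
    have hvx := (mem_nbrs.1 hxv).symm
    obtain ⟨a, b, hN, hab, ha, hb⟩ := h.leaf_nbrs hx3 hxy hy
    obtain ⟨z, hz, hz3⟩ : ∃ z ∈ nbrs G v, (nbrs G z).card ≠ 3 := by
      have : v ∈ nbrs G x := mem_nbrs.2 hvx
      rw [hN] at this
      simp only [Finset.mem_insert, Finset.mem_singleton] at this
      rcases this with rfl | rfl | rfl
      · exact absurd hy.1 (by omega)
      · exact ⟨b, mem_nbrs.2 hab, hb⟩
      · exact ⟨a, mem_nbrs.2 hab.symm, ha⟩
    rw [← Finset.add_sum_erase _ _ hz]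
    have h1 : charge G z v = 0 := by simp [charge, hz3]
    have h2 : ∑ u ∈ (nbrs G v).erase z, charge G u v ≤ ∑ u ∈ (nbrs G v).erase z, 4 :=
      Finset.sum_le_sum fun u _ => charge_le_four G u v
    rw [Finset.sum_const, Finset.card_erase_of_mem hz, h4] at h2
    simp at h2
    linarith
  · have h2 : ∑ u ∈ nbrs G v, charge G u v ≤ ∑ u ∈ nbrs G v, 3 :=
      Finset.sum_le_sum fun u hu => by
        have : ¬ IsCherryLeaf G u := fun hl => hleaf ⟨u, hu, hl⟩
        unfold charge
        split_ifs <;> norm_num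
    rw [Finset.sum_const, h4] at h2
    simpa using h2

end IsMinimalBad

lemma not_isMinimalBad (G : SimpleGraph V) : ¬ IsMinimalBad G := by
  intro h
  have h1 := h.four_le
  rw [potential_supportOf] at h1
  have h2 := sum_charge_comm G (charge G)
  have h3 : ∑ v ∈ supportOf G, (6 * (10 - 3 * ((nbrs G v).card : ℤ)) +
      ∑ u ∈ nbrs G v, charge G u v) ≤ ∑ v ∈ supportOf G, ∑ u ∈ nbrs G v, charge G v u := by
    refine Finset.sum_le_sum fun v hv => ?_
    have hd := h.critical.three_le_card_nbrs hv
    rcases hd.eq_or_lt with h3 | h4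
    · rw [← h3]
      have := h.final_charge_cubic h3.symm
      push_cast
      linarith
    · have h5 := h.final_charge_big (v := v) h4
      have h6 : ∑ u ∈ nbrs G v, charge G v u = 0 := Finset.sum_eq_zero fun u _ => by
        simp [charge, show (nbrs G v).card ≠ 3 by omega]
      linarith
  rw [Finset.sum_add_distrib, ← Finset.mul_sum] at h3
  linarith

end Discharging

section UpperBound

open scoped Classical

variable {V : Type} [Fintype V]

/-! ### The Kostochka–Yancey bound -/

lemma EdgeCritical.potential_le_card {G : SimpleGraph V} (hG : EdgeCritical G) :
    potential G (supportOf G) ≤ (supportOf G).card := by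
  rw [potential_supportOf]
  calc _ ≤ ∑ v ∈ supportOf G, (1 : ℤ) := Finset.sum_le_sum fun v hv => by
        have : (3 : ℤ) ≤ (nbrs G v).card := by exact_mod_cast hG.three_le_card_nbrs hv
        linarith
    _ = _ := by simp

theorem EdgeCritical.potential_le {G : SimpleGraph V} (hG : EdgeCritical G) :
    potential G (supportOf G) ≤ 4 ∧ (4 ≤ potential G (supportOf G) →
      (supportOf G).card = 4 ∨ ∃ B C p q, IsTightSplit G B C p q) := by
  suffices H : ∀ (k : ℕ) (V : Type) [Fintype V] (G : SimpleGraph V), EdgeCritical G →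
      (supportOf G).card = k → potential G (supportOf G) ≤ 4 ∧ (4 ≤ potential G (supportOf G) →
        (supportOf G).card = 4 ∨ ∃ B C p q, IsTightSplit G B C p q) from H _ V G hG rfl
  clear hG G
  intro k
  induction k using Nat.strong_induction_on with
  | _ k ih =>
  intro V _ G hG hk
  by_cases h4 : (supportOf G).card = 4
  · exact ⟨by simpa [h4] using hG.potential_le_card, fun _ => Or.inl h4⟩
  by_cases hcut : NoTwoCut G
  · have hlt : potential G (supportOf G) < 4 := by
      by_contra! hge
      exact not_isMinimalBad G ⟨hG, hge, h4, hcut, fun W _ H hH hlt => ih _ (hk ▸ hlt) W H hH rfl⟩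
    exact ⟨hlt.le, fun h => absurd h (by linarith)⟩
  obtain ⟨B, C, p, q, h⟩ := hG.exists_isTwoCut hcut
  have h1 := (ih _ (by rw [← hk, h.supportOf_addEdgeOn]; exact h.card_left_lt)
    V _ (h.edgeCritical_addEdgeOn hG) rfl).1
  have h2 := (ih _ (by rw [← hk, h.supportOf_mergeOutside hG]; exact h.card_right_lt)
    V _ (h.edgeCritical_mergeOutside hG) rfl).1
  rw [h.supportOf_addEdgeOn] at h1
  rw [h.supportOf_mergeOutside hG] at h2
  have h3 := h.potential_eq hG
  exact ⟨by linarith, fun _ => Or.inr ⟨B, C, p, q, h.isTightSplit hG h1⟩⟩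

end UpperBound

section OreConstruction

open scoped Classical

/-! ### Building 4-Ore graphs -/

lemma splitCompose_inl_inl {V W : Type} {G1 : SimpleGraph V} {G2 : SimpleGraph W}
    {x y : V} {z : W} {N1 : Set W} {a b : V} :
    (splitCompose G1 G2 x y z N1).Adj (Sum.inl a) (Sum.inl b) ↔
      G1.Adj a b ∧ ¬(a = x ∧ b = y) ∧ ¬(a = y ∧ b = x) := by
  simp only [splitCompose, SimpleGraph.fromRel_adj, ne_eq, Sum.inl.injEq]
  constructor
  · rintro ⟨_, h | h⟩
    · exact h
    · exact ⟨h.1.symm, fun e => h.2.2 e.symm, fun e => h.2.1 e.symm⟩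
  · exact fun h => ⟨h.1.ne, Or.inl h⟩

lemma splitCompose_inl_inr {V W : Type} {G1 : SimpleGraph V} {G2 : SimpleGraph W}
    {x y : V} {z : W} {N1 : Set W} {a : V} {b : {w : W // w ≠ z}} :
    (splitCompose G1 G2 x y z N1).Adj (Sum.inl a) (Sum.inr b) ↔
      (a = x ∧ (b : W) ∈ N1) ∨ (a = y ∧ G2.Adj z b ∧ (b : W) ∉ N1) := by
  simp [splitCompose]

lemma splitCompose_inr_inr {V W : Type} {G1 : SimpleGraph V} {G2 : SimpleGraph W}
    {x y : V} {z : W} {N1 : Set W} {a b : {w : W // w ≠ z}} :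
    (splitCompose G1 G2 x y z N1).Adj (Sum.inr a) (Sum.inr b) ↔ G2.Adj a b := by
  simp only [splitCompose, SimpleGraph.fromRel_adj, ne_eq, Sum.inr.injEq]
  exact ⟨fun h => h.2.elim id SimpleGraph.Adj.symm,
    fun h => ⟨fun e => h.ne (congrArg Subtype.val e), Or.inl h⟩⟩

/-- A map out of the vertex set of a DHGO-composition is an isomorphism as soon as it is bijective
and respects adjacency on each of the two sides and between them. -/
lemma nonempty_splitCompose_iso {V W X : Type} {G1 : SimpleGraph V} {G2 : SimpleGraph W}
    {K : SimpleGraph X} {x y : V} {z : W} {N1 : Set W} (f : V ⊕ {w : W // w ≠ z} → X)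
    (hf : Function.Bijective f)
    (hll : ∀ a b, K.Adj (f (Sum.inl a)) (f (Sum.inl b)) ↔
      G1.Adj a b ∧ ¬(a = x ∧ b = y) ∧ ¬(a = y ∧ b = x))
    (hlr : ∀ a b, K.Adj (f (Sum.inl a)) (f (Sum.inr b)) ↔
      (a = x ∧ (b : W) ∈ N1) ∨ (a = y ∧ G2.Adj z b ∧ (b : W) ∉ N1))
    (hrr : ∀ a b, K.Adj (f (Sum.inr a)) (f (Sum.inr b)) ↔ G2.Adj a b) :
    Nonempty (K ≃g splitCompose G1 G2 x y z N1) := by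
  refine ⟨RelIso.symm ⟨Equiv.ofBijective f hf, ?_⟩⟩
  rintro (a | a) (b | b)
  · exact (hll a b).trans splitCompose_inl_inl.symm
  · exact (hlr a b).trans splitCompose_inl_inr.symm
  · rw [SimpleGraph.adj_comm, SimpleGraph.adj_comm (splitCompose _ _ _ _ _ _)]
    exact (hlr b a).trans splitCompose_inl_inr.symm
  · exact (hrr a b).trans splitCompose_inr_inr.symm

lemma nonempty_splitCompose_congr {V W V' W' : Type} {G1 : SimpleGraph V} {G2 : SimpleGraph W}
    {H1 : SimpleGraph V'} {H2 : SimpleGraph W'} (e1 : H1 ≃g G1) (e2 : H2 ≃g G2)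
    (x y : V') (z : W') (N1 : Set W') :
    Nonempty (splitCompose H1 H2 x y z N1 ≃g
      splitCompose G1 G2 (e1 x) (e1 y) (e2 z) (e2.symm ⁻¹' N1)) := by
  refine ⟨⟨e1.toEquiv.sumCongr (e2.toEquiv.subtypeEquiv fun a => by simp), ?_⟩⟩
  rintro (a | a) (b | b)
  · simp [splitCompose_inl_inl, e1.map_adj_iff]
  · simp [splitCompose_inl_inr, e2.map_adj_iff]
  · rw [SimpleGraph.adj_comm, SimpleGraph.adj_comm (splitCompose H1 _ _ _ _ _)]
    simp [splitCompose_inl_inr, e2.map_adj_iff]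
  · simp [splitCompose_inr_inr, e2.map_adj_iff]

lemma IsFourOre.of_iso {V W : Type} [Fintype V] [Fintype W] {G : SimpleGraph V}
    {H : SimpleGraph W} (hH : IsFourOre H) (e : G ≃g H) : IsFourOre G := by
  obtain ⟨n, G', h, ⟨e'⟩⟩ := hH
  exact ⟨n, G', h, ⟨e.trans e'⟩⟩

lemma isFourOre_top {V : Type} [Fintype V] (h : Fintype.card V = 4) :
    IsFourOre (⊤ : SimpleGraph V) :=
  ⟨4, ⊤, .base _ ⟨SimpleGraph.Iso.refl⟩, ⟨SimpleGraph.Iso.completeGraph (Fintype.equivFinOfCardEq h)⟩⟩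

lemma IsFourOre.splitCompose {V W X : Type} [Fintype V] [Fintype W] [Fintype X]
    {G1 : SimpleGraph V} {G2 : SimpleGraph W} {K : SimpleGraph X} {x y : V} {z : W} {N1 : Set W}
    (h1 : IsFourOre G1) (h2 : IsFourOre G2) (hxy : G1.Adj x y) (hsub : N1 ⊆ G2.neighborSet z)
    (hne : N1.Nonempty) (hne' : (G2.neighborSet z \ N1).Nonempty)
    (hK : Nonempty (K ≃g splitCompose G1 G2 x y z N1)) : IsFourOre K := by
  obtain ⟨n, G1', a1, ⟨e1⟩⟩ := h1
  obtain ⟨m, G2', a2, ⟨e2⟩⟩ := h2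
  obtain ⟨eK⟩ := hK
  obtain ⟨e⟩ := nonempty_splitCompose_congr e1 e2 x y z N1
  let eX := K.overFinIso rfl
  refine ⟨_, K.overFin rfl, ?_, ⟨eX⟩⟩
  refine .comp _ G1' G2' (e1 x) (e1 y) (e2 z) (e2.symm ⁻¹' N1) (e1.map_adj_iff.2 hxy) ?_ ?_ ?_
    a1 a2 ⟨eX.symm.trans (eK.trans e)⟩
  · intro w hw
    have := hsub hw
    rw [SimpleGraph.mem_neighborSet] at this ⊢
    rw [← e2.map_adj_iff] at this
    simpa using this
  · obtain ⟨w, hw⟩ := hne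
    exact ⟨e2 w, by simpa using hw⟩
  · obtain ⟨w, hw, hw'⟩ := hne'
    exact ⟨e2 w, e2.map_adj_iff.2 hw, by simpa using hw'⟩

variable {V : Type} [Fintype V] {G : SimpleGraph V} {B C : Finset V} {p q : V}

namespace IsTwoCut

/-- The far side of the cut has a colouring. -/
lemma exists_properOn_right (h : IsTwoCut G B C p q) (hG : EdgeCritical G) :
    ∃ f, ProperOn G (insert p (insert q C)) f := by
  obtain ⟨b, hb, hbp, hbq⟩ := h.exists_left
  refine hG.exists_properOn ((h.mem_support b).2 (Or.inl hb)) ?_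
  simpa [hbp, hbq] using Finset.disjoint_left.1 h.disj hb

lemma exists_adj_left (h : IsTwoCut G B C p q) (hG : EdgeCritical G) :
    ∃ c ∈ C, G.Adj p c := by
  by_contra! hc
  obtain ⟨f, hf⟩ := h.exists_properOn_right hG
  refine h.color_ne _ (hf.update_of_isolated (v := p) ?_ (f q)) (by simp [h.ne.symm])
  simpa using ⟨h.not_adj, hc⟩

lemma exists_adj_right (h : IsTwoCut G B C p q) (hG : EdgeCritical G) :
    ∃ c ∈ C, G.Adj q c := by
  by_contra! hc
  obtain ⟨f, hf⟩ := h.exists_properOn_right hG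
  refine h.color_ne _ (hf.update_of_isolated (v := q) ?_ (f p)) (by simp [h.ne])
  simpa using ⟨fun e => h.not_adj e.symm, hc⟩

lemma isFourOre (h : IsTwoCut G B C p q) (hG : EdgeCritical G)
    (h1 : IsFourOre ((addEdgeOn G B p q).induce (B : Set V)))
    (h2 : IsFourOre ((mergeOutside G B h.left_mem h.right_mem).induce
      ((insert p C : Finset V) : Set V))) :
    IsFourOre (G.induce (supportOf G : Set V)) := by
  have hpC := h.left_notMem
  have hqC := h.right_notMem
  refine h1.splitCompose (x := ⟨p, h.left_mem⟩) (y := ⟨q, h.right_mem⟩)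
    (z := ⟨p, by simp⟩) (N1 := {w | w.1 ∈ C ∧ G.Adj p w.1}) h2 ?_ ?_ ?_ ?_ ?_
  · exact addEdgeOn_adj.2 (Or.inr ⟨Or.inl ⟨rfl, rfl⟩, h.ne⟩)
  · rintro ⟨w, hw⟩ ⟨hwC, hpw⟩
    exact (h.mergeOutside_adj_left hwC).2 (Or.inl hpw)
  · obtain ⟨c, hc, hpc⟩ := h.exists_adj_left hG
    exact ⟨⟨c, by simp [hc]⟩, hc, hpc⟩
  · obtain ⟨c, hc, hqc⟩ := h.exists_adj_right hG
    exact ⟨⟨c, by simp [hc]⟩, (h.mergeOutside_adj_left hc).2 (Or.inr hqc),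
      fun hn => h.not_common_nbr hG hc hn.2 hqc⟩
  have hmem : ∀ w : {w : ((insert p C : Finset V) : Set V) // w ≠ ⟨p, by simp⟩}, w.1.1 ∈ C := by
    rintro ⟨⟨w, hw⟩, hne⟩
    rw [Finset.mem_coe, Finset.mem_insert] at hw
    exact hw.resolve_left fun e => hne (Subtype.ext e)
  refine nonempty_splitCompose_iso
    (Sum.elim (fun a => ⟨a.1, (h.mem_support _).2 (Or.inl a.2)⟩)
      fun b => ⟨b.1.1, (h.mem_support _).2 (Or.inr (hmem b))⟩) ⟨?_, ?_⟩ ?_ ?_ ?_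
  · rintro (a | a) (b | b) hab
    · exact congrArg Sum.inl (Subtype.ext (Subtype.mk.inj hab))
    · exact absurd (Subtype.mk.inj hab)
        fun e => Finset.disjoint_left.1 h.disj a.2 (e ▸ hmem b)
    · exact absurd (Subtype.mk.inj hab)
        fun e => Finset.disjoint_left.1 h.disj b.2 (e ▸ hmem a)
    · exact congrArg Sum.inr (Subtype.ext (Subtype.ext (Subtype.mk.inj hab)))
  · rintro ⟨v, hv⟩
    rcases (h.mem_support v).1 hv with hvB | hvC
    · exact ⟨Sum.inl ⟨v, hvB⟩, rfl⟩
    · exact ⟨Sum.inr ⟨⟨v, by simp [hvC]⟩, fun e => hpC (Subtype.mk.inj e ▸ hvC)⟩, rfl⟩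
  · rintro ⟨a, ha⟩ ⟨b, hb⟩
    simp only [Sum.elim_inl, SimpleGraph.comap_adj, Function.Embedding.subtype_apply,
      addEdgeOn_adj, Subtype.mk.injEq]
    have ha' : a ∈ B := ha
    have hb' : b ∈ B := hb
    have := h.not_adj
    have hqp : ¬ G.Adj q p := fun e => this e.symm
    grind
  · rintro ⟨a, ha⟩ b
    have hb := hmem b
    simp only [Sum.elim_inl, Sum.elim_inr, SimpleGraph.comap_adj,
      Function.Embedding.subtype_apply, Subtype.mk.injEq, Set.mem_ofPred_eq,
      h.mergeOutside_adj_left hb]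
    have := h.sep a ha _ hb
    have := h.not_common_nbr hG hb
    grind
  · intro a b
    exact (h.mergeOutside_adj_right (hmem a) (hmem b)).symm

end IsTwoCut

theorem EdgeCritical.isFourOre (hG : EdgeCritical G) (hpot : 4 ≤ potential G (supportOf G)) :
    IsFourOre (G.induce (supportOf G : Set V)) := by
  induction hk : (supportOf G).card using Nat.strong_induction_on generalizing G with
  | _ k ih =>
  by_cases h4 : (supportOf G).card = 4
  · have : G.induce (supportOf G : Set V) = ⊤ := by
      ext ⟨a, ha⟩ ⟨b, hb⟩
      simp only [SimpleGraph.comap_adj, Function.Embedding.subtype_apply, SimpleGraph.top_adj,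
        ne_eq, Subtype.mk.injEq]
      exact ⟨fun e => e.ne, EdgeCritical.adj_of_card_eq_four hG.1 h4 ha hb⟩
    rw [this]
    exact isFourOre_top (by simpa using h4)
  have hcut : ¬ NoTwoCut G := fun hcut =>
    not_isMinimalBad G ⟨hG, hpot, h4, hcut, fun W _ H hH _ => hH.potential_le⟩
  obtain ⟨B, C, p, q, h⟩ := hG.exists_isTwoCut hcut
  have c1 := h.edgeCritical_addEdgeOn hG
  have c2 := h.edgeCritical_mergeOutside hG
  have s1 := h.supportOf_addEdgeOn
  have s2 := h.supportOf_mergeOutside hG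
  have p1 := c1.potential_le.1
  have p2 := c2.potential_le.1
  have hsum := h.potential_eq hG
  have i1 := ih _ (by rw [← hk, s1]; exact h.card_left_lt) c1 (by rw [s1]; rw [s2] at p2; linarith)
    rfl
  have i2 := ih _ (by rw [← hk, s2]; exact h.card_right_lt) c2
    (by rw [s2]; rw [s1] at p1; linarith) rfl
  refine h.isFourOre hG ?_ ?_
  · rwa [s1] at i1
  · rwa [s2] at i2

/-! ### From the hypotheses of the theorem -/

lemma threeCol_of_colorable {W : Type} {H : SimpleGraph W} (h : H.chromaticNumber < 4) :
    ThreeCol H := by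
  obtain ⟨c⟩ : H.Colorable 3 := by
    rw [← SimpleGraph.chromaticNumber_le_iff_colorable]
    exact Order.le_of_lt_add_one (h.trans_eq (by norm_num))
  exact ⟨c, fun a b hab => c.valid hab⟩

lemma IsFourCritical.not_threeCol (h : IsFourCritical G) : ¬ ThreeCol G := by
  rintro ⟨f, hf⟩
  have : G.Colorable 3 := ⟨SimpleGraph.Coloring.mk f fun {a b} hab => hf a b hab⟩
  have h3 := this.chromaticNumber_le
  rw [h.1] at h3
  exact absurd h3 (by decide)

lemma IsFourCritical.edgeCritical (h : IsFourCritical G) : EdgeCritical G := by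
  refine ⟨h.not_threeCol, fun H hle hne => ?_⟩
  obtain ⟨a, b, hab, hn⟩ : ∃ a b, G.Adj a b ∧ ¬ H.Adj a b := by
    by_contra! hc
    exact hne (le_antisymm hle fun a b hab => hc a b hab)
  refine (threeCol_of_colorable (h.2.2 s(a, b) hab)).mono fun x y hxy => ?_
  rw [SimpleGraph.deleteEdges_adj]
  refine ⟨hle hxy, fun e => hn ?_⟩
  have : s(x, y) ∈ H.edgeSet := hxy
  rwa [Set.mem_singleton_iff.1 e] at this

lemma IsFourCritical.supportOf_eq_univ (h : IsFourCritical G) : supportOf G = Finset.univ := by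
  rw [Finset.eq_univ_iff_forall]
  intro v
  rw [mem_supportOf]
  by_contra! hv
  obtain ⟨f, hf⟩ := threeCol_of_colorable (h.2.1 v)
  refine h.not_threeCol ⟨fun u => if hu : u ≠ v then f ⟨u, hu⟩ else 0, fun a b hab => ?_⟩
  have ha : a ≠ v := by rintro rfl; exact hv b hab
  have hb : b ≠ v := by rintro rfl; exact hv a hab.symm
  simpa only [ha, hb, ne_eq, not_false_eq_true, dite_true] using hf ⟨a, ha⟩ ⟨b, hb⟩ hab

lemma potential_univ (G : SimpleGraph V) :
    potential G Finset.univ = 10 * Fintype.card V - 6 * Nat.card G.edgeSet := by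
  have h1 : pairCount G Finset.univ Finset.univ = ((∑ v, G.degree v : ℕ) : ℤ) := by
    unfold pairCount
    push_cast
    refine Finset.sum_congr rfl fun v _ => ?_
    rw [← SimpleGraph.card_neighborFinset_eq_degree, SimpleGraph.neighborFinset_eq_filter,
      Finset.card_filter]
    push_cast
    rfl
  rw [potential, h1, G.sum_degrees_eq_twice_card_edges, Nat.card_eq_fintype_card,
    ← SimpleGraph.edgeFinset_card]
  push_cast
  rw [Finset.card_univ]
  ring

end OreConstruction

/-- **Kostochka–Yancey, equality case.** A `4`-critical graph on `n` vertices with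
exactly `(5n - 2)/3` edges is a `4`-Ore graph. -/
theorem fourOre_of_fourCritical_edge_equality {V : Type} [Fintype V]
    (G : SimpleGraph V) (hcrit : IsFourCritical G)
    (hedge : 3 * Nat.card G.edgeSet + 2 = 5 * Fintype.card V) :
    IsFourOre G := by
  have hsupp := hcrit.supportOf_eq_univ
  have hpot : 4 ≤ potential G (supportOf G) := by
    rw [hsupp, potential_univ]
    omega
  refine (hcrit.edgeCritical.isFourOre hpot).of_iso ?_
  rw [hsupp, Finset.coe_univ]
  exact SimpleGraph.induceUnivIso G |>.symm
end
end
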